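/- There exist constants d_j > 0, j = 1,…,m, such that the scaling parameters satisfy δ_{j,k} = d_j λ_k^{1/2} + o(λ_k^{1/2}), and consequently the local maxima satisfy v_k(x_{j,k}) = −2 log λ_k − 2 log d_j − log V(x_{j,k}) + o(1) as k → ∞. -/

import Mathlib

open MeasureTheory Real Filter Topology Metric Bornology
open scoped RealInnerProductSpace

noncomputable section

/-- The plane `ℝ²`. -/
abbrev E2 : Type := EuclideanSpace ℝ (Fin 2)

/-- The Laplacian of a function on the plane, as the sum of the second partial
derivatives in the coordinate directions. -/
def lap (f : E2 → ℝ) (x : E2) : ℝ :=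
  ∑ i : Fin 2,
    fderiv ℝ (fun y => fderiv ℝ f y (EuclideanSpace.single i 1)) x (EuclideanSpace.single i 1)

/-- `G` is the Dirichlet Green function of `-Δ` on `Ω`, with regular part `K`
(so that `x ↦ K x x` is the Robin function). -/
structure IsGreen (Ω : Set E2) (G K : E2 → E2 → ℝ) : Prop where
  symm : ∀ x y, G x y = G y x
  decomp : ∀ x ∈ Ω, ∀ y ∈ Ω, x ≠ y →
    G x y = -(1 / (2 * π)) * Real.log (dist x y) + K x y
  harmK : ∀ y ∈ Ω, ∀ x ∈ Ω, lap (fun z => K z y) x = 0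
  harmG : ∀ y ∈ Ω, ∀ x ∈ Ω, x ≠ y → lap (fun z => G z y) x = 0
  bdry : ∀ y ∈ Ω, ∀ x ∈ frontier Ω, G x y = 0
  contK : ContinuousOn (fun p : E2 × E2 => K p.1 p.2) (closure Ω ×ˢ Ω ∪ Ω ×ˢ closure Ω)

/-- The Hamiltonian `H^m_V` of the system of `m`-point vortices:
`H^m_V(x₁,…,x_m) = ½ Σᵢ R(xᵢ) + Σ_{i<j} G(xᵢ,xⱼ) + (1/8π) Σᵢ log V(xᵢ)`. -/
def Ham (m : ℕ) (G K : E2 → E2 → ℝ) (V : E2 → ℝ) (x : Fin m → E2) : ℝ :=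
  (1 / 2) * ∑ i, K (x i) (x i)
    + ∑ i, ∑ j, (if i < j then G (x i) (x j) else 0)
    + (1 / (8 * π)) * ∑ i, Real.log (V (x i))

/-- The standard bubble `U(x) = log (1/(1+|x|²/8)²)`. -/
def U (x : E2) : ℝ := Real.log (1 / (1 + ‖x‖ ^ 2 / 8) ^ 2)

/-- `Λ` lists the eigenvalues (with multiplicity, in nondecreasing order) of the real
symmetric matrix `M`, as witnessed by an orthonormal eigenbasis. -/
def IsEigList {N : ℕ} (M : Matrix (Fin N) (Fin N) ℝ) (Λ : Fin N → ℝ) : Prop :=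
  Monotone Λ ∧ ∃ b : Fin N → (Fin N → ℝ),
    (∀ i i', (∑ t, b i t * b i' t) = if i = i' then 1 else 0) ∧
    ∀ i, M.mulVec (b i) = Λ i • b i

/-- The standing setting: a family `v_k` of solutions of the Liouville–Gel'fand problem
`-Δv = λ_k V e^v` in `Ω`, `v = 0` on `∂Ω`, blowing up at the `m` interior points
`x*₁, …, x*_m`, with local maximum points `x_{j,k} → x*_j`. -/
structure Setting (m : ℕ) where
  /-- the bounded planar domain -/
  Ω : Set E2
  /-- the positive coefficient `V ∈ C¹(Ω̄)` -/
  V : E2 → ℝ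
  /-- the parameters `λ_k ↓ 0` -/
  lam : ℕ → ℝ
  /-- the blow-up solutions -/
  v : ℕ → E2 → ℝ
  /-- the Dirichlet Green function of `-Δ` on `Ω` -/
  G : E2 → E2 → ℝ
  /-- its regular part; `x ↦ K x x` is the Robin function -/
  K : E2 → E2 → ℝ
  /-- the blow-up points -/
  xstar : Fin m → E2
  /-- the local maximum points `x_{j,k}` -/
  xpt : Fin m → ℕ → E2
  /-- the fixed small radius -/
  R : ℝ
  hm : 0 < m
  hopen : IsOpen Ω
  hbd : IsBounded Ω
  hconn : IsConnected Ω
  hVpos : ∀ x ∈ closure Ω, 0 < V x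
  hVreg : ContDiffOn ℝ 1 V (closure Ω)
  hgreen : IsGreen Ω G K
  hlam_pos : ∀ k, 0 < lam k
  hlam_anti : StrictAnti lam
  hlam0 : Tendsto lam atTop (𝓝 0)
  hv_reg : ∀ k, ContDiffOn ℝ 2 (v k) Ω
  hv_cont : ∀ k, ContinuousOn (v k) (closure Ω)
  hPDE : ∀ k, ∀ x ∈ Ω, -lap (v k) x = lam k * V x * Real.exp (v k x)
  hBC : ∀ k, ∀ x ∈ frontier Ω, v k x = 0
  hblow : Tendsto (fun k => ⨆ x ∈ closure Ω, |v k x|) atTop atTop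
  hmass : Tendsto (fun k => ∫ x in Ω, lam k * V x * Real.exp (v k x)) atTop (𝓝 (8 * π * m))
  hx_mem : ∀ j, xstar j ∈ Ω
  hx_inj : Function.Injective xstar
  hS : {x ∈ closure Ω | ∃ z : ℕ → E2, (∀ k, z k ∈ Ω) ∧ Tendsto z atTop (𝓝 x) ∧
      Tendsto (fun k => v k (z k)) atTop atTop} = Set.range xstar
  hR : 0 < R
  hR2 : ∀ j, closedBall (xstar j) (2 * R) ⊆ Ω
  hRdisj : ∀ i j, i ≠ j → Disjoint (ball (xstar i) R) (ball (xstar j) R)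
  hxpt_lim : ∀ j, Tendsto (fun k => xpt j k) atTop (𝓝 (xstar j))
  hxpt_mem : ∀ j k, xpt j k ∈ ball (xstar j) R
  hxpt_max : ∀ j k, ∀ x ∈ ball (xpt j k) R, v k x ≤ v k (xpt j k)
  hxpt_blow : ∀ j, Tendsto (fun k => v k (xpt j k)) atTop atTop

namespace Setting

variable {m : ℕ}

/-- The scaling parameter `δ_{j,k} > 0`, defined by
`λ_k V(x_{j,k}) e^{v_k(x_{j,k})} δ_{j,k}² = 1`. -/
def delta (S : Setting m) (j : Fin m) (k : ℕ) : ℝ :=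
  (Real.sqrt (S.lam k * S.V (S.xpt j k) * Real.exp (S.v k (S.xpt j k))))⁻¹

/-- The local mass `σ_{j,k} = ∫_{B_R(x_{j,k})} λ_k V e^{v_k}`. -/
def sigmaLoc (S : Setting m) (j : Fin m) (k : ℕ) : ℝ :=
  ∫ x in ball (S.xpt j k) S.R, S.lam k * S.V x * Real.exp (S.v k x)

/-- The entries of the matrix `(h_{ij})`:
`h_{ii} = R(x*_i) + 2 Σ_{h ≠ i} G(x*_h, x*_i) + (1/4π) log V(x*_i)`,
`h_{ij} = -G(x*_i, x*_j)` for `i ≠ j`. -/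
def hEnt (S : Setting m) (i j : Fin m) : ℝ :=
  if i = j then
    S.K (S.xstar i) (S.xstar i)
      + 2 * ∑ h, (if h = i then 0 else S.G (S.xstar h) (S.xstar i))
      + 1 / (4 * π) * Real.log (S.V (S.xstar i))
  else -S.G (S.xstar i) (S.xstar j)

/-- The matrix `(h_{ij})`. -/
def hmat (S : Setting m) : Matrix (Fin m) (Fin m) ℝ := Matrix.of S.hEnt

end Setting

/-- The eigenpairs `(μⁿ_k, wⁿ_k)` of the linearized problem
`-Δw = μ λ_k V e^{v_k} w` in `Ω`, `w = 0` on `∂Ω`, indexed by `n = 1, 2, …`,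
normalized by `‖wⁿ_k‖_∞ = max wⁿ_k = 1`, ordered, and orthogonal in `H¹₀`. -/
structure EigenData {m : ℕ} (S : Setting m) where
  /-- the `n`-th eigenvalue `μⁿ_k` (`n ≥ 1`) -/
  mu : ℕ → ℕ → ℝ
  /-- the `n`-th eigenfunction `wⁿ_k` -/
  w : ℕ → ℕ → E2 → ℝ
  hw_reg : ∀ n k, ContDiffOn ℝ 2 (w n k) S.Ω
  hw_cont : ∀ n k, ContinuousOn (w n k) (closure S.Ω)
  hPDE : ∀ n k, ∀ x ∈ S.Ω,
    -lap (w n k) x = mu n k * S.lam k * S.V x * Real.exp (S.v k x) * w n k x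
  hBC : ∀ n k, ∀ x ∈ frontier S.Ω, w n k x = 0
  hbound : ∀ n k, ∀ x ∈ closure S.Ω, |w n k x| ≤ 1
  hmax : ∀ n k, ∃ x ∈ closure S.Ω, w n k x = 1
  hpos : ∀ k, 0 < mu 1 k
  hlt : ∀ k, mu 1 k < mu 2 k
  hmono : ∀ k n, 2 ≤ n → mu n k ≤ mu (n + 1) k
  hdiv : ∀ k, Tendsto (fun n => mu n k) atTop atTop
  horth : ∀ k n n', 1 ≤ n → 1 ≤ n' → n ≠ n' →
    (∫ x in S.Ω, ⟪gradient (w n k) x, gradient (w n' k) x⟫) = 0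

/-- `c = (c₁,…,c_m) ≠ 0` is the limit vector of the rescaled `n`-th eigenfunctions
`w̃ⁿ_{j,k}(x) = wⁿ_k(δ_{j,k} x + x_{j,k}) → c_j` locally uniformly in `ℝ²`,
along the subsequence `φ`. -/
def IsLimitVec {m : ℕ} (S : Setting m) (W : EigenData S) (φ : ℕ → ℕ) (n : ℕ)
    (c : Fin m → ℝ) : Prop :=
  c ≠ 0 ∧ ∀ j : Fin m,
    TendstoLocallyUniformly
      (fun k (x : E2) => W.w n (φ k) (S.delta j (φ k) • x + S.xpt j (φ k)))
      (fun _ => c j) atTop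

/-- A sequence of (eigen)functions `w_k` concentrates at `κ`: there are `C > 0`
and `κ_k → κ` in `Ω` with `|w_k(κ_k)| ≥ C` for `k ≫ 1`. -/
def ConcentratesAt {m : ℕ} (S : Setting m) (wk : ℕ → E2 → ℝ) (κ : E2) : Prop :=
  ∃ C > 0, ∃ z : ℕ → E2, (∀ k, z k ∈ S.Ω) ∧ Tendsto z atTop (𝓝 κ) ∧
    ∀ᶠ k in atTop, C ≤ |wk k (z k)|

/-- The index `j` of the coordinate pair to which the `i`-th coordinate of
`ℝ^{2m} ≃ (ℝ²)^m` belongs. -/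
def coordIdx {m : ℕ} (i : Fin (2 * m)) : Fin m := ⟨i.1 / 2, by have h := i.isLt; omega⟩

/-- The `i`-th coordinate direction of `(ℝ²)^m ≃ ℝ^{2m}`. -/
def coordBasis (m : ℕ) (i : Fin (2 * m)) : Fin m → E2 :=
  Pi.single (coordIdx i) (EuclideanSpace.single ⟨i.1 % 2, by omega⟩ 1)

/-- The Hessian of the Hamiltonian `H^m_V` at `x0`, as a `2m × 2m` array of second
directional derivatives. -/
def hessHam (m : ℕ) (G K : E2 → E2 → ℝ) (V : E2 → ℝ) (x0 : Fin m → E2)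
    (i j : Fin (2 * m)) : ℝ :=
  fderiv ℝ (fun x => fderiv ℝ (Ham m G K V) x (coordBasis m j)) x0 (coordBasis m i)

section
open MeasureTheory Real Filter Topology Metric Bornology
open scoped RealInnerProductSpace

namespace BU

lemma radial_integral (f : ℝ → ℝ) :
    ∫ x : ℂ, f ‖x‖ = 2 * π * ∫ y in Set.Ioi (0:ℝ), y * f y := by
  rw [integral_fun_norm_addHaar (volume : Measure ℂ) f]
  have h1 : (volume : Measure ℂ).real (ball 0 1) = π := by
    simp [Measure.real, Complex.volume_ball]
  rw [h1, Complex.finrank_real_complex]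
  simp only [smul_eq_mul, nsmul_eq_mul]
  norm_num
  ring

lemma vol_ball (a : ℂ) {r : ℝ} (hr : 0 ≤ r) : (volume : Measure ℂ).real (ball a r) = π * r ^ 2 := by
  simp [Measure.real, Complex.volume_ball, ENNReal.toReal_ofReal hr]; ring

/-- the truncated singular kernel -/
def ker (a s : ℝ) (x : ℂ) : ℝ := (ball (0:ℂ) s).indicator (fun x => ‖x‖ ^ (-a)) x

lemma ker_eq (a s : ℝ) (x : ℂ) : ker a s x = (Set.Iio s).indicator (fun t : ℝ => t ^ (-a)) ‖x‖ := by
  simp only [ker, Set.indicator, mem_ball, dist_zero_right, Set.mem_Iio]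

lemma ker_nonneg (a s : ℝ) (x : ℂ) : 0 ≤ ker a s x := by
  unfold ker
  apply Set.indicator_nonneg
  intro x _
  positivity

lemma ker_integrable {a s : ℝ} (ha : a < 2) (hs : 0 < s) : Integrable (ker a s) := by
  unfold ker
  rw [integrable_indicator_iff measurableSet_ball,
    integrableOn_fun_norm_addHaar (volume : Measure ℂ) (f := fun t : ℝ => t ^ (-a)),
    Complex.finrank_real_complex]
  have h := (intervalIntegral.intervalIntegrable_rpow' (a := 0) (b := s) (r := 1 - a) (by linarith))
  rw [intervalIntegrable_iff_integrableOn_Ioo_of_le hs.le] at h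
  refine h.congr_fun ?_ measurableSet_Ioo
  intro t ht
  simp only [smul_eq_mul]
  rw [show (1 - a) = 1 + (-a) by ring, Real.rpow_add ht.1]
  norm_num

lemma ker_integral {a s : ℝ} (ha : a < 2) (hs : 0 < s) :
    ∫ x, ker a s x = 2 * π * (s ^ (2 - a) / (2 - a)) := by
  simp_rw [ker_eq]
  rw [radial_integral]
  congr 1
  have : ∀ y ∈ Set.Ioi (0:ℝ), y * (Set.Iio s).indicator (fun t : ℝ => t ^ (-a)) y
      = (Set.Ioo 0 s).indicator (fun t : ℝ => t ^ (1 - a)) y := by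
    intro y hy
    simp only [Set.indicator, Set.mem_Iio, Set.mem_Ioo]
    have hy' : (0:ℝ) < y := hy
    by_cases h : y < s
    · simp only [h, hy', if_true, and_self]
      rw [show (1 - a) = 1 + (-a) by ring, Real.rpow_add hy']
      norm_num
    · simp [h]
  rw [setIntegral_congr_fun measurableSet_Ioi this, setIntegral_indicator measurableSet_Ioo]
  have h2 : Set.Ioi (0:ℝ) ∩ Set.Ioo 0 s = Set.Ioo 0 s := by
    ext x; simp
  rw [h2, ← integral_Ioc_eq_integral_Ioo, ← intervalIntegral.integral_of_le hs.le,
    integral_rpow (Or.inl (by linarith))]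
  rw [show 1 - a + 1 = 2 - a by ring, Real.zero_rpow (by linarith)]
  ring

lemma ker_integral_sub {a s : ℝ} (ha : a < 2) (hs : 0 < s) (z : ℂ) :
    Integrable (fun y => ker a s (z - y)) ∧
    ∫ y, ker a s (z - y) = 2 * π * (s ^ (2 - a) / (2 - a)) := by
  refine ⟨(ker_integrable ha hs).comp_sub_left z, ?_⟩
  rw [integral_sub_left_eq_self (ker a s) volume z, ker_integral ha hs]

lemma riesz_ptwise {a s A : ℝ} (ha0 : 0 ≤ a) (hs : 0 < s) {g : ℂ → ℝ} {z y : ℂ} (hg0 : 0 ≤ g y)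
    (hA : y ∈ ball z s → g y ≤ A) :
    g y * ‖z - y‖ ^ (-a) ≤ A * ker a s (z - y) + s ^ (-a) * g y := by
  by_cases hy : y ∈ ball z s
  · have : z - y ∈ ball (0:ℂ) s := by
      rw [mem_ball_zero_iff, ← dist_eq_norm, dist_comm]; exact hy
    have h1 : ker a s (z - y) = ‖z - y‖ ^ (-a) := by simp only [ker, Set.indicator_of_mem this]
    rw [h1]
    have h2 : 0 ≤ ‖z - y‖ ^ (-a) := by positivity
    have h3 : 0 ≤ s ^ (-a) := by positivity
    nlinarith [mul_le_mul_of_nonneg_right (hA hy) h2, mul_nonneg h3 hg0]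
  · have h0 : z - y ∉ ball (0:ℂ) s := by
      rw [mem_ball_zero_iff, ← dist_eq_norm, dist_comm]; exact hy
    have h1 : ker a s (z - y) = 0 := by simp only [ker, Set.indicator_of_notMem h0]
    rw [h1]
    have h4 : s ≤ ‖z - y‖ := by
      rw [mem_ball_zero_iff] at h0; linarith
    have h5 : ‖z - y‖ ^ (-a) ≤ s ^ (-a) :=
      Real.rpow_le_rpow_of_nonpos hs h4 (by linarith)
    nlinarith

/-- Riesz potential bound. -/
lemma riesz {a s A : ℝ} (ha0 : 0 ≤ a) (ha : a < 2) (hs : 0 < s) {g : ℂ → ℝ} {z : ℂ}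
    (hg : Integrable g) (hg0 : ∀ y, 0 ≤ g y) (hA : ∀ y ∈ ball z s, g y ≤ A) :
    Integrable (fun y => g y * ‖z - y‖ ^ (-a)) ∧
    ∫ y, g y * ‖z - y‖ ^ (-a) ≤ A * (2 * π * (s ^ (2 - a) / (2 - a))) + s ^ (-a) * ∫ y, g y := by
  obtain ⟨h1, h2⟩ := ker_integral_sub ha hs z
  have hI : Integrable (fun y => A * ker a s (z - y) + s ^ (-a) * g y) :=
    (h1.const_mul A).add (hg.const_mul _)
  have hI2 : Integrable (fun y => g y * ‖z - y‖ ^ (-a)) := by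
    refine hI.mono' ?_ ?_
    · refine hg.aestronglyMeasurable.mul ?_
      have : Measurable (fun y : ℂ => ‖z - y‖ ^ (-a)) := by fun_prop
      exact this.aestronglyMeasurable
    · filter_upwards with y
      rw [Real.norm_of_nonneg (mul_nonneg (hg0 y) (by positivity))]
      exact riesz_ptwise ha0 hs (hg0 y) (hA y)
  refine ⟨hI2, ?_⟩
  calc _ ≤ ∫ y, (A * ker a s (z - y) + s ^ (-a) * g y) :=
        integral_mono hI2 hI (fun y => riesz_ptwise ha0 hs (hg0 y) (hA y))
    _ = _ := by
        rw [integral_add (h1.const_mul A) (hg.const_mul _), integral_const_mul, integral_const_mul,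
          h2]

/-- Riesz potential bound with `a = 1`. -/
lemma riesz1 {s A : ℝ} (hs : 0 < s) {g : ℂ → ℝ} {z : ℂ}
    (hg : Integrable g) (hg0 : ∀ y, 0 ≤ g y) (hA : ∀ y ∈ ball z s, g y ≤ A) :
    Integrable (fun y => g y * ‖z - y‖⁻¹) ∧
    ∫ y, g y * ‖z - y‖⁻¹ ≤ 2 * π * A * s + s⁻¹ * ∫ y, g y := by
  have h := riesz (a := 1) (by norm_num) (by norm_num) hs hg hg0 hA
  simp only [Real.rpow_neg_one] at h
  refine ⟨h.1, h.2.trans (le_of_eq ?_)⟩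
  norm_num
  ring

lemma abs_log_le {t : ℝ} (ht : 0 ≤ t) : |Real.log t| ≤ t + t⁻¹ := by
  rcases ht.eq_or_lt with rfl | ht
  · simp
  have h1 := Real.log_le_self ht.le
  have h2 := Real.log_le_self (inv_pos.2 ht).le
  rw [Real.log_inv] at h2
  have := inv_pos.2 ht
  rw [abs_le]; constructor <;> linarith

lemma abs_log_sub_le {a b : ℝ} (ha : 0 < a) (hb : 0 < b) :
    |Real.log a - Real.log b| ≤ |a - b| * (a⁻¹ + b⁻¹) := by
  have key : ∀ {a b : ℝ}, 0 < a → 0 < b → Real.log a - Real.log b ≤ |a - b| * b⁻¹ := by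
    intro a b ha hb
    rw [← Real.log_div ha.ne' hb.ne']
    have h := Real.log_le_sub_one_of_pos (div_pos ha hb)
    have h2 : a / b - 1 = (a - b) * b⁻¹ := by field_simp
    rw [h2] at h
    exact h.trans (mul_le_mul_of_nonneg_right (le_abs_self _) (inv_pos.2 hb).le)
  have h1 := key ha hb
  have h2 := key hb ha
  rw [abs_sub_comm] at h2
  have h3 : 0 ≤ |a - b| * a⁻¹ := by positivity
  have h4 : 0 ≤ |a - b| * b⁻¹ := by positivity
  rw [mul_add, abs_le]
  constructor <;> linarith

lemma abs_log_norm_sub_le (z z' y : ℂ) (h : z ≠ y) (h' : z' ≠ y) :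
    |Real.log ‖z - y‖ - Real.log ‖z' - y‖| ≤ ‖z - z'‖ * (‖z - y‖⁻¹ + ‖z' - y‖⁻¹) := by
  refine (abs_log_sub_le (norm_pos_iff.2 (sub_ne_zero.2 h)) (norm_pos_iff.2 (sub_ne_zero.2 h'))).trans ?_
  gcongr
  refine (abs_norm_sub_norm_le _ _).trans (le_of_eq ?_)
  congr 1; ring

lemma ae_ne (z : ℂ) : ∀ᵐ y : ℂ, z ≠ y := by
  have : (volume : Measure ℂ) {z} = 0 := by simp
  rw [ae_iff]
  convert this using 2
  ext y; simp [eq_comm]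

/-- Integrability of `log |z - y| g(y)` for bounded integrable `g` with bounded support. -/
lemma log_integrable {A D : ℝ} {g : ℂ → ℝ} (hg : Integrable g) (hA : ∀ y, |g y| ≤ A)
    (hD : ∀ y, g y ≠ 0 → ‖y‖ ≤ D) (z : ℂ) :
    Integrable (fun y => Real.log ‖z - y‖ * g y) := by
  have h1 := (riesz1 (z := z) one_pos hg.abs (fun y => abs_nonneg _) (A := A) (fun y _ => hA y)).1
  have h2 : Integrable (fun y => (‖z‖ + D) * |g y| + |g y| * ‖z - y‖⁻¹) :=
    (hg.abs.const_mul _).add h1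
  refine h2.mono' ?_ ?_
  · refine AEStronglyMeasurable.mul ?_ hg.aestronglyMeasurable
    have : Measurable (fun y : ℂ => Real.log ‖z - y‖) := by fun_prop
    exact this.aestronglyMeasurable
  · filter_upwards with y
    rw [norm_mul, Real.norm_eq_abs, Real.norm_eq_abs]
    by_cases hy : g y = 0
    · simp [hy]
    have h3 := abs_log_le (norm_nonneg (z - y))
    have h4 : ‖z - y‖ ≤ ‖z‖ + D := (norm_sub_le _ _).trans (by linarith [hD y hy])
    have h5 : |Real.log ‖z - y‖| ≤ (‖z‖ + D) + ‖z - y‖⁻¹ := by linarith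
    nlinarith [mul_le_mul_of_nonneg_right h5 (abs_nonneg (g y))]

/-- Difference kernel integrable for integrable `g` locally bounded near `z, z'`. -/
lemma logdiff {s A : ℝ} (hs : 0 < s) {g : ℂ → ℝ} {z z' : ℂ}
    (hg : Integrable g) (hg0 : ∀ y, 0 ≤ g y) (hA : ∀ y ∈ ball z s, g y ≤ A)
    (hA' : ∀ y ∈ ball z' s, g y ≤ A) :
    Integrable (fun y => (Real.log ‖z - y‖ - Real.log ‖z' - y‖) * g y) ∧
    ∫ y, |(Real.log ‖z - y‖ - Real.log ‖z' - y‖) * g y| ≤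
      ‖z - z'‖ * (2 * (2 * π * A * s + s⁻¹ * ∫ y, g y)) := by
  obtain ⟨h1, h2⟩ := riesz1 hs hg hg0 hA
  obtain ⟨h1', h2'⟩ := riesz1 hs hg hg0 hA'
  have hI : Integrable (fun y => ‖z - z'‖ * (g y * ‖z - y‖⁻¹ + g y * ‖z' - y‖⁻¹)) :=
    (h1.add h1').const_mul _
  have hb : ∀ᵐ y : ℂ, |(Real.log ‖z - y‖ - Real.log ‖z' - y‖) * g y| ≤
      ‖z - z'‖ * (g y * ‖z - y‖⁻¹ + g y * ‖z' - y‖⁻¹) := by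
    filter_upwards [ae_ne z, ae_ne z'] with y hy hy'
    rw [abs_mul, abs_of_nonneg (hg0 y)]
    calc _ ≤ ‖z - z'‖ * (‖z - y‖⁻¹ + ‖z' - y‖⁻¹) * g y :=
          mul_le_mul_of_nonneg_right (abs_log_norm_sub_le z z' y hy hy') (hg0 y)
      _ = _ := by ring
  have hI2 : Integrable (fun y => (Real.log ‖z - y‖ - Real.log ‖z' - y‖) * g y) := by
    refine hI.mono' ?_ hb
    refine AEStronglyMeasurable.mul ?_ hg.aestronglyMeasurable
    have : Measurable (fun y : ℂ => Real.log ‖z - y‖ - Real.log ‖z' - y‖) := by fun_prop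
    exact this.aestronglyMeasurable
  refine ⟨hI2, ?_⟩
  calc _ ≤ ∫ y, ‖z - z'‖ * (g y * ‖z - y‖⁻¹ + g y * ‖z' - y‖⁻¹) :=
        integral_mono_ae hI2.abs hI hb
    _ = ‖z - z'‖ * ((∫ y, g y * ‖z - y‖⁻¹) + ∫ y, g y * ‖z' - y‖⁻¹) := by
        rw [integral_const_mul, integral_add h1 h1']
    _ ≤ _ := by
        gcongr
        linarith

end BU

end

section
open MeasureTheory Real Filter Topology Metric Bornology
open scoped RealInnerProductSpace

namespace BU

/-- Laplacian on `ℂ`. -/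
def lapC (f : ℂ → ℝ) (x : ℂ) : ℝ :=
  fderiv ℝ (fun y => fderiv ℝ f y 1) x 1 + fderiv ℝ (fun y => fderiv ℝ f y Complex.I) x Complex.I

def qe (x : ℂ) (ε : ℝ) (y : ℂ) : ℝ := (y.re - x.re) ^ 2 + (y.im - x.im) ^ 2 + ε ^ 2

lemma qe_pos (x : ℂ) {ε : ℝ} (hε : 0 < ε) (y : ℂ) : 0 < qe x ε y := by unfold qe; positivity

lemma qe_eq (x : ℂ) (ε : ℝ) (y : ℂ) : qe x ε y = ‖x - y‖ ^ 2 + ε ^ 2 := by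
  rw [Complex.sq_norm, Complex.normSq_apply]; simp [qe]; ring

lemma qe_cont (x : ℂ) (ε : ℝ) : Continuous (qe x ε) := by unfold qe; fun_prop

lemma ibp {f f' g g' : ℂ → ℝ} {e : ℂ} (hf : Continuous f) (hf' : Continuous f') (hg : Continuous g)
    (hg' : Continuous g') (hs : HasCompactSupport g) (hs' : HasCompactSupport g')
    (h1 : ∀ x, HasLineDerivAt ℝ f (f' x) x e) (h2 : ∀ x, HasLineDerivAt ℝ g (g' x) x e) :
    ∫ x, f x * g' x = - ∫ x, f' x * g x := by
  have := integral_bilinear_hasLineDerivAt_right_eq_neg_left_of_integrable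
    (μ := (volume : Measure ℂ)) (f := f) (f' := f') (g := g) (g' := g') (v := e)
    (B := ContinuousLinearMap.mul ℝ ℝ) ?_ ?_ ?_ (fun x _ => h1 x) (fun x _ => h2 x)
  · simpa using this
  · simp only [ContinuousLinearMap.mul_apply']
    exact (hf'.mul hg).integrable_of_hasCompactSupport hs.mul_left
  · simp only [ContinuousLinearMap.mul_apply']
    exact (hf.mul hg').integrable_of_hasCompactSupport hs'.mul_left
  · simp only [ContinuousLinearMap.mul_apply']
    exact (hf.mul hg).integrable_of_hasCompactSupport hs.mul_left

lemma ibp2 {f f' f'' φ : ℂ → ℝ} {e : ℂ} (hφ : ContDiff ℝ 2 φ) (hs : HasCompactSupport φ)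
    (hf : Continuous f) (hf' : Continuous f') (hf'' : Continuous f'')
    (h1 : ∀ x, HasLineDerivAt ℝ f (f' x) x e) (h2 : ∀ x, HasLineDerivAt ℝ f' (f'' x) x e) :
    ∫ x, f x * fderiv ℝ (fun y => fderiv ℝ φ y e) x e = ∫ x, f'' x * φ x := by
  have hd1 : ContDiff ℝ 1 (fun y => fderiv ℝ φ y e) :=
    (hφ.fderiv_right (m := 1) (by norm_num)).clm_apply contDiff_const
  have hs1 : HasCompactSupport (fun y => fderiv ℝ φ y e) := hs.fderiv_apply ℝ e
  have hd2 : Continuous (fun x => fderiv ℝ (fun y => fderiv ℝ φ y e) x e) :=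
    (hd1.continuous_fderiv (by norm_num)).clm_apply continuous_const
  have hs2 : HasCompactSupport (fun x => fderiv ℝ (fun y => fderiv ℝ φ y e) x e) :=
    hs1.fderiv_apply ℝ e
  rw [ibp hf hf' hd1.continuous hd2 hs1 hs2 h1
    (fun x => ((hd1.differentiable (by norm_num)) x).hasFDerivAt.hasLineDerivAt e)]
  rw [ibp hf' hf'' hφ.continuous hd1.continuous hs hs1 h2
    (fun x => ((hφ.differentiable (by norm_num)) x).hasFDerivAt.hasLineDerivAt e)]
  simp

lemma lapC_cont {φ : ℂ → ℝ} (hφ : ContDiff ℝ 2 φ) : Continuous (lapC φ) := by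
  have h : ∀ e : ℂ, Continuous (fun x => fderiv ℝ (fun y => fderiv ℝ φ y e) x e) := by
    intro e
    have hd1 : ContDiff ℝ 1 (fun y => fderiv ℝ φ y e) :=
      (hφ.fderiv_right (m := 1) (by norm_num)).clm_apply contDiff_const
    exact (hd1.continuous_fderiv (by norm_num)).clm_apply continuous_const
  exact (h 1).add (h Complex.I)

lemma lapC_supp {φ : ℂ → ℝ} (hs : HasCompactSupport φ) : HasCompactSupport (lapC φ) := by
  have h : ∀ e : ℂ, HasCompactSupport (fun x => fderiv ℝ (fun y => fderiv ℝ φ y e) x e) := by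
    intro e
    exact (hs.fderiv_apply ℝ e).fderiv_apply ℝ e
  exact (h 1).add (h Complex.I)

lemma reg_identity {φ : ℂ → ℝ} (hφ : ContDiff ℝ 2 φ) (hs : HasCompactSupport φ) (x : ℂ) (c : ℝ)
    {ε : ℝ} (hε : 0 < ε) :
    ∫ y, (1 / 2 * Real.log (qe x ε y) - c) * lapC φ y = ∫ y, 2 * ε ^ 2 / (qe x ε y) ^ 2 * φ y := by
  have hq := qe_pos x hε
  have hqc := qe_cont x ε
  have hL : Continuous (fun y => 1 / 2 * Real.log (qe x ε y) - c) :=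
    (continuous_const.mul (hqc.log (fun y => (hq y).ne'))).sub continuous_const
  have hr : Continuous (fun y : ℂ => (y.re - x.re) / qe x ε y) :=
    (by fun_prop : Continuous (fun y : ℂ => y.re - x.re)).div hqc (fun y => (hq y).ne')
  have hi : Continuous (fun y : ℂ => (y.im - x.im) / qe x ε y) :=
    (by fun_prop : Continuous (fun y : ℂ => y.im - x.im)).div hqc (fun y => (hq y).ne')
  have hrr : Continuous (fun y : ℂ => (qe x ε y - 2 * (y.re - x.re) ^ 2) / qe x ε y ^ 2) :=
    (by fun_prop : Continuous (fun y : ℂ => qe x ε y - 2 * (y.re - x.re) ^ 2)).div (by fun_prop)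
      (fun y => (pow_pos (hq y) 2).ne')
  have hii : Continuous (fun y : ℂ => (qe x ε y - 2 * (y.im - x.im) ^ 2) / qe x ε y ^ 2) :=
    (by fun_prop : Continuous (fun y : ℂ => qe x ε y - 2 * (y.im - x.im) ^ 2)).div (by fun_prop)
      (fun y => (pow_pos (hq y) 2).ne')
  have dq1 : ∀ y, HasDerivAt (fun t : ℝ => qe x ε (y + t • (1:ℂ))) (2 * (y.re - x.re)) 0 := by
    intro y
    have : (fun t : ℝ => qe x ε (y + t • (1:ℂ))) =
        fun t : ℝ => (y.re + t - x.re) ^ 2 + (y.im - x.im) ^ 2 + ε ^ 2 := by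
      funext t; simp [qe]
    rw [this]
    have h0 : HasDerivAt (fun t : ℝ => y.re + t - x.re) 1 0 :=
      ((hasDerivAt_id (0:ℝ)).const_add y.re).sub_const x.re
    have := ((h0.pow 2).add_const ((y.im - x.im) ^ 2)).add_const (ε ^ 2)
    simpa using this
  have dqI : ∀ y, HasDerivAt (fun t : ℝ => qe x ε (y + t • Complex.I)) (2 * (y.im - x.im)) 0 := by
    intro y
    have : (fun t : ℝ => qe x ε (y + t • Complex.I)) =
        fun t : ℝ => (y.re - x.re) ^ 2 + (y.im + t - x.im) ^ 2 + ε ^ 2 := by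
      funext t; simp [qe]
    rw [this]
    have h0 : HasDerivAt (fun t : ℝ => y.im + t - x.im) 1 0 :=
      ((hasDerivAt_id (0:ℝ)).const_add y.im).sub_const x.im
    have := ((h0.pow 2).const_add ((y.re - x.re) ^ 2)).add_const (ε ^ 2)
    simpa using this
  have e1 := ibp2 (e := 1) hφ hs hL hr hrr
    (by
      intro y
      unfold HasLineDerivAt
      have := (((dq1 y).log (by simpa using (hq y).ne')).const_mul (1/2)).sub_const c
      convert this using 1
      simp
      field_simp)
    (by
      intro y
      unfold HasLineDerivAt
      have h0 : HasDerivAt (fun t : ℝ => (y + t • (1:ℂ)).re - x.re) 1 0 := by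
        simpa using ((hasDerivAt_id (0:ℝ)).const_add y.re).sub_const x.re
      have := h0.div (dq1 y) (by simpa using (hq y).ne')
      refine this.congr_deriv ?_
      simp
      ring)
  have e2 := ibp2 (e := Complex.I) hφ hs hL hi hii
    (by
      intro y
      unfold HasLineDerivAt
      have := (((dqI y).log (by simpa using (hq y).ne')).const_mul (1/2)).sub_const c
      convert this using 1
      simp
      field_simp)
    (by
      intro y
      unfold HasLineDerivAt
      have h0 : HasDerivAt (fun t : ℝ => (y + t • Complex.I).im - x.im) 1 0 := by
        simpa using ((hasDerivAt_id (0:ℝ)).const_add y.im).sub_const x.im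
      have := h0.div (dqI y) (by simpa using (hq y).ne')
      refine this.congr_deriv ?_
      simp
      ring)
  have hint : ∀ e : ℂ, Integrable (fun y => (1 / 2 * Real.log (qe x ε y) - c) *
      fderiv ℝ (fun y => fderiv ℝ φ y e) y e) := by
    intro e
    have hd1 : ContDiff ℝ 1 (fun y => fderiv ℝ φ y e) :=
      (hφ.fderiv_right (m := 1) (by norm_num)).clm_apply contDiff_const
    have hd2 : Continuous (fun x => fderiv ℝ (fun y => fderiv ℝ φ y e) x e) :=
      (hd1.continuous_fderiv (by norm_num)).clm_apply continuous_const
    exact (hL.mul hd2).integrable_of_hasCompactSupport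
      (((hs.fderiv_apply ℝ e).fderiv_apply ℝ e).mul_left)
  simp only [lapC, mul_add]
  rw [integral_add (hint 1) (hint Complex.I), e1, e2, ← integral_add]
  · congr 1
    funext y
    rw [← add_mul, ← add_div]
    congr 2
    simp only [qe]; ring
  · exact (hrr.mul hφ.continuous).integrable_of_hasCompactSupport hs.mul_left
  · exact (hii.mul hφ.continuous).integrable_of_hasCompactSupport hs.mul_left

/-- integral of the bubble profile -/
lemma bubble_int (s : ℝ) (hs : 0 < s) :
    Integrable (fun z : ℂ => ((‖z‖ ^ 2 + s) ^ 2)⁻¹) ∧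
    ∫ z : ℂ, ((‖z‖ ^ 2 + s) ^ 2)⁻¹ = π / s := by
  have hd : ∀ y ∈ Set.Ici (0:ℝ), HasDerivAt (fun y : ℝ => -(1/2) * (y ^ 2 + s)⁻¹)
      (y * ((y ^ 2 + s) ^ 2)⁻¹) y := by
    intro y _
    have hne : y ^ 2 + s ≠ 0 := by positivity
    have h0 : HasDerivAt (fun y : ℝ => y ^ 2 + s) (2 * y) y := by
      simpa using ((hasDerivAt_id y).pow 2).add_const s
    have := (h0.inv hne).const_mul (-(1/2))
    refine this.congr_deriv ?_
    field_simp
  have ht : Tendsto (fun y : ℝ => -(1/2) * (y ^ 2 + s)⁻¹) atTop (𝓝 0) := by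
    have : Tendsto (fun y : ℝ => y ^ 2 + s) atTop atTop :=
      tendsto_atTop_add_const_right _ _ (tendsto_pow_atTop (by norm_num))
    have h := this.inv_tendsto_atTop.const_mul (-(1/2:ℝ))
    rw [mul_zero] at h
    exact h
  have hpos : ∀ y ∈ Set.Ioi (0:ℝ), 0 ≤ y * ((y ^ 2 + s) ^ 2)⁻¹ := by
    intro y hy
    have : (0:ℝ) < y := hy
    positivity
  constructor
  · have := integrable_fun_norm_addHaar (volume : Measure ℂ) (f := fun t : ℝ => ((t ^ 2 + s) ^ 2)⁻¹)
    rw [this, Complex.finrank_real_complex]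
    have h := integrableOn_Ioi_deriv_of_nonneg' hd hpos ht
    simpa using h
  · rw [radial_integral (fun t : ℝ => ((t ^ 2 + s) ^ 2)⁻¹),
      integral_Ioi_of_hasDerivAt_of_nonneg' hd hpos ht]
    field_simp
    ring

/-- Fundamental identity. -/
lemma fundamental {φ : ℂ → ℝ} (hφ : ContDiff ℝ 2 φ) (hs : HasCompactSupport φ) (x : ℂ) (c : ℝ) :
    Integrable (fun y => (Real.log ‖x - y‖ - c) * lapC φ y) ∧
    φ x = 1 / (2 * π) * ∫ y, (Real.log ‖x - y‖ - c) * lapC φ y := by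
  have hc := lapC_cont hφ
  have hsl := lapC_supp hs
  have hint := hc.integrable_of_hasCompactSupport (μ := volume) hsl
  obtain ⟨A, hA⟩ := hc.bounded_above_of_compact_support hsl
  have hDD : ∃ D, ∀ y, lapC φ y ≠ 0 → ‖y‖ ≤ D := by
    obtain ⟨D, hD⟩ := hsl.isCompact.isBounded.exists_norm_le
    exact ⟨D, fun y hy => hD y (subset_tsupport _ hy)⟩
  obtain ⟨D, hD⟩ := hDD
  have hlog := log_integrable hint (fun y => by simpa using hA y) hD x
  have hI : Integrable (fun y => (Real.log ‖x - y‖ - c) * lapC φ y) := by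
    simp_rw [sub_mul]
    exact hlog.sub (hint.const_mul c)
  refine ⟨hI, ?_⟩
  set e : ℕ → ℝ := fun n => 1 / ((n:ℝ) + 1) with he
  have hepos : ∀ n, 0 < e n := fun n => by simp only [he]; positivity
  have hele : ∀ n, e n ≤ 1 := fun n => by
    simp only [he]; rw [div_le_one (by positivity)]; linarith [(Nat.cast_nonneg n : (0:ℝ) ≤ n)]
  have he0 : Tendsto e atTop (𝓝 0) := tendsto_one_div_add_atTop_nhds_zero_nat
  have hl : Tendsto (fun n => ∫ y, (1 / 2 * Real.log (qe x (e n) y) - c) * lapC φ y) atTop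
      (𝓝 (∫ y, (Real.log ‖x - y‖ - c) * lapC φ y)) := by
    apply tendsto_integral_of_dominated_convergence
      (fun y => |Real.log ‖x - y‖ * lapC φ y| + (‖x - y‖ ^ 2 + |c|) * |lapC φ y|)
    · intro n
      refine Continuous.aestronglyMeasurable ?_
      exact ((continuous_const.mul ((qe_cont x _).log (fun y => (qe_pos x (hepos n) y).ne'))).sub
        continuous_const).mul hc
    · refine hlog.abs.add ?_
      refine Continuous.integrable_of_hasCompactSupport (by fun_prop) ?_
      exact (hsl.comp_left (g := fun t => |t|) (by simp)).mul_left
    · intro n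
      filter_upwards [ae_ne x] with y hy
      have h1 : 0 < ‖x - y‖ := norm_pos_iff.2 (sub_ne_zero.2 hy)
      rw [norm_mul, Real.norm_eq_abs, Real.norm_eq_abs, abs_mul, ← add_mul]
      refine mul_le_mul_of_nonneg_right ?_ (abs_nonneg _)
      have h2 : Real.log ‖x - y‖ ≤ 1 / 2 * Real.log (qe x (e n) y) := by
        have : Real.log (‖x - y‖ ^ 2) ≤ Real.log (qe x (e n) y) := by
          rw [qe_eq]
          exact Real.log_le_log (by positivity) (by nlinarith [hepos n])
        rw [Real.log_pow] at this
        push_cast at this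
        linarith
      have h3 : 1 / 2 * Real.log (qe x (e n) y) ≤ ‖x - y‖ ^ 2 := by
        have h4 := Real.log_le_sub_one_of_pos (qe_pos x (hepos n) y)
        rw [qe_eq] at h4 ⊢
        nlinarith [hepos n, hele n, sq_nonneg ‖x - y‖]
      have h5 := abs_sub (1 / 2 * Real.log (qe x (e n) y)) c
      have h6 : |1 / 2 * Real.log (qe x (e n) y)| ≤ |Real.log ‖x - y‖| + ‖x - y‖ ^ 2 := by
        rw [abs_le]
        constructor
        · linarith [neg_abs_le (Real.log ‖x - y‖), sq_nonneg ‖x - y‖]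
        · linarith [abs_nonneg (Real.log ‖x - y‖)]
      linarith
    · filter_upwards [ae_ne x] with y hy
      have h1 : 0 < ‖x - y‖ := norm_pos_iff.2 (sub_ne_zero.2 hy)
      refine Tendsto.mul_const _ (Tendsto.sub_const ?_ c)
      have h2 : Tendsto (fun n => qe x (e n) y) atTop (𝓝 (‖x - y‖ ^ 2)) := by
        simp_rw [qe_eq]
        simpa using (he0.pow 2).const_add (‖x - y‖ ^ 2)
      have h3 := (h2.log (by positivity)).const_mul (1 / 2)
      rw [Real.log_pow] at h3
      convert h3 using 2
      push_cast; ring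
  have hr : Tendsto (fun n => ∫ y, 2 * e n ^ 2 / (qe x (e n) y) ^ 2 * φ y) atTop
      (𝓝 (2 * π * φ x)) := by
    have hsub : ∀ n, ∫ y, 2 * e n ^ 2 / (qe x (e n) y) ^ 2 * φ y =
        ∫ z : ℂ, 2 * ((‖z‖ ^ 2 + 1) ^ 2)⁻¹ * φ (x + e n • z) := by
      intro n
      have h1 := integral_add_left_eq_self (μ := (volume : Measure ℂ))
        (fun y => 2 * e n ^ 2 / (qe x (e n) y) ^ 2 * φ y) x
      rw [← h1]
      have h2 := Measure.integral_comp_smul_of_nonneg (volume : Measure ℂ)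
        (fun y => 2 * e n ^ 2 / (qe x (e n) (x + y)) ^ 2 * φ (x + y)) (e n) (hR := (hepos n).le)
      rw [Complex.finrank_real_complex, smul_eq_mul] at h2
      have h3 : (∫ y, 2 * e n ^ 2 / (qe x (e n) (x + y)) ^ 2 * φ (x + y)) =
          (e n ^ 2) * ∫ y : ℂ, 2 * e n ^ 2 / (qe x (e n) (x + e n • y)) ^ 2 * φ (x + e n • y) := by
        rw [h2, ← mul_assoc, mul_inv_cancel₀ (pow_pos (hepos n) 2).ne', one_mul]
      rw [h3, ← integral_const_mul]
      congr 1
      funext y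
      have h4 : qe x (e n) (x + e n • y) = e n ^ 2 * (‖y‖ ^ 2 + 1) := by
        rw [qe_eq]
        simp [mul_pow, abs_of_pos (hepos n)]; ring
      rw [h4]
      have := (hepos n).ne'
      have h5 : ‖y‖ ^ 2 + 1 ≠ 0 := by positivity
      field_simp
    simp_rw [hsub]
    obtain ⟨hb1, hb2⟩ := bubble_int 1 one_pos
    have h3 : 2 * π * φ x = ∫ z : ℂ, 2 * ((‖z‖ ^ 2 + 1) ^ 2)⁻¹ * φ x := by
      rw [integral_mul_const, integral_const_mul, hb2]; ring
    rw [h3]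
    obtain ⟨M, hM⟩ := hφ.continuous.bounded_above_of_compact_support hs
    apply tendsto_integral_of_dominated_convergence (fun z => 2 * ((‖z‖ ^ 2 + 1) ^ 2)⁻¹ * M)
    · intro n
      refine Continuous.aestronglyMeasurable ?_
      have : Continuous (fun z : ℂ => ((‖z‖ ^ 2 + 1) ^ 2)⁻¹) :=
        Continuous.inv₀ (by fun_prop) (fun z => by positivity)
      exact (continuous_const.mul this).mul (hφ.continuous.comp (by fun_prop))
    · exact (hb1.const_mul 2).mul_const M
    · intro n
      filter_upwards with z
      rw [norm_mul, Real.norm_of_nonneg (by positivity)]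
      exact mul_le_mul_of_nonneg_left (hM _) (by positivity)
    · filter_upwards with z
      refine Tendsto.const_mul _ ?_
      have : Tendsto (fun n => x + e n • z) atTop (𝓝 (x + (0:ℝ) • z)) :=
        (he0.smul_const z).const_add x
      rw [zero_smul, add_zero] at this
      exact (hφ.continuous.tendsto x).comp this
  have heq : ∀ n, ∫ y, (1 / 2 * Real.log (qe x (e n) y) - c) * lapC φ y =
      ∫ y, 2 * e n ^ 2 / (qe x (e n) y) ^ 2 * φ y := fun n => reg_identity hφ hs x c (hepos n)
  simp_rw [heq] at hl
  have := tendsto_nhds_unique hl hr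
  rw [this]
  field_simp

end BU

end

section
open MeasureTheory Real Filter Topology Metric Bornology
open scoped RealInnerProductSpace

namespace BU

lemma rot_mp (θ r : ℝ) : MeasurePreserving (fun w : ℂ => Complex.exp (θ * Complex.I) * w)
    (volume.restrict (ball 0 r)) (volume.restrict (ball 0 r)) := by
  have h := (rotation (Circle.exp θ)).measurePreserving
  have h2 := h.restrict_preimage (s := ball (0:ℂ) r) measurableSet_ball
  have h3 : (rotation (Circle.exp θ)) ⁻¹' ball (0:ℂ) r = ball 0 r := by
    ext w
    simp only [Set.mem_preimage, mem_ball_zero_iff, LinearIsometryEquiv.norm_map]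
  rw [h3] at h2
  have h4 : (fun w : ℂ => Complex.exp (θ * Complex.I) * w) = (rotation (Circle.exp θ)) := by
    funext w; simp [rotation_apply, Circle.coe_exp]
  rw [h4]; exact h2

lemma rot_circle (F : ℂ → ℝ) (w : ℂ) :
    circleAverage F 0 ‖w‖ =
      (2 * π)⁻¹ * ∫ θ in Set.Ioc 0 (2 * π), F (Complex.exp (θ * Complex.I) * w) := by
  rw [circleAverage_eq_integral_add (η := Complex.arg w),
    intervalIntegral.integral_of_le (by positivity), smul_eq_mul]
  congr 2
  funext θ
  congr 1
  rw [circleMap_zero]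
  push_cast
  rw [add_mul, Complex.exp_add]
  nth_rewrite 3 [← Complex.norm_mul_exp_arg_mul_I w]
  ring

lemma rot_avg {F : ℂ → ℝ} (hm : Measurable F) {r : ℝ} (hF : IntegrableOn F (ball 0 r)) :
    ∫ w in ball (0:ℂ) r, F w = ∫ w in ball (0:ℂ) r, circleAverage F 0 ‖w‖ := by
  simp_rw [rot_circle F, integral_const_mul]
  have hmeas : Measurable (fun p : ℂ × ℝ => F (Complex.exp (p.2 * Complex.I) * p.1)) :=
    hm.comp (by fun_prop)
  have h1 : ∀ θ : ℝ, Integrable (fun w : ℂ => F (Complex.exp (θ * Complex.I) * w))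
      (volume.restrict (ball 0 r)) := fun θ => (rot_mp θ r).integrable_comp_of_integrable hF
  have h2 : ∀ (θ : ℝ) (G : ℂ → ℝ), Measurable G →
      ∫ w in ball (0:ℂ) r, G (Complex.exp (θ * Complex.I) * w)
      = ∫ w in ball (0:ℂ) r, G w := by
    intro θ G hG
    have := (rot_mp θ r)
    conv_rhs => rw [← this.map_eq]
    rw [integral_map this.measurable.aemeasurable hG.aestronglyMeasurable]
  rw [integral_integral_swap]
  · simp_rw [h2 _ F hm]
    rw [integral_const]
    have : (2 * π) ≠ 0 := by positivity
    simp only [measureReal_restrict_apply_univ, Real.volume_real_Ioc, smul_eq_mul]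
    rw [max_eq_left (by linarith [Real.pi_pos])]
    field_simp
    ring
  · change Integrable (fun p : ℂ × ℝ => F (Complex.exp (p.2 * Complex.I) * p.1)) _
    rw [integrable_prod_iff' hmeas.aestronglyMeasurable]
    refine ⟨Eventually.of_forall (fun θ => h1 θ), ?_⟩
    simp only [Function.uncurry]
    have : ∀ θ : ℝ, ∫ w in ball (0:ℂ) r, ‖F (Complex.exp (θ * Complex.I) * w)‖
      = ∫ w in ball (0:ℂ) r, ‖F w‖ := fun θ => h2 θ _ hm.norm
    simp_rw [this]
    exact integrable_const _

/-- `L x s y`: integral of `log |z - y|` over `z ∈ B_s(x)`. -/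
def Lb (x : ℂ) (s : ℝ) (y : ℂ) : ℝ := ∫ z in ball x s, Real.log ‖z - y‖

lemma log_int_ball (x : ℂ) (s : ℝ) (y : ℂ) : IntegrableOn (fun z => Real.log ‖z - y‖) (ball x s) := by
  have h := log_integrable (A := 1) (D := ‖x‖ + s) (g := (ball x s).indicator (fun _ => (1:ℝ)))
    ((integrable_indicator_iff measurableSet_ball).2 (integrableOn_const measure_ball_lt_top.ne))
    (fun z => by
      by_cases h : z ∈ ball x s <;> simp [h])
    (fun z hz => by
      by_cases h : z ∈ ball x s
      · rw [mem_ball, dist_eq_norm] at h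
        have := norm_sub_norm_le z x
        linarith
      · simp [h] at hz) y
  rw [← integrable_indicator_iff measurableSet_ball]
  refine h.congr (Eventually.of_forall fun z => ?_)
  by_cases h : z ∈ ball x s
  · simp [h, norm_sub_rev]
  · simp [h]

lemma Lb_eq (x : ℂ) (s : ℝ) (y : ℂ) :
    Lb x s y = ∫ w in ball (0:ℂ) s, (Real.log ‖w‖ + Real.posLog (‖w‖⁻¹ * ‖x - y‖)) := by
  have h1 : Lb x s y = ∫ w in ball (0:ℂ) s, Real.log ‖w - (y - x)‖ := by
    unfold Lb
    have := (measurePreserving_add_left (volume : Measure ℂ) x).setIntegral_preimage_emb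
      (measurableEmbedding_addLeft x) (fun z => Real.log ‖z - y‖) (ball x s)
    rw [← this]
    have h2 : (fun w => x + w) ⁻¹' ball x s = ball (0:ℂ) s := by
      ext w; simp
    rw [h2]
    congr 1
    funext w
    congr 2
    ring
  rw [h1, rot_avg (F := fun w => Real.log ‖w - (y - x)‖) (by fun_prop) (log_int_ball 0 s (y - x))]
  have h0 : ∀ᵐ w : ℂ ∂(volume.restrict (ball 0 s)), (0:ℂ) ≠ w := ae_restrict_of_ae (ae_ne 0)
  refine integral_congr_ae ?_
  filter_upwards [h0] with w hw
  rw [circleAverage_log_norm_sub_const_eq_log_radius_add_posLog (norm_ne_zero_iff.2 hw.symm)]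
  congr 3
  rw [zero_sub, neg_sub]

lemma log_posLog_eq {a b : ℝ} (ha : 0 < a) (hb : 0 < b) :
    Real.log a + Real.posLog (a⁻¹ * b) = max (Real.log a) (Real.log b) := by
  have : Real.posLog (a⁻¹ * b) = max 0 (Real.log (a⁻¹ * b)) := rfl
  rw [this, Real.log_mul (by positivity) hb.ne', Real.log_inv]
  rcases le_total (Real.log a) (Real.log b) with h | h
  · rw [max_eq_right h, max_eq_right (by linarith)]; ring
  · rw [max_eq_left h, max_eq_left (by linarith)]; ring

lemma log_posLog_int (x : ℂ) (s : ℝ) {y : ℂ} (hxy : x ≠ y) :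
    Lb x s y = ∫ w in ball (0:ℂ) s, max (Real.log ‖w‖) (Real.log ‖x - y‖) := by
  rw [Lb_eq]
  have h0 : ∀ᵐ w : ℂ ∂(volume.restrict (ball 0 s)), (0:ℂ) ≠ w := ae_restrict_of_ae (ae_ne 0)
  refine integral_congr_ae ?_
  filter_upwards [h0] with w hw
  exact log_posLog_eq (norm_pos_iff.2 hw.symm) (norm_pos_iff.2 (sub_ne_zero.2 hxy))

lemma vol_real {x : ℂ} {s : ℝ} (hs : 0 ≤ s) : volume.real (ball x s) = π * s ^ 2 := by
  rw [measureReal_def, Complex.volume_ball]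
  simp [ENNReal.toReal_mul, hs]; ring

lemma Lb_far {x : ℂ} {s : ℝ} (hs : 0 < s) {y : ℂ} (hxy : s ≤ ‖x - y‖) :
    Lb x s y = π * s ^ 2 * Real.log ‖x - y‖ := by
  have hne : x ≠ y := by
    rintro rfl
    simp at hxy; linarith
  rw [log_posLog_int x s hne]
  have h0 : ∀ᵐ w : ℂ ∂(volume.restrict (ball 0 s)), (0:ℂ) ≠ w := ae_restrict_of_ae (ae_ne 0)
  have h1 : ∫ w in ball (0:ℂ) s, max (Real.log ‖w‖) (Real.log ‖x - y‖) =
      ∫ w in ball (0:ℂ) s, Real.log ‖x - y‖ := by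
    refine integral_congr_ae ?_
    filter_upwards [h0, ae_restrict_mem measurableSet_ball] with w hw hw2
    rw [max_eq_right]
    refine Real.log_le_log (norm_pos_iff.2 hw.symm) ?_
    rw [mem_ball_zero_iff] at hw2
    linarith
  rw [h1, setIntegral_const, vol_real hs.le, smul_eq_mul]

lemma Lb_ge {x : ℂ} {s : ℝ} (hs : 0 < s) {y : ℂ} (hxy : x ≠ y) :
    π * s ^ 2 * Real.log ‖x - y‖ ≤ Lb x s y := by
  rw [log_posLog_int x s hxy]
  have h1 : π * s ^ 2 * Real.log ‖x - y‖ = ∫ w in ball (0:ℂ) s, Real.log ‖x - y‖ := by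
    rw [setIntegral_const, vol_real hs.le, smul_eq_mul]
  have hc : IntegrableOn (fun _ : ℂ => Real.log ‖x - y‖) (ball 0 s) :=
    integrableOn_const measure_ball_lt_top.ne
  have hl : IntegrableOn (fun w : ℂ => Real.log ‖w‖) (ball 0 s) := by
    simpa using log_int_ball 0 s 0
  rw [h1]
  exact integral_mono hc (hl.sup hc) (fun w => le_max_right _ _)

lemma Lb_le {x : ℂ} {s : ℝ} (hs : 0 < s) {y : ℂ} (hxy : x ≠ y) (hy : ‖x - y‖ ≤ s) :
    Lb x s y ≤ π * s ^ 2 * Real.log s := by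
  rw [log_posLog_int x s hxy]
  have h1 : π * s ^ 2 * Real.log s = ∫ w in ball (0:ℂ) s, Real.log s := by
    rw [setIntegral_const, vol_real hs.le, smul_eq_mul]
  have hc : ∀ c : ℝ, IntegrableOn (fun _ : ℂ => c) (ball 0 s) := fun c =>
    integrableOn_const measure_ball_lt_top.ne
  have hl : IntegrableOn (fun w : ℂ => Real.log ‖w‖) (ball 0 s) := by
    simpa using log_int_ball 0 s 0
  rw [h1]
  have h0 : ∀ᵐ w : ℂ ∂(volume.restrict (ball 0 s)), (0:ℂ) ≠ w := ae_restrict_of_ae (ae_ne 0)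
  refine integral_mono_ae (hl.sup (hc _)) (hc _) ?_
  filter_upwards [h0, ae_restrict_mem measurableSet_ball] with w hw hw2
  rw [mem_ball_zero_iff] at hw2
  exact max_le (Real.log_le_log (norm_pos_iff.2 hw.symm) hw2.le)
    (Real.log_le_log (norm_pos_iff.2 (sub_ne_zero.2 hxy)) hy)

/-- Fubini for the logarithmic potential over a ball. -/
lemma fubini_log {q : ℂ → ℝ} (hq : Integrable q) {D : ℝ} (hD : ∀ y, q y ≠ 0 → ‖y‖ ≤ D)
    (x : ℂ) (s : ℝ) :
    Integrable (fun z => ∫ y, Real.log ‖z - y‖ * q y) (volume.restrict (ball x s)) ∧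
    Integrable (fun y => Lb x s y * q y) ∧
    ∫ z in ball x s, ∫ y, Real.log ‖z - y‖ * q y = ∫ y, Lb x s y * q y := by
  set E := ‖x‖ + |s| + |D| + 1 with hE
  set g : ℂ → ℝ := (ball (0:ℂ) E).indicator (fun w => Real.log ‖w‖) with hg
  have hgi : Integrable g := by
    rw [hg, integrable_indicator_iff measurableSet_ball]
    simpa using log_int_ball 0 E 0
  have hc := (hq.convolution_integrand (ContinuousLinearMap.mul ℝ ℝ) hgi)
  have hle : (volume.restrict (ball x s)).prod (volume : Measure ℂ) ≤ volume.prod volume :=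
    Measure.prod_mono Measure.restrict_le_self le_rfl
  have hc2 := hc.mono_measure hle
  have hI : Integrable (fun p : ℂ × ℂ => Real.log ‖p.1 - p.2‖ * q p.2)
      ((volume.restrict (ball x s)).prod volume) := by
    refine hc2.congr ?_
    have hb : ∀ᵐ p : ℂ × ℂ ∂((volume.restrict (ball x s)).prod volume), p.1 ∈ ball x s := by
      have : ∀ᵐ z ∂(volume.restrict (ball x s)), z ∈ ball x s := ae_restrict_mem measurableSet_ball
      exact Measure.quasiMeasurePreserving_fst.ae this
    filter_upwards [hb] with p hp
    simp only [ContinuousLinearMap.mul_apply']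
    by_cases h0 : q p.2 = 0
    · simp [h0]
    · have h1 := hD _ h0
      have h2 : p.1 - p.2 ∈ ball (0:ℂ) E := by
        rw [mem_ball_zero_iff]
        rw [mem_ball, dist_eq_norm] at hp
        have h3 := norm_sub_le p.1 p.2
        have h4 := norm_sub_norm_le p.1 x
        have := le_abs_self s
        have := le_abs_self D
        linarith
      rw [hg, Set.indicator_of_mem h2]; ring
  refine ⟨hI.integral_prod_left, ?_, ?_⟩
  · have := hI.integral_prod_right
    refine this.congr (Eventually.of_forall fun y => ?_)
    simp only [Lb]
    rw [integral_mul_const]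
  · rw [integral_integral_swap hI]
    congr 1
    funext y
    rw [integral_mul_const]; rfl

end BU

end

section
open MeasureTheory Real Filter Topology Metric Bornology
open scoped RealInnerProductSpace

namespace BU

lemma lapC_congr {f g : ℂ → ℝ} {x : ℂ} (h : f =ᶠ[𝓝 x] g) : lapC f x = lapC g x := by
  have h1 : ∀ e : ℂ, (fun y => fderiv ℝ f y e) =ᶠ[𝓝 x] (fun y => fderiv ℝ g y e) := by
    intro e
    filter_upwards [h.eventuallyEq_nhds] with y hy
    rw [hy.fderiv_eq]
  unfold lapC
  rw [(h1 1).fderiv_eq, (h1 Complex.I).fderiv_eq]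

lemma submean {u : ℂ → ℝ} (hu : ContDiff ℝ 2 u) (hsu : HasCompactSupport u) {x : ℂ} {s A : ℝ}
    (hs : 0 < s) (hA0 : 0 ≤ A) (h : ∀ y ∈ ball x s, -A ≤ lapC u y) :
    π * s ^ 2 * u x ≤ (∫ z in ball x s, u z) + π * s ^ 2 * (A * s ^ 2) := by
  have hc := lapC_cont hu
  have hsl := lapC_supp hsu
  have hint := hc.integrable_of_hasCompactSupport (μ := volume) hsl
  have hDD : ∃ D, ∀ y, lapC u y ≠ 0 → ‖y‖ ≤ D := by
    obtain ⟨D, hD⟩ := hsl.isCompact.isBounded.exists_norm_le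
    exact ⟨D, fun y hy => hD y (subset_tsupport _ hy)⟩
  obtain ⟨D, hD⟩ := hDD
  obtain ⟨f1, f2, f3⟩ := fubini_log hint hD x s
  have hf : ∀ z, u z = 1 / (2 * π) * ∫ y, Real.log ‖z - y‖ * lapC u y := by
    intro z
    simpa using (fundamental hu hsu z 0).2
  have hfi : Integrable (fun y => Real.log ‖x - y‖ * lapC u y) := by
    simpa using (fundamental hu hsu x 0).1
  have e1 : ∫ z in ball x s, u z = 1 / (2 * π) * ∫ y, Lb x s y * lapC u y := by
    rw [← f3, ← integral_const_mul]
    congr 1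
    funext z
    exact hf z
  obtain ⟨k1, k2⟩ := ker_integral_sub (a := 1) (by norm_num) hs x
  have e2 : -(A * (π * s ^ 3) * ∫ y, ker 1 s (x - y)) ≤
      (∫ y, Lb x s y * lapC u y) - π * s ^ 2 * ∫ y, Real.log ‖x - y‖ * lapC u y := by
    rw [← integral_const_mul, ← integral_const_mul, ← integral_sub f2 (hfi.const_mul _),
      ← integral_neg]
    refine integral_mono_ae (k1.const_mul _).neg (f2.sub (hfi.const_mul _)) ?_
    filter_upwards [ae_ne x] with y hy
    have hpos : 0 < ‖x - y‖ := norm_pos_iff.2 (sub_ne_zero.2 hy)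
    have hk0 := ker_nonneg 1 s (x - y)
    change -(A * (π * s ^ 3) * ker 1 s (x - y)) ≤ Lb x s y * lapC u y - π * s ^ 2 * (Real.log ‖x - y‖ * lapC u y)
    rcases le_or_gt s ‖x - y‖ with hxy | hxy
    · rw [Lb_far hs hxy]
      have : 0 ≤ A * (π * s ^ 3) * ker 1 s (x - y) := by positivity
      have e : π * s ^ 2 * Real.log ‖x - y‖ * lapC u y -
        π * s ^ 2 * (Real.log ‖x - y‖ * lapC u y) = 0 := by ring
      rw [e]; linarith
    · have h1 := Lb_ge hs hy
      have h2 := Lb_le hs hy hxy.le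
      have hmem : y ∈ ball x s := by rw [mem_ball, dist_comm, dist_eq_norm]; exact hxy
      have h3 := h y hmem
      have h4 : ker 1 s (x - y) = ‖x - y‖⁻¹ := by
        have : x - y ∈ ball (0:ℂ) s := by rw [mem_ball_zero_iff]; exact hxy
        simp only [ker, Set.indicator_of_mem this, Real.rpow_neg_one]
      have h5 : Real.log s - Real.log ‖x - y‖ ≤ s * ‖x - y‖⁻¹ := by
        rw [← Real.log_div hs.ne' hpos.ne', ← div_eq_mul_inv]
        exact Real.log_le_self (by positivity)
      rw [h4]
      have h6 : Lb x s y - π * s ^ 2 * Real.log ‖x - y‖ ≤ π * s ^ 3 * ‖x - y‖⁻¹ := by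
        have : π * s ^ 2 * (Real.log s - Real.log ‖x - y‖) ≤ π * s ^ 2 * (s * ‖x - y‖⁻¹) :=
          mul_le_mul_of_nonneg_left h5 (by positivity)
        nlinarith
      have h7 : (Lb x s y - π * s ^ 2 * Real.log ‖x - y‖) * (-A) ≤
        (Lb x s y - π * s ^ 2 * Real.log ‖x - y‖) * lapC u y :=
        mul_le_mul_of_nonneg_left h3 (by linarith)
      nlinarith [mul_le_mul_of_nonneg_right h6 hA0]
  rw [k2] at e2
  rw [e1, hf x]
  norm_num at e2
  have hpi := Real.pi_pos
  have : 1 / (2 * π) * -(A * (π * s ^ 3) * (2 * π * s)) ≤ 1 / (2 * π) *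
    ((∫ y, Lb x s y * lapC u y) - π * s ^ 2 * ∫ y, Real.log ‖x - y‖ * lapC u y) :=
    mul_le_mul_of_nonneg_left (by linarith) (by positivity)
  have e3 : 1 / (2 * π) * -(A * (π * s ^ 3) * (2 * π * s)) = - (π * s ^ 2 * (A * s ^ 2)) := by
    field_simp
  rw [e3] at this
  linarith

/-- Mean value property on balls. -/
def MV (h : ℂ → ℝ) (Ω : Set ℂ) : Prop :=
  ∀ x r, 0 < r → closedBall x r ⊆ Ω →
    IntegrableOn h (ball x r) ∧ ∫ y in ball x r, h y = π * r ^ 2 * h x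

/-- Newtonian (logarithmic) potential. -/
def Pot (f : ℂ → ℝ) (x : ℂ) : ℝ := -(1 / (2 * π)) * ∫ y, Real.log ‖x - y‖ * f y

lemma mv_of_pde {Ω : Set ℂ} (hΩ : IsOpen Ω) {v f : ℂ → ℝ} (hv : ContDiffOn ℝ 2 v Ω)
    (hf : Integrable f) {A D : ℝ} (hA : ∀ y, |f y| ≤ A) (hD : ∀ y, f y ≠ 0 → ‖y‖ ≤ D)
    (hpde : ∀ x ∈ Ω, -lapC v x = f x) : MV (fun x => v x - Pot f x) Ω := by
  intro x r hr hsub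
  obtain ⟨d, hd, hd2⟩ := (isCompact_closedBall x r).exists_cthickening_subset_open hΩ hsub
  rw [cthickening_closedBall hd.le hr.le] at hd2
  let χ : ContDiffBump x := ⟨r + d / 3, r + 2 * d / 3, by positivity, by linarith⟩
  set φ : ℂ → ℝ := fun y => χ y * v y with hφdef
  have hts : tsupport (χ : ℂ → ℝ) ⊆ Ω := by
    rw [χ.tsupport_eq]
    exact (closedBall_subset_closedBall (show r + 2 * d / 3 ≤ d + r by linarith)).trans hd2
  have hφ : ContDiff ℝ 2 φ := by
    rw [contDiff_iff_contDiffAt]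
    intro y
    by_cases hy : y ∈ Ω
    · exact χ.contDiff.contDiffAt.mul (hv.contDiffAt (hΩ.mem_nhds hy))
    · have : y ∉ tsupport (χ : ℂ → ℝ) := fun h => hy (hts h)
      rw [notMem_tsupport_iff_eventuallyEq] at this
      have h0 : φ =ᶠ[𝓝 y] fun _ => 0 := by
        filter_upwards [this] with z hz
        simp [hφdef, hz]
      exact contDiffAt_const.congr_of_eventuallyEq h0
  have hs : HasCompactSupport φ := χ.hasCompactSupport.mul_right
  have hφv : ∀ z ∈ ball x (r + d / 3), φ z = v z := by
    intro z hz
    have : χ z = 1 := χ.one_of_mem_closedBall (ball_subset_closedBall hz)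
    simp [hφdef, this]
  have hbΩ : ball x (r + d / 3) ⊆ Ω := fun z hz =>
    hd2 (closedBall_subset_closedBall (by linarith) (ball_subset_closedBall hz))
  set q : ℂ → ℝ := fun y => lapC φ y + f y with hq
  have hq0 : ∀ z ∈ ball x (r + d / 3), q z = 0 := by
    intro z hz
    have h1 : φ =ᶠ[𝓝 z] v := by
      filter_upwards [isOpen_ball.mem_nhds hz] with y hy using hφv y hy
    have := hpde z (hbΩ hz)
    simp only [hq, lapC_congr h1]
    linarith
  have hc := lapC_cont hφ
  have hsl := lapC_supp hs
  have hint := hc.integrable_of_hasCompactSupport (μ := volume) hsl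
  have hDD : ∃ D, ∀ y, lapC φ y ≠ 0 → ‖y‖ ≤ D := by
    obtain ⟨D, hD⟩ := hsl.isCompact.isBounded.exists_norm_le
    exact ⟨D, fun y hy => hD y (subset_tsupport _ hy)⟩
  obtain ⟨D', hD'⟩ := hDD
  have hqi : Integrable q := hint.add hf
  have hqD : ∀ y, q y ≠ 0 → ‖y‖ ≤ max D D' := by
    intro y hy
    by_cases h1 : f y = 0
    · refine (hD' y ?_).trans (le_max_right _ _)
      intro h2; exact hy (by simp [hq, h1, h2])
    · exact (hD y h1).trans (le_max_left _ _)
  obtain ⟨f1, f2, f3⟩ := fubini_log hqi hqD x r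
  have hrep : ∀ z ∈ ball x (r + d / 3), v z - Pot f z = 1 / (2 * π) * ∫ y, Real.log ‖z - y‖ * q y := by
    intro z hz
    have h1 := (fundamental hφ hs z 0).2
    have h2 : Integrable (fun y => Real.log ‖z - y‖ * lapC φ y) := by
      simpa using (fundamental hφ hs z 0).1
    have h3 := log_integrable hf hA hD z
    rw [hφv z hz] at h1
    simp only [hq, mul_add]
    rw [integral_add h2 h3, h1, Pot]
    simp only [sub_zero]
    ring
  have hmem : x ∈ ball x (r + d / 3) := mem_ball_self (by positivity)
  have hsubb : ball x r ⊆ ball x (r + d / 3) := ball_subset_ball (by linarith)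
  constructor
  · have := f1.const_mul (1 / (2 * π))
    refine IntegrableOn.congr_fun this (fun z hz => (hrep z (hsubb hz)).symm) measurableSet_ball
  · rw [setIntegral_congr_fun measurableSet_ball (fun z hz => hrep z (hsubb hz)),
      integral_const_mul, f3]
    change _ = π * r ^ 2 * (v x - Pot f x)
    rw [hrep x hmem]
    have : ∀ y, Lb x r y * q y = π * r ^ 2 * (Real.log ‖x - y‖ * q y) := by
      intro y
      by_cases hy : y ∈ ball x (r + d / 3)
      · simp [hq0 y hy]
      · rw [mem_ball, not_lt, dist_comm, dist_eq_norm] at hy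
        rw [Lb_far hr (by linarith)]; ring
    simp_rw [this]
    rw [integral_const_mul]; ring

lemma MV.sub {h g : ℂ → ℝ} {Ω : Set ℂ} (h1 : MV h Ω) (h2 : MV g Ω) :
    MV (fun x => h x - g x) Ω := by
  intro x r hr hsub
  obtain ⟨a, b⟩ := h1 x r hr hsub
  obtain ⟨c, d⟩ := h2 x r hr hsub
  refine ⟨a.sub c, ?_⟩
  rw [integral_sub a c, b, d]; ring

lemma MV.neg {h : ℂ → ℝ} {Ω : Set ℂ} (h1 : MV h Ω) : MV (fun x => - h x) Ω := by
  intro x r hr hsub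
  obtain ⟨a, b⟩ := h1 x r hr hsub
  refine ⟨a.neg, ?_⟩
  rw [integral_neg, b]; ring

lemma MV.const (c : ℝ) (Ω : Set ℂ) : MV (fun _ => c) Ω := by
  intro x r hr _
  refine ⟨integrableOn_const measure_ball_lt_top.ne, ?_⟩
  rw [setIntegral_const, vol_real hr.le, smul_eq_mul]

/-- Harnack inequality for nonnegative functions. -/
lemma harnack {H : ℂ → ℝ} {Ω : Set ℂ} (hH : MV H Ω) {c : ℂ} {R : ℝ}
    (hR : 0 < R) (hsub : closedBall c R ⊆ Ω) (h0 : ∀ y ∈ closedBall c R, 0 ≤ H y) {x : ℂ}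
    (hx : ‖x - c‖ ≤ R / 4) : |H x - H c| ≤ 4 * (‖x - c‖ / R) * H c := by
  set t := ‖x - c‖ with ht
  have ht0 : 0 ≤ t := norm_nonneg _
  have hxc : dist x c = t := by rw [dist_eq_norm]
  have s1 : closedBall x (R - t) ⊆ closedBall c R := closedBall_subset_closedBall' (by linarith)
  have s1' : ball x (R - t) ⊆ ball c R := ball_subset_ball' (by linarith)
  have s2 : closedBall c (R - 2 * t) ⊆ closedBall c R := closedBall_subset_closedBall (by linarith)
  have s2' : ball c (R - 2 * t) ⊆ ball x (R - t) :=
    ball_subset_ball' (by rw [dist_comm]; linarith)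
  obtain ⟨i1, e1⟩ := hH c R hR hsub
  obtain ⟨i2, e2⟩ := hH x (R - t) (by linarith) (s1.trans hsub)
  obtain ⟨i3, e3⟩ := hH c (R - 2 * t) (by linarith) (s2.trans hsub)
  have n1 : 0 ≤ᵐ[volume.restrict (ball c R)] H := by
    filter_upwards [ae_restrict_mem measurableSet_ball] with y hy using h0 y (ball_subset_closedBall hy)
  have n2 : 0 ≤ᵐ[volume.restrict (ball x (R - t))] H := by
    filter_upwards [ae_restrict_mem measurableSet_ball] with y hy using
      h0 y (ball_subset_closedBall (s1' hy))
  have m1 := setIntegral_mono_set i1 n1 (LE.le.eventuallyLE s1')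
  have m2 := setIntegral_mono_set i2 n2 (LE.le.eventuallyLE s2')
  rw [e1, e2] at m1
  rw [e2, e3] at m2
  have hpi := Real.pi_pos
  have m1' : (R - t) ^ 2 * H x ≤ R ^ 2 * H c := by
    refine le_of_mul_le_mul_left ?_ hpi; linarith
  have m2' : (R - 2 * t) ^ 2 * H c ≤ (R - t) ^ 2 * H x := by
    refine le_of_mul_le_mul_left ?_ hpi; linarith
  have hc0 : 0 ≤ H c := h0 c (mem_closedBall_self hR.le)
  have hpos : 0 < (R - t) ^ 2 := by have : 0 < R - t := by linarith
                                    positivity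
  have eq1 : 4 * (t / R) * H c = 4 * t * H c / R := by ring
  rw [eq1, le_div_iff₀ hR]
  have key1 : (H x - H c) * R ≤ 4 * t * H c := by
    refine le_of_mul_le_mul_left ?_ hpos
    have a1 : (R - t) ^ 2 * (H x - H c) ≤ (2 * R * t - t ^ 2) * H c := by nlinarith
    have a2 : (2 * R * t - t ^ 2) * R ≤ (R - t) ^ 2 * (4 * t) := by
      have : 0 ≤ t * ((R - 4 * t) * (2 * R) + 1 * R * t + 4 * t ^ 2) := by
        have : 0 ≤ R - 4 * t := by linarith
        positivity
      nlinarith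
    nlinarith [mul_le_mul_of_nonneg_right a2 hc0, mul_le_mul_of_nonneg_right a1 hR.le]
  have key2 : -(4 * t * H c) ≤ (H x - H c) * R := by
    refine le_of_mul_le_mul_left ?_ hpos
    have a1 : -((2 * R * t - 3 * t ^ 2) * H c) ≤ (R - t) ^ 2 * (H x - H c) := by nlinarith
    have a2 : (2 * R * t - 3 * t ^ 2) * R ≤ (R - t) ^ 2 * (4 * t) := by
      have : 0 ≤ t * ((R - 4 * t) * (2 * R) + 3 * R * t + 4 * t ^ 2) := by
        have : 0 ≤ R - 4 * t := by linarith
        positivity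
      nlinarith
    nlinarith [mul_le_mul_of_nonneg_right a2 hc0, mul_le_mul_of_nonneg_right a1 hR.le]
  rw [← abs_of_pos hR, ← abs_mul, abs_le]
  exact ⟨key2, key1⟩

lemma harnack_bdd {h : ℂ → ℝ} {Ω : Set ℂ} (hh : MV h Ω) {c : ℂ} {R C : ℝ}
    (hR : 0 < R) (hsub : closedBall c R ⊆ Ω) (h0 : ∀ y ∈ closedBall c R, |h y| ≤ C) {x : ℂ}
    (hx : ‖x - c‖ ≤ R / 4) : |h x - h c| ≤ 8 * C / R * ‖x - c‖ := by
  have h1 : MV (fun y => C - h y) Ω := (MV.const C Ω).sub hh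
  have h2 := harnack h1 hR hsub (fun y hy => by have := abs_le.1 (h0 y hy); linarith) hx
  have h3 : |h x - h c| = |C - h x - (C - h c)| := by
    rw [← abs_neg]; congr 1; ring
  rw [h3]
  refine h2.trans ?_
  have h4 := abs_le.1 (h0 c (mem_closedBall_self hR.le))
  have : 4 * (‖x - c‖ / R) * (C - h c) ≤ 4 * (‖x - c‖ / R) * (2 * C) :=
    mul_le_mul_of_nonneg_left (by linarith) (by positivity)
  refine this.trans (le_of_eq ?_)
  ring

/-- Maximum principle. -/
lemma max_principle {h : ℂ → ℝ} {Ω : Set ℂ} (hΩ : IsOpen Ω) (hb : IsBounded Ω)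
    (hc : ContinuousOn h (closure Ω)) (hh : MV h Ω) {C : ℝ} (hC : ∀ x ∈ frontier Ω, h x ≤ C) :
    ∀ x ∈ closure Ω, h x ≤ C := by
  intro x0 hx0
  have hcomp : IsCompact (closure Ω) := hb.isCompact_closure
  obtain ⟨a, ha, hamax⟩ := hcomp.exists_isMaxOn ⟨x0, hx0⟩ hc
  set M := h a with hM
  have hmax : ∀ y ∈ closure Ω, h y ≤ M := fun y hy => hamax hy
  have hT : IsCompact (closure Ω ∩ h ⁻¹' {M}) :=
    hcomp.of_isClosed_subset (hc.preimage_isClosed_of_isClosed isClosed_closure isClosed_singleton)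
      Set.inter_subset_left
  obtain ⟨b, ⟨hb1, hb2⟩, hbmax⟩ := hT.exists_isMaxOn ⟨a, ha, rfl⟩ Complex.continuous_re.continuousOn
  have hb2 : h b = M := hb2
  by_cases hbΩ : b ∈ Ω
  · exfalso
    obtain ⟨r, hr, hr2⟩ := Metric.isOpen_iff.1 hΩ b hbΩ
    have hcb : closedBall b (r / 2) ⊆ Ω := (closedBall_subset_ball (by linarith)).trans hr2
    obtain ⟨i1, e1⟩ := hh b (r / 2) (by linarith) hcb
    have ic : IntegrableOn (fun _ : ℂ => M) (ball b (r / 2)) := integrableOn_const measure_ball_lt_top.ne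
    have e2 : ∫ y in ball b (r / 2), (M - h y) = 0 := by
      rw [integral_sub ic i1, e1, setIntegral_const, vol_real (by linarith), smul_eq_mul, hb2]
      ring
    have hsubc : ball b (r / 2) ⊆ closure Ω := (ball_subset_closedBall.trans hcb).trans subset_closure
    have n1 : 0 ≤ᵐ[volume.restrict (ball b (r / 2))] (fun y => M - h y) := by
      filter_upwards [ae_restrict_mem measurableSet_ball] with y hy
      have := hmax y (hsubc hy)
      simp only [Pi.zero_apply]; linarith
    rw [integral_eq_zero_iff_of_nonneg_ae n1 (ic.sub i1)] at e2
    have hcont : ContinuousOn (fun y => M - h y) (ball b (r / 2)) :=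
      continuousOn_const.sub (hc.mono hsubc)
    have hzero := Measure.eqOn_open_of_ae_eq e2 isOpen_ball hcont continuousOn_const
    have hp : b + ((r / 4 : ℝ) : ℂ) ∈ ball b (r / 2) := by
      simp [abs_of_pos hr]; linarith
    have h4 := hzero hp
    simp only [Pi.zero_apply] at h4
    have h5 : b + ((r / 4 : ℝ) : ℂ) ∈ closure Ω ∩ h ⁻¹' {M} :=
      ⟨hsubc hp, by simp only [Set.mem_preimage, Set.mem_singleton_iff]; linarith⟩
    have h6 := hbmax h5
    simp only [Complex.add_re, Complex.ofReal_re, Set.mem_ofPred_eq] at h6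
    linarith
  · have hfr : b ∈ frontier Ω := by
      rw [hΩ.frontier_eq]; exact ⟨hb1, hbΩ⟩
    have := hC b hfr
    have := hmax x0 hx0
    linarith

/-- Lipschitz/continuity of the potential -/
lemma pot_cont {f : ℂ → ℝ} (hf : Integrable f) (h0 : ∀ y, 0 ≤ f y) {A D : ℝ} (hA : ∀ y, |f y| ≤ A)
    (hD : ∀ y, f y ≠ 0 → ‖y‖ ≤ D) : Continuous (Pot f) := by
  set K := 1 / (2 * π) * (2 * (2 * π * A * 1 + 1⁻¹ * ∫ y, f y)) with hK
  have key : ∀ z z', |Pot f z - Pot f z'| ≤ K * ‖z - z'‖ := by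
    intro z z'
    have hA' : ∀ w : ℂ, ∀ y ∈ ball w 1, f y ≤ A := fun w y _ => (le_abs_self _).trans (hA y)
    obtain ⟨l1, l2⟩ := logdiff one_pos (z := z) (z' := z') hf h0 (hA' z) (hA' z')
    have e : Pot f z - Pot f z' = -(1 / (2 * π)) *
        ∫ y, (Real.log ‖z - y‖ - Real.log ‖z' - y‖) * f y := by
      simp only [Pot, sub_mul]
      rw [integral_sub (log_integrable hf hA hD z) (log_integrable hf hA hD z')]
      ring
    rw [e, abs_mul, abs_neg, abs_of_pos (by positivity : (0:ℝ) < 1 / (2 * π)), hK, mul_assoc]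
    refine mul_le_mul_of_nonneg_left ?_ (by positivity)
    refine (abs_integral_le_integral_abs).trans (l2.trans (le_of_eq ?_))
    ring
  refine continuous_iff_continuousAt.2 fun z => ?_
  rw [ContinuousAt, tendsto_iff_norm_sub_tendsto_zero]
  refine squeeze_zero (fun _ => norm_nonneg _) (fun w => key w z) ?_
  have : Tendsto (fun w : ℂ => K * ‖w - z‖) (𝓝 z) (𝓝 (K * ‖z - z‖)) :=
    (Continuous.tendsto (by fun_prop) z)
  simpa using this

end BU

end

section
open MeasureTheory Real Filter Topology Metric Bornology
open scoped RealInnerProductSpace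

namespace BU

lemma le_two_rpow {X : ℝ} (hX : 1 / 4 ≤ X) : X ≤ 2 * X ^ (3 / 2 : ℝ) := by
  have h0 : 0 < X := by linarith
  have h1 : X ^ (3 / 2 : ℝ) = X * Real.sqrt X := by
    rw [show (3 / 2 : ℝ) = 1 + 1 / 2 by norm_num, Real.rpow_add h0, Real.rpow_one, Real.sqrt_eq_rpow]
  have h2 : (1 / 2 : ℝ) ≤ Real.sqrt X := by
    apply Real.le_sqrt_of_sq_le; norm_num; linarith
  rw [h1]; nlinarith

lemma ker_taylor {w ζ : ℂ} (hw : w ≠ 0) (hwz : w + ζ ≠ 0) :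
    |Real.log ‖w + ζ‖ - Real.log ‖w‖ - (ζ * w⁻¹).re| ≤
      4 * ‖ζ‖ ^ (3 / 2 : ℝ) * (‖w‖ ^ (-(3 / 2) : ℝ) + ‖w + ζ‖ ^ (-(3 / 2) : ℝ)) := by
  have ha : 0 < ‖w‖ := norm_pos_iff.2 hw
  have hb : 0 < ‖w + ζ‖ := norm_pos_iff.2 hwz
  have e1 : ∀ a : ℝ, 0 < a → ‖ζ‖ ^ (3 / 2 : ℝ) * a ^ (-(3 / 2) : ℝ) = (‖ζ‖ / a) ^ (3 / 2 : ℝ) := by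
    intro a ha
    rw [Real.div_rpow (norm_nonneg _) ha.le, Real.rpow_neg ha.le]; rfl
  rw [mul_assoc, mul_add, e1 _ ha, e1 _ hb]
  set X := ‖ζ‖ / ‖w‖ with hX
  set Y := ‖ζ‖ / ‖w + ζ‖ with hY
  have hX0 : 0 ≤ X := by positivity
  have hY0 : 0 ≤ Y := by positivity
  have hXp : 0 ≤ X ^ (3 / 2 : ℝ) := by positivity
  have hYp : 0 ≤ Y ^ (3 / 2 : ℝ) := by positivity
  have ht : ‖ζ * w⁻¹‖ = X := by rw [norm_mul, norm_inv]; rfl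
  rcases le_or_gt X (1 / 2) with h | h
  · have h1 := Complex.norm_log_one_add_sub_self_le (z := ζ * w⁻¹) (by rw [ht]; linarith)
    have h2 : (Complex.log (1 + ζ * w⁻¹) - ζ * w⁻¹).re =
        Real.log ‖w + ζ‖ - Real.log ‖w‖ - (ζ * w⁻¹).re := by
      rw [Complex.sub_re, Complex.log_re, ← Real.log_div hb.ne' ha.ne', ← norm_div]
      congr 3
      field_simp
    rw [← h2]
    refine (Complex.abs_re_le_norm _).trans (h1.trans ?_)
    rw [ht]
    have h3 : (1 - X)⁻¹ ≤ 2 := by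
      rw [inv_le_comm₀ (by linarith) (by norm_num)]; linarith
    have h4 : X ^ 2 ≤ X ^ (3 / 2 : ℝ) := by
      rcases hX0.eq_or_lt with h0 | h0
      · rw [← h0]; norm_num
      · rw [← Real.rpow_natCast]
        exact Real.rpow_le_rpow_of_exponent_ge h0 (by linarith) (by norm_num)
    have h5 : X ^ 2 * (1 - X)⁻¹ ≤ X ^ 2 * 2 := mul_le_mul_of_nonneg_left h3 (sq_nonneg X)
    linarith
  · have h1 := abs_log_sub_le hb ha
    have h2 : |‖w + ζ‖ - ‖w‖| ≤ ‖ζ‖ := by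
      have := abs_norm_sub_norm_le (w + ζ) w
      simpa using this
    have h3 : |Real.log ‖w + ζ‖ - Real.log ‖w‖| ≤ Y + X := by
      refine h1.trans ?_
      have : |‖w + ζ‖ - ‖w‖| * (‖w + ζ‖⁻¹ + ‖w‖⁻¹) ≤ ‖ζ‖ * (‖w + ζ‖⁻¹ + ‖w‖⁻¹) :=
        mul_le_mul_of_nonneg_right h2 (by positivity)
      refine this.trans (le_of_eq ?_)
      rw [hX, hY]; ring
    have h4 : |(ζ * w⁻¹).re| ≤ X := by
      rw [← ht]; exact Complex.abs_re_le_norm _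
    have h5 : ‖w + ζ‖ ≤ 3 * ‖ζ‖ := by
      have := norm_add_le w ζ
      rw [hX, lt_div_iff₀ ha] at h
      linarith
    have h6 : 1 / 4 ≤ Y := by
      rw [hY, le_div_iff₀ hb]; linarith [norm_nonneg ζ]
    have h7 := le_two_rpow h6
    have h8 := le_two_rpow (show 1 / 4 ≤ X by linarith)
    have h9 := abs_sub (Real.log ‖w + ζ‖ - Real.log ‖w‖) (ζ * w⁻¹).re
    linarith

/-- the Cauchy transform -/
def cau (g : ℂ → ℝ) (z : ℂ) : ℂ := ∫ y, (g y : ℂ) * (z - y)⁻¹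

lemma cau_integrable {g : ℂ → ℝ} (hg : Integrable g) (hg0 : ∀ y, 0 ≤ g y) {A : ℝ}
    (hA : ∀ y, g y ≤ A) (z : ℂ) : Integrable (fun y => (g y : ℂ) * (z - y)⁻¹) := by
  have h := (riesz1 (z := z) one_pos hg hg0 (A := A) (fun y _ => hA y)).1
  refine h.mono' ?_ ?_
  · exact (Complex.continuous_ofReal.comp_aestronglyMeasurable hg.aestronglyMeasurable).mul
      (by fun_prop : Measurable (fun y : ℂ => (z - y)⁻¹)).aestronglyMeasurable
  · filter_upwards with y
    rw [norm_mul, norm_inv, Complex.norm_real, Real.norm_of_nonneg (hg0 y)]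

lemma cau_bound {g : ℂ → ℝ} (hg : Integrable g) (hg0 : ∀ y, 0 ≤ g y) {A : ℝ}
    (hA : ∀ y, g y ≤ A) (z : ℂ) : ‖cau g z‖ ≤ 2 * π * A + ∫ y, g y := by
  have h := (riesz1 (z := z) one_pos hg hg0 (A := A) (fun y _ => hA y)).2
  refine (norm_integral_le_integral_norm _).trans ?_
  have e : ∀ y, ‖(g y : ℂ) * (z - y)⁻¹‖ = g y * ‖z - y‖⁻¹ := by
    intro y
    rw [norm_mul, norm_inv, Complex.norm_real, Real.norm_of_nonneg (hg0 y)]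
  simp_rw [e]
  simpa using h

/-- real linear functional `ζ ↦ Re (c ζ)` -/
def reMul (c : ℂ) : ℂ →L[ℝ] ℝ := Complex.reCLM.comp (ContinuousLinearMap.mul ℝ ℂ c)

@[simp] lemma reMul_apply (c ζ : ℂ) : reMul c ζ = (c * ζ).re := rfl

lemma pot_taylor {g : ℂ → ℝ} (hg : Integrable g) (hg0 : ∀ y, 0 ≤ g y) {A : ℝ}
    (hA : ∀ y, g y ≤ A) : ∃ C : ℝ, ∀ z ζ : ℂ,
    |(∫ y, (Real.log ‖z + ζ - y‖ - Real.log ‖z - y‖) * g y) - (cau g z * ζ).re| ≤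
      C * ‖ζ‖ ^ (3 / 2 : ℝ) := by
  set K := A * (2 * π * ((1:ℝ) ^ ((2:ℝ) - 3 / 2) / (2 - 3 / 2))) + (1:ℝ) ^ (-(3 / 2 : ℝ)) * ∫ y, g y with hK
  refine ⟨4 * (K + K), fun z ζ => ?_⟩
  have r1 := riesz (a := 3 / 2) (by norm_num) (by norm_num) one_pos (z := z) hg hg0 (fun y _ => hA y)
  have r2 := riesz (a := 3 / 2) (by norm_num) (by norm_num) one_pos (z := z + ζ) hg hg0 (fun y _ => hA y)
  obtain ⟨l1, _⟩ := logdiff one_pos (z := z + ζ) (z' := z) hg hg0 (fun y _ => hA y) (fun y _ => hA y)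
  have c1 := (cau_integrable hg hg0 hA z).mul_const ζ
  have e1 : (cau g z * ζ).re = ∫ y, ((g y : ℂ) * (z - y)⁻¹ * ζ).re := by
    rw [cau, ← integral_mul_const]
    exact (integral_re c1).symm
  have c2 : Integrable (fun y => ((g y : ℂ) * (z - y)⁻¹ * ζ).re) := c1.re
  rw [e1, ← integral_sub l1 c2]
  refine abs_integral_le_integral_abs.trans ?_
  have hdom : Integrable (fun y => 4 * ‖ζ‖ ^ (3 / 2 : ℝ) *
      (g y * ‖z - y‖ ^ (-(3 / 2) : ℝ) + g y * ‖z + ζ - y‖ ^ (-(3 / 2) : ℝ))) :=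
    (r1.1.add r2.1).const_mul _
  have h1 : ∫ y, |(Real.log ‖z + ζ - y‖ - Real.log ‖z - y‖) * g y - ((g y : ℂ) * (z - y)⁻¹ * ζ).re|
      ≤ ∫ y, 4 * ‖ζ‖ ^ (3 / 2 : ℝ) *
      (g y * ‖z - y‖ ^ (-(3 / 2) : ℝ) + g y * ‖z + ζ - y‖ ^ (-(3 / 2) : ℝ)) := by
    refine integral_mono_ae (l1.sub c2).abs hdom ?_
    filter_upwards [ae_ne z, ae_ne (z + ζ)] with y hy hy2
    have k := ker_taylor (w := z - y) (ζ := ζ) (sub_ne_zero.2 hy)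
      (by rw [show z - y + ζ = z + ζ - y by ring]; exact sub_ne_zero.2 hy2)
    rw [show z - y + ζ = z + ζ - y by ring] at k
    have e2 : ((g y : ℂ) * (z - y)⁻¹ * ζ).re = (ζ * (z - y)⁻¹).re * g y := by
      rw [show (g y : ℂ) * (z - y)⁻¹ * ζ = (g y : ℂ) * (ζ * (z - y)⁻¹) by ring, Complex.re_ofReal_mul]
      ring
    rw [e2, ← sub_mul, abs_mul, abs_of_nonneg (hg0 y)]
    refine (mul_le_mul_of_nonneg_right k (hg0 y)).trans (le_of_eq ?_)
    ring
  refine h1.trans ?_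
  rw [integral_const_mul, integral_add r1.1 r2.1]
  have := add_le_add r1.2 r2.2
  have hp : 0 ≤ 4 * ‖ζ‖ ^ (3 / 2 : ℝ) := by positivity
  refine (mul_le_mul_of_nonneg_left this hp).trans (le_of_eq ?_)
  rw [hK]; ring

lemma hasFDerivAt_of_pot {g F : ℂ → ℝ} (hg : Integrable g) (hg0 : ∀ y, 0 ≤ g y) {A : ℝ}
    (hA : ∀ y, g y ≤ A)
    (hF : ∀ z z', F z' - F z = -(1 / (2 * π)) * ∫ y, (Real.log ‖z' - y‖ - Real.log ‖z - y‖) * g y)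
    (z : ℂ) : HasFDerivAt F (-(1 / (2 * π)) • reMul (cau g z)) z := by
  obtain ⟨C, hC⟩ := pot_taylor hg hg0 hA
  rw [hasFDerivAt_iff_isLittleO_nhds_zero]
  rw [Asymptotics.isLittleO_iff]
  intro c hc
  have h1 : Tendsto (fun ζ : ℂ => (1 / (2 * π)) * (C * ‖ζ‖ ^ (1 / 2 : ℝ))) (𝓝 0) (𝓝 0) := by
    have : Continuous (fun ζ : ℂ => (1 / (2 * π)) * (C * ‖ζ‖ ^ (1 / 2 : ℝ))) := by
      refine continuous_const.mul (continuous_const.mul ?_)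
      exact continuous_norm.rpow_const (fun _ => Or.inr (by norm_num))
    have h := this.tendsto 0
    simpa using h
  filter_upwards [h1.eventually (gt_mem_nhds hc)] with ζ hζ
  rw [hF z (z + ζ)]
  have e : -(1 / (2 * π)) * (∫ y, (Real.log ‖z + ζ - y‖ - Real.log ‖z - y‖) * g y) -
      (-(1 / (2 * π)) • reMul (cau g z)) ζ = -(1 / (2 * π)) *
      ((∫ y, (Real.log ‖z + ζ - y‖ - Real.log ‖z - y‖) * g y) - (cau g z * ζ).re) := by
    simp only [smul_apply, reMul_apply, smul_eq_mul]; ring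
  rw [e, Real.norm_eq_abs, abs_mul, abs_neg, abs_of_pos (by positivity : (0:ℝ) < 1 / (2 * π))]
  have h2 := mul_le_mul_of_nonneg_left (hC z ζ) (by positivity : (0:ℝ) ≤ 1 / (2 * π))
  refine h2.trans ?_
  have h3 : ‖ζ‖ ^ (3 / 2 : ℝ) = ‖ζ‖ ^ (1 / 2 : ℝ) * ‖ζ‖ := by
    rw [show (3 / 2 : ℝ) = 1 / 2 + 1 by norm_num, Real.rpow_add_one' (norm_nonneg _) (by norm_num)]
  rw [h3]
  have := mul_le_mul_of_nonneg_right hζ.le (norm_nonneg ζ)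
  linarith

end BU

end

section
open MeasureTheory Real Filter Topology Metric Bornology
open scoped RealInnerProductSpace

namespace BU

lemma polar_integrable {f : ℂ → ℝ} (hfm : Measurable f) (hf : Integrable f) :
    IntegrableOn (fun p : ℝ × ℝ => p.1 * f (Complex.polarCoord.symm p)) polarCoord.target := by
  have hm : Measurable (fun p : ℝ × ℝ => p.1 * f (Complex.polarCoord.symm p)) := by
    refine measurable_fst.mul (hfm.comp ?_)
    have : (fun p : ℝ × ℝ => Complex.polarCoord.symm p) =
      fun p => (p.1 : ℂ) * (Real.cos p.2 + Real.sin p.2 * Complex.I) := by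
      funext p; exact Complex.polarCoord_symm_apply p
    change Measurable (fun p : ℝ × ℝ => Complex.polarCoord.symm p)
    rw [this]; fun_prop
  refine ⟨hm.aestronglyMeasurable, ?_⟩
  rw [hasFiniteIntegral_iff_enorm]
  have h := Complex.lintegral_comp_polarCoord_symm (fun x => ‖f x‖ₑ)
  have h2 : ∫⁻ p in polarCoord.target, ‖p.1 * f (Complex.polarCoord.symm p)‖ₑ =
      ∫⁻ p in polarCoord.target, ENNReal.ofReal p.1 • ‖f (Complex.polarCoord.symm p)‖ₑ := by
    refine setLIntegral_congr_fun polarCoord.open_target.measurableSet ?_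
    intro p hp
    have hp0 : 0 < p.1 := hp.1
    simp only [enorm_mul, smul_eq_mul]
    rw [Real.enorm_of_nonneg hp0.le]
  rw [h2, h]
  exact hf.2

/-- radial integration by parts -/
lemma radial_ibp {G : ℂ → ℝ} (hG : Differentiable ℝ G) (hGi : Integrable G)
    (hi : Integrable (fun y : ℂ => fderiv ℝ G y y * (‖y‖ ^ 2)⁻¹)) :
    ∫ y : ℂ, fderiv ℝ G y y * (‖y‖ ^ 2)⁻¹ = -(2 * π) * G 0 := by
  have hm : Measurable (fun y : ℂ => fderiv ℝ G y y * (‖y‖ ^ 2)⁻¹) := by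
    have h1 := measurable_fderiv ℝ G
    refine Measurable.mul ?_ (by fun_prop)
    exact (isBoundedBilinearMap_apply (𝕜 := ℝ) (E := ℂ) (F := ℝ)).continuous.measurable.comp
      (h1.prodMk measurable_id)
  have p1 := polar_integrable hm hi
  have p2 := polar_integrable hG.continuous.measurable hGi
  have e1 := Complex.integral_comp_polarCoord_symm (fun y : ℂ => fderiv ℝ G y y * (‖y‖ ^ 2)⁻¹)
  rw [← e1]
  simp only [smul_eq_mul]
  have ht : polarCoord.target = Set.Ioi (0:ℝ) ×ˢ Set.Ioo (-π) π := rfl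
  rw [ht] at p1 p2 ⊢
  unfold IntegrableOn at p1 p2
  rw [Measure.volume_eq_prod, ← Measure.prod_restrict] at p1 p2 ⊢
  rw [integral_prod_symm _ p1]
  have key : ∀ᵐ θ ∂(volume.restrict (Set.Ioo (-π) π)), (∫ r in Set.Ioi (0:ℝ), (r, θ).1 *
      (fderiv ℝ G (Complex.polarCoord.symm (r, θ)) (Complex.polarCoord.symm (r, θ)) *
      (‖Complex.polarCoord.symm (r, θ)‖ ^ 2)⁻¹)) = - G 0 := by
    filter_upwards [p1.prod_left_ae, p2.prod_left_ae] with θ h1 h2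
    set e : ℂ := Real.cos θ + Real.sin θ * Complex.I with he
    have hne : ‖e‖ = 1 := by
      rw [he, Complex.ofReal_cos, Complex.ofReal_sin, ← Complex.exp_mul_I]
      exact Complex.norm_exp_ofReal_mul_I θ
    have hpe : ∀ r : ℝ, Complex.polarCoord.symm (r, θ) = r * e := fun r =>
      Complex.polarCoord_symm_apply (r, θ)
    simp only [hpe] at h1 h2 ⊢
    have hd : ∀ r : ℝ, HasDerivAt (fun r : ℝ => G (r * e)) (fderiv ℝ G (r * e) e) r := by
      intro r
      have h3 : HasDerivAt (fun r : ℝ => (r : ℂ) * e) e r := by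
        simpa using (Complex.ofRealCLM.hasDerivAt (x := r)).mul_const e
      exact (hG (r * e)).hasFDerivAt.comp_hasDerivAt r h3
    have e2 : ∀ r ∈ Set.Ioi (0:ℝ), r * (fderiv ℝ G (r * e) (r * e) * (‖(r:ℂ) * e‖ ^ 2)⁻¹) =
        fderiv ℝ G (r * e) e := by
      intro r hr
      have hr0 : (0:ℝ) < r := hr
      have : fderiv ℝ G (r * e) (r * e) = r * fderiv ℝ G (r * e) e := by
        rw [← Complex.real_smul, map_smul, smul_eq_mul]
      rw [this, norm_mul, hne, Complex.norm_real, Real.norm_of_nonneg hr0.le]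
      field_simp
    have h1' : IntegrableOn (fun r : ℝ => fderiv ℝ G (r * e) e) (Set.Ioi 0) :=
      IntegrableOn.congr_fun (f := fun r : ℝ => r * (fderiv ℝ G (r * e) (r * e) * (‖(r:ℂ) * e‖ ^ 2)⁻¹))
        h1 e2 measurableSet_Ioi
    rw [setIntegral_congr_fun measurableSet_Ioi e2]
    have h2' : IntegrableOn (fun r : ℝ => G (r * e)) (Set.Ioi 1) := by
      have h2'' : IntegrableOn (fun r : ℝ => r * G (r * e)) (Set.Ioi 1) :=
        IntegrableOn.mono_set (t := Set.Ioi 0) h2 (Set.Ioi_subset_Ioi zero_le_one)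
      refine h2''.norm.mono' ?_ ?_
      · exact (hG.continuous.comp (by fun_prop)).aestronglyMeasurable
      · filter_upwards [self_mem_ae_restrict measurableSet_Ioi] with r hr
        have hr1 : (1:ℝ) < r := hr
        rw [norm_mul, Real.norm_of_nonneg (by linarith : (0:ℝ) ≤ r)]
        nlinarith [norm_nonneg (G (r * e))]
    have hlim := tendsto_zero_of_hasDerivAt_of_integrableOn_Ioi (fun r _ => hd r)
      (h1'.mono_set (Set.Ioi_subset_Ioi zero_le_one)) h2'
    rw [integral_Ioi_of_hasDerivAt_of_tendsto (hd 0).continuousAt.continuousWithinAt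
      (fun r _ => hd r) h1' hlim]
    simp
  rw [integral_congr_ae key]
  simp only [integral_const, smul_eq_mul, measureReal_restrict_apply_univ]
  rw [Real.volume_real_Ioo_of_le (by linarith [pi_pos])]
  ring


section classif
variable {u : ℂ → ℝ} (hint : Integrable (fun y => Real.exp (u y))) (hneg : ∀ z, u z ≤ 0)
  (h0 : u 0 = 0)
  (hrep : ∀ z, u z = -(1 / (2 * π)) * ∫ y, (Real.log ‖z - y‖ - Real.log ‖y‖) * Real.exp (u y))

lemma rep_diff {u g : ℂ → ℝ} {A : ℝ} (hg : Integrable g) (hg0 : ∀ y, 0 ≤ g y) (hA : ∀ y, g y ≤ A)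
    (hrep : ∀ z, u z = -(1 / (2 * π)) * ∫ y, (Real.log ‖z - y‖ - Real.log ‖y‖) * g y) (z z' : ℂ) :
    u z' - u z = -(1 / (2 * π)) * ∫ y, (Real.log ‖z' - y‖ - Real.log ‖z - y‖) * g y := by
  have l1 := (logdiff one_pos (z := z') (z' := 0) hg hg0 (fun y _ => hA y) (fun y _ => hA y)).1
  have l2 := (logdiff one_pos (z := z) (z' := 0) hg hg0 (fun y _ => hA y) (fun y _ => hA y)).1
  simp only [zero_sub, norm_neg] at l1 l2
  rw [hrep z, hrep z', ← mul_sub, ← integral_sub l1 l2]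
  congr 2
  funext y
  ring

include hint hneg hrep in
lemma cl_du (z : ℂ) :
    HasFDerivAt u (-(1 / (2 * π)) • reMul (cau (fun y => Real.exp (u y)) z)) z := by
  have hA : ∀ y, Real.exp (u y) ≤ 1 := fun y => Real.exp_le_one_iff.2 (hneg y)
  exact hasFDerivAt_of_pot hint (fun y => (Real.exp_pos _).le) hA
    (rep_diff hint (fun y => (Real.exp_pos _).le) hA hrep) z

/-- derivative of `e^u` -/
def dg (u : ℂ → ℝ) (z : ℂ) : ℂ →L[ℝ] ℝ :=
  Real.exp (u z) • (-(1 / (2 * π)) • reMul (cau (fun y => Real.exp (u y)) z))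

include hint hneg hrep in
lemma cl_dg (z : ℂ) : HasFDerivAt (fun z => Real.exp (u z)) (dg u z) z :=
  (cl_du hint hneg hrep z).exp

lemma reMul_norm (c : ℂ) : ‖reMul c‖ ≤ ‖c‖ := by
  refine ContinuousLinearMap.opNorm_le_bound _ (norm_nonneg _) (fun ζ => ?_)
  rw [reMul_apply, Real.norm_eq_abs]
  exact (Complex.abs_re_le_norm _).trans (norm_mul_le _ _)

include hint hneg hrep in
lemma cl_dg_bound : ∃ C : ℝ, 0 ≤ C ∧ (∀ z, ‖dg u z‖ ≤ C * Real.exp (u z)) ∧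
    (∀ z z', u z' ≤ u z + C * ‖z' - z‖) := by
  have hA : ∀ y, Real.exp (u y) ≤ 1 := fun y => Real.exp_le_one_iff.2 (hneg y)
  set M := 2 * π * 1 + ∫ y, Real.exp (u y) with hM
  have hM0 : 0 ≤ M := by
    have : 0 ≤ ∫ y, Real.exp (u y) := integral_nonneg (fun y => (Real.exp_pos _).le)
    have := pi_pos
    rw [hM]; linarith
  have hb : ∀ z, ‖-(1 / (2 * π)) • reMul (cau (fun y => Real.exp (u y)) z)‖ ≤ 1 / (2 * π) * M := by
    intro z
    rw [norm_smul, norm_neg, Real.norm_of_nonneg (by positivity)]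
    refine mul_le_mul_of_nonneg_left ?_ (by positivity)
    exact (reMul_norm _).trans (cau_bound hint (fun y => (Real.exp_pos _).le) hA z)
  refine ⟨1 / (2 * π) * M, by positivity, fun z => ?_, fun z z' => ?_⟩
  · rw [dg, norm_smul, Real.norm_of_nonneg (Real.exp_pos _).le, mul_comm]
    exact mul_le_mul_of_nonneg_right (hb z) (Real.exp_pos _).le
  · have := Convex.norm_image_sub_le_of_norm_hasFDerivWithin_le (s := Set.univ) (f := u)
      (fun x _ => (cl_du hint hneg hrep x).hasFDerivWithinAt) (fun x _ => hb x) convex_univ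
      (Set.mem_univ z) (Set.mem_univ z')
    have := (le_abs_self _).trans this
    linarith

include hint hneg hrep in
lemma cl_dcau (z : ℂ) : Integrable (fun y => (dg u (z - y)).smulRight (y⁻¹ : ℂ)) ∧
    HasFDerivAt (cau (fun y => Real.exp (u y)))
      (∫ y, (dg u (z - y)).smulRight (y⁻¹ : ℂ)) z := by
  have hA : ∀ y, Real.exp (u y) ≤ 1 := fun y => Real.exp_le_one_iff.2 (hneg y)
  obtain ⟨C, hC0, hC1, hC2⟩ := cl_dg_bound hint hneg hrep
  have hd := cl_dg hint hneg hrep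
  have hcont : Continuous (fun z => Real.exp (u z)) :=
    continuous_iff_continuousAt.2 (fun z => (hd z).continuousAt)
  have hdgm : Measurable (dg u) := by
    have : dg u = fderiv ℝ (fun z => Real.exp (u z)) := by
      funext z; exact (hd z).fderiv.symm
    rw [this]; exact measurable_fderiv ℝ _
  have hFm : AEStronglyMeasurable (fun y => (dg u (z - y)).smulRight (y⁻¹ : ℂ)) volume := by
    have h1 : Measurable (fun y : ℂ => dg u (z - y)) := hdgm.comp (by fun_prop)
    have h2 : Continuous (fun p : (ℂ →L[ℝ] ℝ) × ℂ => p.1.smulRight p.2) := by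
      exact (ContinuousLinearMap.smulRightL ℝ ℂ ℂ).continuous₂
    exact (h2.measurable.comp (h1.prodMk measurable_inv)).aestronglyMeasurable
  have hci := cau_integrable hint (fun y => (Real.exp_pos _).le) hA z
  have hci2 : Integrable (fun y => (Real.exp (u (z - y)) : ℂ) * y⁻¹) := by
    have := hci.comp_sub_left z
    simpa using this
  have e : cau (fun y => Real.exp (u y)) = fun z => ∫ y, (Real.exp (u (z - y)) : ℂ) * y⁻¹ := by
    funext z
    rw [cau, ← integral_sub_left_eq_self _ volume z]
    simp
  have hbd : ∀ y, ∀ x ∈ ball z 1, ‖(dg u (x - y)).smulRight (y⁻¹ : ℂ)‖ ≤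
      C * Real.exp C * (‖(Real.exp (u (z - y)) : ℂ) * y⁻¹‖) := by
    intro y x hx
    rw [ContinuousLinearMap.norm_smulRight_apply, norm_mul, ← mul_assoc, Complex.norm_real,
      Real.norm_of_nonneg (Real.exp_pos _).le]
    refine mul_le_mul_of_nonneg_right ?_ (norm_nonneg _)
    refine (hC1 _).trans ?_
    rw [mul_assoc, ← Real.exp_add]
    refine mul_le_mul_of_nonneg_left (Real.exp_le_exp.2 ?_) hC0
    have h3 := hC2 (z - y) (x - y)
    rw [sub_sub_sub_cancel_right] at h3
    rw [mem_ball, dist_eq_norm] at hx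
    nlinarith
  have hbi := hci2.norm.const_mul (C * Real.exp C)
  refine ⟨hbi.mono' hFm (Eventually.of_forall fun y => hbd y z (mem_ball_self one_pos)), ?_⟩
  rw [e]
  refine hasFDerivAt_integral_of_dominated_of_fderiv_le (𝕜 := ℝ)
    (F := fun z y => (Real.exp (u (z - y)) : ℂ) * y⁻¹)
    (F' := fun z y => (dg u (z - y)).smulRight (y⁻¹ : ℂ))
    (bound := fun y => C * Real.exp C * (‖(Real.exp (u (z - y)) : ℂ) * y⁻¹‖))
    (ball_mem_nhds z one_pos) ?_ hci2 hFm (Eventually.of_forall hbd) hbi ?_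
  · refine Eventually.of_forall (fun x => ?_)
    have : Measurable (fun y => (Real.exp (u (x - y)) : ℂ)) :=
      (Complex.continuous_ofReal.comp (hcont.comp (by fun_prop : Continuous fun y : ℂ => x - y))).measurable
    exact (this.mul measurable_inv).aestronglyMeasurable
  · refine Eventually.of_forall (fun y x _ => ?_)
    have h1 : HasFDerivAt (fun x => Real.exp (u (x - y))) (dg u (x - y)) x := by
      have := (hd (x - y)).comp x ((hasFDerivAt_id x).sub_const y)
      exact this.congr_fderiv (ContinuousLinearMap.comp_id _)
    have h2 := h1.smul_const (y⁻¹ : ℂ)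
    simpa using h2

include hint hneg hrep in
lemma cl_A (z : ℂ) : Integrable (fun y => (Real.exp (u y) : ℂ) * cau (fun y => Real.exp (u y)) y * (z - y)⁻¹) ∧
    ∫ y, (Real.exp (u y) : ℂ) * cau (fun y => Real.exp (u y)) y * (z - y)⁻¹ =
    (cau (fun y => Real.exp (u y)) z) ^ 2 / 2 := by
  have hA : ∀ y, Real.exp (u y) ≤ 1 := fun y => Real.exp_le_one_iff.2 (hneg y)
  set g : ℂ → ℝ := fun y => Real.exp (u y) with hgdef
  have hg0 : ∀ y, 0 ≤ g y := fun y => (Real.exp_pos _).le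
  have hcont : Continuous g :=
    continuous_iff_continuousAt.2 (fun z => (cl_dg hint hneg hrep z).continuousAt)
  have hci := cau_integrable hint hg0 hA z
  set K : ℂ × ℂ → ℂ := fun p => (g p.1 : ℂ) * (g p.2 : ℂ) * (p.1 - p.2)⁻¹ * (z - p.1)⁻¹ with hK
  have hKm : Measurable K := by
    have := hcont.measurable
    rw [hK]; fun_prop
  set M := 2 * π * 1 + ∫ y, g y with hM
  have hKi : Integrable K (volume.prod volume) := by
    rw [integrable_prod_iff hKm.aestronglyMeasurable]
    have e : ∀ y t, K (y, t) = ((g y : ℂ) * (z - y)⁻¹) * ((g t : ℂ) * (y - t)⁻¹) := by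
      intro y t; simp only [hK]; ring
    refine ⟨Eventually.of_forall fun y => ?_, ?_⟩
    · simp_rw [e]
      exact (cau_integrable hint hg0 hA y).const_mul _
    · refine (hci.norm.const_mul M).mono' ?_ ?_
      · exact hKm.norm.stronglyMeasurable.integral_prod_right.aestronglyMeasurable
      · refine Eventually.of_forall fun y => ?_
        rw [Real.norm_of_nonneg (integral_nonneg fun _ => norm_nonneg _)]
        simp_rw [e, norm_mul _ ((g _ : ℂ) * (y - _)⁻¹)]
        rw [integral_const_mul, mul_comm]
        refine mul_le_mul_of_nonneg_right ?_ (norm_nonneg _)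
        have h := (riesz1 (z := y) one_pos hint hg0 (A := 1) (fun y _ => hA y)).2
        have e3 : ∀ t, ‖(g t : ℂ) * (y - t)⁻¹‖ = g t * ‖y - t‖⁻¹ := by
          intro t
          rw [norm_mul, norm_inv, Complex.norm_real, Real.norm_of_nonneg (hg0 t)]
        simp_rw [e3]
        simpa [hM] using h
  have e1 : ∀ y, ∫ t, K (y, t) = (g y : ℂ) * cau g y * (z - y)⁻¹ := by
    intro y
    rw [cau, mul_right_comm, ← integral_const_mul]
    congr 1; funext t; simp only [hK]; ring
  have i1 := hKi.integral_prod_left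
  simp_rw [e1] at i1
  refine ⟨i1, ?_⟩
  have e2 : ∫ p, K p ∂(volume.prod volume) = ∫ y, (g y : ℂ) * cau g y * (z - y)⁻¹ := by
    rw [integral_prod _ hKi]; simp_rw [e1]
  rw [← e2]
  have e3 : ∫ p, K p ∂(volume.prod volume) = ∫ p : ℂ × ℂ, K p.swap ∂(volume.prod volume) :=
    (integral_prod_swap K).symm
  have e4 : ∫ p : ℂ × ℂ, (K p + K p.swap) ∂(volume.prod volume) = cau g z * cau g z := by
    rw [cau, ← integral_prod_mul]
    refine integral_congr_ae ?_
    have a1 : ∀ᵐ p : ℂ × ℂ ∂(volume.prod volume), p.1 ≠ z := by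
      exact Measure.quasiMeasurePreserving_fst.ae ((ae_ne z).mono fun y hy => hy.symm)
    have a2 : ∀ᵐ p : ℂ × ℂ ∂(volume.prod volume), p.2 ≠ z := by
      exact Measure.quasiMeasurePreserving_snd.ae ((ae_ne z).mono fun y hy => hy.symm)
    have a3 : ∀ᵐ p : ℂ × ℂ ∂(volume.prod volume), p.1 ≠ p.2 := by
      rw [Measure.ae_prod_iff_ae_ae]
      · exact Eventually.of_forall fun y => ae_ne y
      · exact (measurableSet_eq_fun measurable_fst measurable_snd).compl
    filter_upwards [a1, a2, a3] with p h1 h2 h3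
    have h1' := sub_ne_zero.2 h1.symm
    have h2' := sub_ne_zero.2 h2.symm
    have h3' := sub_ne_zero.2 h3
    have h4' := sub_ne_zero.2 h3.symm
    simp only [hK, Prod.fst_swap, Prod.snd_swap]
    have : (p.2 - p.1)⁻¹ = - (p.1 - p.2)⁻¹ := by rw [← neg_sub, inv_neg]
    rw [this]
    field_simp
    ring
  have hKs : Integrable (fun p : ℂ × ℂ => K p.swap) (volume.prod volume) := hKi.swap
  rw [integral_add hKi hKs, ← e3] at e4
  rw [sq, ← e4]; ring

include hint hneg hrep in
lemma cl_D (z : ℂ) : ∃ L : ℂ →L[ℝ] ℂ, HasFDerivAt (cau (fun y => Real.exp (u y))) L z ∧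
    ∀ ζ, L ζ = -(1 / (8 * π) : ℝ) * (cau (fun y => Real.exp (u y)) z) ^ 2 * ζ +
      (π * Real.exp (u z) : ℝ) * (starRingEnd ℂ ζ) := by
  obtain ⟨hLi, hL⟩ := cl_dcau hint hneg hrep z
  obtain ⟨hAi, hAe⟩ := cl_A hint hneg hrep z
  have hd := cl_dg hint hneg hrep
  set φ := cau (fun y => Real.exp (u y)) with hφ
  set L := ∫ y, (dg u (z - y)).smulRight (y⁻¹ : ℂ) with hLdef
  have hcont : Continuous (fun z => Real.exp (u z)) :=
    continuous_iff_continuousAt.2 (fun z => (hd z).continuousAt)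
  have hLz : ∀ ζ, L ζ = ∫ y, (dg u (z - y) ζ : ℂ) * y⁻¹ := by
    intro ζ
    rw [hLdef, ContinuousLinearMap.integral_apply hLi]
    simp
  have hLzi : ∀ ζ, Integrable (fun y => (dg u (z - y) ζ : ℂ) * y⁻¹) := by
    intro ζ
    have := hLi.apply_continuousLinearMap ζ
    simpa using this
  have hφc : Continuous φ := continuous_iff_continuousAt.2
    (fun z => (cl_dcau hint hneg hrep z).2.continuousAt)
  have hBi : Integrable (fun y => (Real.exp (u y) : ℂ) * (starRingEnd ℂ (φ y)) * (z - y)⁻¹) := by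
    refine hAi.norm.mono' ?_ (Eventually.of_forall fun y => ?_)
    · have h1 := hcont.measurable
      have h2 := hφc.measurable
      have h3 : Measurable (fun y => starRingEnd ℂ (φ y)) := (Complex.continuous_conj.comp hφc).measurable
      exact Measurable.aestronglyMeasurable (by fun_prop)
    · simp
  set B : ℂ := -(1 / (4 * π) : ℝ) * ∫ y, (Real.exp (u y) : ℂ) * (starRingEnd ℂ (φ y)) * (z - y)⁻¹ with hB
  have hLAB : ∀ ζ, L ζ = -(1 / (8 * π) : ℝ) * (φ z) ^ 2 * ζ + B * (starRingEnd ℂ ζ) := by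
    intro ζ
    rw [hLz, ← integral_sub_left_eq_self _ volume z]
    simp only [sub_sub_cancel]
    have e : ∀ y, (dg u y ζ : ℂ) * (z - y)⁻¹ =
        (-(1 / (4 * π) : ℝ) * ζ) * ((Real.exp (u y) : ℂ) * φ y * (z - y)⁻¹) +
        (-(1 / (4 * π) : ℝ) * starRingEnd ℂ ζ) *
          ((Real.exp (u y) : ℂ) * (starRingEnd ℂ (φ y)) * (z - y)⁻¹) := by
      intro y
      have e1 : (dg u y ζ : ℂ) = (Real.exp (u y) : ℂ) * (-(1 / (2 * π) : ℝ) *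
          ((φ y * ζ + starRingEnd ℂ (φ y) * starRingEnd ℂ ζ) / 2)) := by
        rw [← map_mul, ← Complex.re_eq_add_conj]
        simp only [dg, smul_apply, reMul_apply, smul_eq_mul]
        push_cast
        rfl
      rw [e1]
      push_cast
      ring
    simp_rw [e]
    rw [integral_add (hAi.const_mul _) (hBi.const_mul _), integral_const_mul, integral_const_mul,
      hAe, hB]
    push_cast
    ring
  have hBB : L 1 + Complex.I * L Complex.I = 2 * B := by
    rw [hLAB, hLAB, map_one, Complex.conj_I]
    linear_combination (-(1 / (8 * π) : ℝ) * (φ z) ^ 2 - B) * Complex.I_mul_I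
  have hBre : B.re = π * Real.exp (u z) := by
    set G : ℂ → ℝ := fun y => Real.exp (u (z - y)) with hG
    have hGd : ∀ y, HasFDerivAt G (-(dg u (z - y))) y := by
      intro y
      have := (hd (z - y)).comp y ((hasFDerivAt_id y).const_sub z)
      refine this.congr_fderiv ?_
      ext v; simp
    have hGi : Integrable G := hint.comp_sub_left z
    have e : ∀ y : ℂ, fderiv ℝ G y y * (‖y‖ ^ 2)⁻¹ =
        -(((dg u (z - y) 1 : ℂ) * y⁻¹ + Complex.I * ((dg u (z - y) Complex.I : ℂ) * y⁻¹)).re) := by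
      intro y
      rw [(hGd y).fderiv]
      have hy : y = y.re • (1:ℂ) + y.im • Complex.I := by
        simp [Complex.re_add_im]
      have e2 : dg u (z - y) y = y.re * dg u (z - y) 1 + y.im * dg u (z - y) Complex.I := by
        conv_lhs => rw [show dg u (z - y) y = dg u (z - y) (y.re • (1:ℂ) + y.im • Complex.I) by rw [← hy]]
        rw [map_add, map_smul, map_smul, smul_eq_mul, smul_eq_mul]
      rw [neg_apply, e2, ← Complex.normSq_eq_norm_sq]
      simp only [Complex.add_re, Complex.mul_re, Complex.I_re, Complex.I_im, Complex.mul_im,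
        Complex.ofReal_re, Complex.ofReal_im, Complex.inv_re, Complex.inv_im]
      ring
    have hi : Integrable (fun y => ((dg u (z - y) 1 : ℂ) * y⁻¹ +
        Complex.I * ((dg u (z - y) Complex.I : ℂ) * y⁻¹))) :=
      (hLzi 1).add ((hLzi Complex.I).const_mul _)
    have hi' : Integrable (fun y : ℂ => fderiv ℝ G y y * (‖y‖ ^ 2)⁻¹) := by
      simp_rw [e]; exact hi.re.neg
    have h1 := radial_ibp (fun y => (hGd y).differentiableAt) hGi hi'
    simp_rw [e] at h1
    rw [integral_neg] at h1
    have h2 : ∫ y, ((dg u (z - y) 1 : ℂ) * y⁻¹ + Complex.I * ((dg u (z - y) Complex.I : ℂ) * y⁻¹)).re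
      = (2 * B).re := by
      rw [← hBB, hLz, hLz, ← integral_const_mul, ← integral_add (hLzi 1) ((hLzi Complex.I).const_mul _)]
      exact integral_re hi
    rw [h2] at h1
    have h3 : (2 * B).re = 2 * B.re := by simp
    rw [h3] at h1
    simp only [hG, sub_zero] at h1
    linarith
  have hBim : B.im = 0 := by
    set R : ℂ →L[ℝ] (ℂ →L[ℝ] ℝ) :=
      (ContinuousLinearMap.compL ℝ ℂ ℂ ℝ Complex.reCLM).comp (ContinuousLinearMap.mul ℝ ℂ) with hR
    have hRe : ∀ c, R c = reMul c := fun c => rfl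
    have hf : ∀ y, HasFDerivAt u (((-(1 / (2 * π)) : ℝ) • R) (φ y)) y := fun y =>
      cl_du hint hneg hrep y
    have hs := second_derivative_symmetric hf
      ((((-(1 / (2 * π)) : ℝ) • R).hasFDerivAt (x := φ z)).comp z hL) 1 Complex.I
    simp only [ContinuousLinearMap.comp_apply, smul_apply, hRe, reMul_apply, smul_eq_mul] at hs
    have hp : (-(1 / (2 * π)) : ℝ) ≠ 0 := by
      have := pi_pos; simp [this.ne']
    have hs2 := mul_left_cancel₀ hp hs
    rw [hLAB, hLAB, map_one, Complex.conj_I] at hs2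
    simp only [Complex.mul_re, Complex.add_re, Complex.add_im, Complex.mul_im, Complex.I_re,
      Complex.I_im, Complex.neg_re, Complex.neg_im, Complex.one_re, Complex.one_im] at hs2
    linarith
  refine ⟨L, hL, fun ζ => ?_⟩
  have : B = (π * Real.exp (u z) : ℝ) := by
    apply Complex.ext
    · rw [hBre, Complex.ofReal_re]
    · rw [hBim, Complex.ofReal_im]
  rw [hLAB, this]

include hint hneg hrep h0 in
theorem classification (z : ℂ) : u z = -2 * Real.log (1 + ‖z‖ ^ 2 / 8) := by
  have hdu := cl_du hint hneg hrep
  have hD := cl_D hint hneg hrep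
  set φ := cau (fun y => Real.exp (u y)) with hφ
  have hφ0 : φ 0 = 0 := by
    have hm : IsLocalMax u 0 := Eventually.of_forall fun y => by rw [h0]; exact hneg y
    have h1 := hm.hasFDerivAt_eq_zero (hdu 0)
    have h2 := congrArg (fun L : ℂ →L[ℝ] ℝ => L (starRingEnd ℂ (φ 0))) h1
    simp only [smul_apply, reMul_apply, smul_eq_mul, Complex.mul_conj, Complex.ofReal_re,
      zero_apply] at h2
    have hp : (-(1 / (2 * π)) : ℝ) ≠ 0 := by
      have := pi_pos; simp [this.ne']
    have h3 := (mul_eq_zero.1 h2).resolve_left hp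
    exact Complex.normSq_eq_zero.1 h3
  set w : ℂ → ℝ := fun z => Real.exp (-(u z) / 2) with hw
  have hwd : ∀ z, HasFDerivAt w ((w z / (4 * π)) • reMul (φ z)) z := by
    intro z
    have h1 := (((hdu z).neg).mul_const (1 / 2 : ℝ)).exp
    have e : w = fun z => Real.exp ((-u) z * (1 / 2)) := by
      funext z; simp only [hw, Pi.neg_apply]; congr 1; ring
    rw [e]
    refine h1.congr_fderiv ?_
    ext ζ
    simp only [smul_apply, neg_apply, smul_eq_mul, reMul_apply]
    have := pi_pos
    field_simp
    ring
  set r : ℂ → ℝ := fun z => w z * (Real.exp (u z) / 8 + ‖φ z‖ ^ 2 / (64 * π ^ 2)) with hr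
  set H : ℂ → ℂ := fun z => starRingEnd ℂ (φ z) * (w z : ℂ) * (1 / (8 * π) : ℝ) with hH
  have hHd : ∀ z, HasDerivAt H (r z : ℂ) z := by
    intro z
    obtain ⟨L, hL, hLe⟩ := hD z
    have h1 : HasFDerivAt (fun z => starRingEnd ℂ (φ z))
        ((Complex.conjCLE : ℂ →L[ℝ] ℂ).comp L) z :=
      (Complex.conjCLE : ℂ →L[ℝ] ℂ).hasFDerivAt.comp z hL
    have h2 : HasFDerivAt (fun z => (w z : ℂ)) (Complex.ofRealCLM.comp ((w z / (4 * π)) • reMul (φ z))) z :=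
      Complex.ofRealCLM.hasFDerivAt.comp z (hwd z)
    have h3 := (h1.mul h2).mul_const ((1 / (8 * π) : ℝ) : ℂ)
    rw [hasDerivAt_iff_hasFDerivAt]
    refine hasFDerivAt_of_restrictScalars ℝ h3 ?_
    ext ζ
    have e1 : (reMul (φ z) ζ : ℂ) = (φ z * ζ + starRingEnd ℂ (φ z) * starRingEnd ℂ ζ) / 2 := by
      rw [← map_mul, ← Complex.re_eq_add_conj]; rfl
    have e2 : ((‖φ z‖ ^ 2 : ℝ) : ℂ) = φ z * starRingEnd ℂ (φ z) := by
      rw [Complex.mul_conj, Complex.normSq_eq_norm_sq]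
    have hp : (π : ℂ) ≠ 0 := by exact_mod_cast pi_pos.ne'
    simp only [ContinuousLinearMap.coe_restrictScalars', ContinuousLinearMap.toSpanSingleton_apply,
      smul_apply, add_apply, ContinuousLinearMap.comp_apply, Complex.ofRealCLM_apply, smul_eq_mul,
      ContinuousLinearEquiv.coe_coe, Complex.conjCLE_apply, hLe, hr]
    push_cast
    push_cast at e2
    rw [e1, e2]
    simp only [map_add, map_mul, map_neg, map_pow, map_div₀, map_one, Complex.conj_ofReal,
      Complex.conj_conj, map_ofNat, ← Complex.exp_conj]
    field_simp
    ring
  have hHdiff : Differentiable ℂ H := fun z => (hHd z).differentiableAt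
  have hH' : deriv H = fun z => (r z : ℂ) := funext fun z => (hHd z).deriv
  have hrdiff : Differentiable ℂ (fun z => (r z : ℂ)) := by
    rw [← hH']; exact hHdiff.deriv
  have hne : ∀ z, (r z : ℂ) + Complex.I ≠ 0 := by
    intro z h
    have := congrArg Complex.im h
    simp at this
  have hconst : ∀ z, r z = r 0 := by
    intro z
    have h1 : Differentiable ℂ (fun z => ((r z : ℂ) + Complex.I)⁻¹) := fun z =>
      ((hrdiff z).add_const _).inv (hne z)
    have h2 : IsBounded (Set.range (fun z => ((r z : ℂ) + Complex.I)⁻¹)) := by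
      rw [isBounded_iff_forall_norm_le]
      refine ⟨1, ?_⟩
      rintro _ ⟨z, rfl⟩
      rw [norm_inv]
      apply inv_le_one_of_one_le₀
      have := Complex.abs_im_le_norm ((r z : ℂ) + Complex.I)
      simpa using this
    have h3 := h1.apply_eq_apply_of_bounded h2 z 0
    have h4 := inv_injective h3
    have h5 := congrArg Complex.re h4
    simpa using h5
  have hr0 : r 0 = 1 / 8 := by
    simp [hr, hw, h0, hφ0]
  have hHz : ∀ z, H z = z / 8 := by
    intro z
    have hd : ∀ z, HasDerivAt (fun z => H z - z / 8) 0 z := by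
      intro z
      refine ((hHd z).sub ((hasDerivAt_id z).div_const 8)).congr_deriv ?_
      rw [hconst, hr0]; simp
    have := is_const_of_deriv_eq_zero (fun z => (hd z).differentiableAt) (fun z => (hd z).deriv) z 0
    simp only [hH, hφ0] at this ⊢
    simp at this
    have h2 := sub_eq_zero.1 this
    rw [← h2]; simp
  have hφw : ∀ z, φ z * w z = π * starRingEnd ℂ z := by
    intro z
    have h1 := congrArg (starRingEnd ℂ) (hHz z)
    simp only [hH, map_mul, Complex.conj_conj, Complex.conj_ofReal, map_div₀, map_ofNat] at h1
    have hp : (π : ℂ) ≠ 0 := by exact_mod_cast pi_pos.ne'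
    push_cast at h1
    field_simp at h1
    rw [h1]
  have hwz : w z = 1 + ‖z‖ ^ 2 / 8 := by
    have hq : ∀ z : ℂ, HasFDerivAt (fun z : ℂ => 1 + ‖z‖ ^ 2 / 8)
        ((1 / 4 : ℝ) • reMul (starRingEnd ℂ z)) z := by
      intro z
      have h1 := ((hasStrictFDerivAt_norm_sq z).hasFDerivAt.mul_const (8⁻¹ : ℝ)).const_add 1
      simp only [← div_eq_mul_inv] at h1
      refine h1.congr_fderiv ?_
      ext ζ
      simp only [smul_apply, reMul_apply, smul_eq_mul, innerSL_apply_apply, Complex.inner]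
      simp
      ring
    have hd : ∀ z, HasFDerivAt (fun z => w z - (1 + ‖z‖ ^ 2 / 8)) (0 : ℂ →L[ℝ] ℝ) z := by
      intro z
      refine ((hwd z).sub (hq z)).congr_fderiv ?_
      ext ζ
      have e : (φ z * ζ).re * w z = π * (starRingEnd ℂ z * ζ).re := by
        have := congrArg (fun t : ℂ => (t * ζ).re) (hφw z)
        rw [mul_right_comm, mul_assoc (π : ℂ), Complex.re_mul_ofReal, Complex.re_ofReal_mul] at this
        exact this
      simp only [sub_apply, smul_apply, reMul_apply, smul_eq_mul, zero_apply]
      have := pi_pos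
      rw [show w z / (4 * π) * (φ z * ζ).re = ((φ z * ζ).re * w z) / (4 * π) by ring, e]
      field_simp
      ring
    have := is_const_of_fderiv_eq_zero (fun z => (hd z).differentiableAt) (fun z => (hd z).fderiv) z 0
    simp [hw, h0] at this
    linarith
  have := congrArg Real.log hwz
  simp only [hw, Real.log_exp] at this
  linarith

end classif

end BU

end

section
open MeasureTheory Real Filter Topology Metric Bornology
open scoped RealInnerProductSpace

namespace BU

/-- the bubble -/
def U0 (z : ℂ) : ℝ := -2 * Real.log (1 + ‖z‖ ^ 2 / 8)

/-- hypotheses of the blow-up lemma -/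
structure BL (w g : ℕ → ℂ → ℝ) (M : ℝ) : Prop where
  hg : ∀ k, Integrable (g k)
  g0 : ∀ k z, 0 ≤ g k z
  hM : ∀ k, ∫ z, g k z ≤ M
  hw0 : ∀ k, w k 0 = 0
  hwneg : ∀ ρ : ℝ, ∀ᶠ k in atTop, ∀ z : ℂ, ‖z‖ ≤ ρ → w k z ≤ 0
  hθ : ∀ ρ ε : ℝ, 0 < ε → ∀ᶠ k in atTop, ∀ z : ℂ, ‖z‖ ≤ ρ →
    |g k z - Real.exp (w k z)| ≤ ε * Real.exp (w k z)
  hη : ∀ ρ ε : ℝ, 0 < ε → ∀ᶠ k in atTop, ∀ z : ℂ, ‖z‖ ≤ ρ →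
    |w k z + 1 / (2 * π) * ∫ y, (Real.log ‖z - y‖ - Real.log ‖y‖) * g k y| ≤ ε

lemma BL.comp {w g : ℕ → ℂ → ℝ} {M : ℝ} (h : BL w g M) {n : ℕ → ℕ} (hn : Tendsto n atTop atTop) :
    BL (fun k => w (n k)) (fun k => g (n k)) M where
  hg _ := h.hg _
  g0 _ := h.g0 _
  hM _ := h.hM _
  hw0 _ := h.hw0 _
  hwneg ρ := hn.eventually (h.hwneg ρ)
  hθ ρ ε hε := hn.eventually (h.hθ ρ ε hε)
  hη ρ ε hε := hn.eventually (h.hη ρ ε hε)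

lemma BL.g_le {w g : ℕ → ℂ → ℝ} {M : ℝ} (h : BL w g M) (ρ : ℝ) :
    ∀ᶠ k in atTop, ∀ z : ℂ, ‖z‖ ≤ ρ → g k z ≤ 2 := by
  filter_upwards [h.hwneg ρ, h.hθ ρ 1 one_pos] with k h1 h2 z hz
  have h3 := Real.exp_le_one_iff.2 (h1 z hz)
  have h4 := (abs_le.1 (h2 z hz)).2
  linarith

/-- the Lipschitz constant -/
def lipC (M : ℝ) : ℝ := 1 / (2 * π) * (2 * (2 * π * 2 * 1 + 1⁻¹ * M))

lemma lipC_nonneg {M : ℝ} (hM : 0 ≤ M) : 0 ≤ lipC M := by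
  have := pi_pos
  unfold lipC; positivity

lemma BL.M0 {w g : ℕ → ℂ → ℝ} {M : ℝ} (h : BL w g M) : 0 ≤ M :=
  (integral_nonneg (h.g0 0)).trans (h.hM 0)

lemma BL.lip {w g : ℕ → ℂ → ℝ} {M : ℝ} (h : BL w g M) (ρ ε : ℝ) (hε : 0 < ε) :
    ∀ᶠ k in atTop, ∀ z z' : ℂ, ‖z‖ ≤ ρ → ‖z'‖ ≤ ρ → |w k z - w k z'| ≤ lipC M * ‖z - z'‖ + ε := by
  filter_upwards [h.g_le (ρ + 1), h.g_le 1, h.hη ρ (ε / 2) (half_pos hε)] with k h1 h1' h2 z z' hz hz'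
  have hb : ∀ x : ℂ, ‖x‖ ≤ ρ → ∀ y ∈ ball x 1, g k y ≤ 2 := by
    intro x hx y hy
    apply h1
    have := norm_add_le (y - x) x
    rw [mem_ball, dist_eq_norm] at hy
    simp at this
    linarith
  have hb0 : ∀ y ∈ ball (0:ℂ) 1, g k y ≤ 2 := by
    intro y hy
    apply h1'
    rw [mem_ball, dist_zero_right] at hy
    exact hy.le
  have l1 := (logdiff one_pos (z := z) (z' := 0) (h.hg k) (h.g0 k) (hb z hz) hb0).1
  have l2 := (logdiff one_pos (z := z') (z' := 0) (h.hg k) (h.g0 k) (hb z' hz') hb0).1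
  have l3 := logdiff one_pos (z := z) (z' := z') (h.hg k) (h.g0 k) (hb z hz) (hb z' hz')
  simp only [zero_sub, norm_neg] at l1 l2
  have e : (∫ y, (Real.log ‖z - y‖ - Real.log ‖z' - y‖) * g k y) =
      (∫ y, (Real.log ‖z - y‖ - Real.log ‖y‖) * g k y) -
      ∫ y, (Real.log ‖z' - y‖ - Real.log ‖y‖) * g k y := by
    rw [← integral_sub l1 l2]
    congr 1; funext y; ring
  have h3 := h2 z hz
  have h4 := h2 z' hz'
  have h5 : |∫ y, (Real.log ‖z - y‖ - Real.log ‖z' - y‖) * g k y| ≤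
      ‖z - z'‖ * (2 * (2 * π * 2 * 1 + 1⁻¹ * M)) := by
    refine abs_integral_le_integral_abs.trans (l3.2.trans ?_)
    refine mul_le_mul_of_nonneg_left ?_ (norm_nonneg _)
    have := h.hM k
    linarith
  have h6 : |1 / (2 * π) * ∫ y, (Real.log ‖z - y‖ - Real.log ‖z' - y‖) * g k y| ≤
      lipC M * ‖z - z'‖ := by
    rw [abs_mul, abs_of_pos (by positivity : (0:ℝ) < 1 / (2 * π)), lipC, mul_assoc,
      mul_comm _ ‖z - z'‖]
    exact mul_le_mul_of_nonneg_left h5 (by positivity)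
  rw [e, mul_sub] at h6
  rw [abs_le] at h3 h4 h6 ⊢
  constructor <;> linarith [h3.1, h3.2, h4.1, h4.2, h6.1, h6.2]

/-- a pointwise convergent subsequence -/
lemma BL.subseq {w g : ℕ → ℂ → ℝ} {M : ℝ} (h : BL w g M) :
    ∃ (n : ℕ → ℕ) (W : ℂ → ℝ), StrictMono n ∧
      ∀ z, Tendsto (fun k => w (n k) z) atTop (𝓝 (W z)) := by
  set q := TopologicalSpace.denseSeq ℂ with hq
  have hqd : DenseRange q := TopologicalSpace.denseRange_denseSeq ℂ
  set b : ℕ → ℝ := fun i => lipC M * ‖q i‖ + 1 with hb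
  have hb0 : ∀ i, 0 ≤ b i := fun i => by
    have := mul_nonneg (lipC_nonneg h.M0) (norm_nonneg (q i))
    simp only [hb]; linarith
  have hev : ∀ i, ∀ᶠ k in atTop, w k (q i) ∈ Set.Icc (-b i) (b i) := by
    intro i
    filter_upwards [h.lip ‖q i‖ 1 one_pos] with k hk
    have := hk (q i) 0 le_rfl (by simp)
    rw [h.hw0, sub_zero, sub_zero] at this
    exact abs_le.1 this
  set x : ℕ → ℕ → ℝ := fun k i => max (-b i) (min (w k (q i)) (b i)) with hx
  have hxm : ∀ k, x k ∈ Set.univ.pi (fun i => Set.Icc (-b i) (b i)) := by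
    intro k i _
    refine ⟨le_max_left _ _, max_le (by linarith [hb0 i]) (min_le_right _ _)⟩
  obtain ⟨a, _, n, hn, hlim⟩ := (isCompact_univ_pi fun i => isCompact_Icc).tendsto_subseq hxm
  have hq1 : ∀ i, Tendsto (fun k => w (n k) (q i)) atTop (𝓝 (a i)) := by
    intro i
    have h1 := (tendsto_pi_nhds.1 hlim) i
    refine h1.congr' ?_
    filter_upwards [hn.tendsto_atTop.eventually (hev i)] with k hk
    simp only [Function.comp_apply, hx]
    rw [min_eq_left hk.2, max_eq_right hk.1]
  have hc : ∀ z, ∃ l, Tendsto (fun k => w (n k) z) atTop (𝓝 l) := by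
    intro z
    apply cauchySeq_tendsto_of_complete
    rw [Metric.cauchySeq_iff']
    intro ε hε
    have hL := lipC_nonneg h.M0
    obtain ⟨i, hi⟩ := hqd.exists_dist_lt z (show 0 < ε / 8 / (lipC M + 1) by positivity)
    have hi' : lipC M * ‖z - q i‖ ≤ ε / 8 := by
      rw [dist_eq_norm, lt_div_iff₀ (by linarith)] at hi
      nlinarith [norm_nonneg (z - q i)]
    obtain ⟨N1, hN1⟩ := eventually_atTop.1 (hn.tendsto_atTop.eventually
      (h.lip (max ‖z‖ ‖q i‖) (ε / 8) (by positivity)))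
    obtain ⟨N2, hN2⟩ := Metric.tendsto_atTop.1 (hq1 i) (ε / 8) (by positivity)
    refine ⟨max N1 N2, fun k hk => ?_⟩
    have k1 := hN1 k (le_trans (le_max_left _ _) hk) z (q i) (le_max_left _ _) (le_max_right _ _)
    have k2 := hN1 (max N1 N2) (le_max_left _ _) z (q i) (le_max_left _ _) (le_max_right _ _)
    have k3 := hN2 k (le_trans (le_max_right _ _) hk)
    have k4 := hN2 (max N1 N2) (le_max_right _ _)
    rw [Real.dist_eq, abs_lt] at *
    rw [abs_le] at k1 k2
    constructor <;> linarith [k1.1, k1.2, k2.1, k2.2, k3.1, k3.2, k4.1, k4.2]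
  choose W hW using hc
  exact ⟨n, W, hn, hW⟩

/-- if `w k → W` pointwise then `W` is the bubble -/
lemma BL.limit {w g : ℕ → ℂ → ℝ} {M : ℝ} (h : BL w g M) {W : ℂ → ℝ}
    (hW : ∀ z, Tendsto (fun k => w k z) atTop (𝓝 (W z))) (z : ℂ) : W z = U0 z := by
  have hL := lipC_nonneg h.M0
  have hWneg : ∀ z, W z ≤ 0 := fun z => le_of_tendsto (hW z)
    ((h.hwneg ‖z‖).mono fun k hk => hk z le_rfl)
  have hW0 : W 0 = 0 := tendsto_nhds_unique (hW 0) (by simp_rw [h.hw0]; exact tendsto_const_nhds)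
  have hWlip : ∀ z z', |W z - W z'| ≤ lipC M * ‖z - z'‖ := by
    intro z z'
    apply le_of_forall_pos_le_add
    intro ε hε
    refine le_of_tendsto ((hW z).sub (hW z')).abs ?_
    filter_upwards [h.lip (max ‖z‖ ‖z'‖) ε hε] with k hk
    exact hk z z' (le_max_left _ _) (le_max_right _ _)
  have hWc : Continuous W := by
    have : LipschitzWith (Real.toNNReal (lipC M)) W := by
      apply LipschitzWith.of_dist_le_mul
      intro x y
      rw [Real.dist_eq, dist_eq_norm, Real.coe_toNNReal _ hL]
      exact hWlip x y
    exact this.continuous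
  have hgW : ∀ z, Tendsto (fun k => g k z) atTop (𝓝 (Real.exp (W z))) := by
    intro z
    have h1 : Tendsto (fun k => Real.exp (w k z)) atTop (𝓝 (Real.exp (W z))) :=
      (Real.continuous_exp.tendsto _).comp (hW z)
    have h2 : Tendsto (fun k => g k z - Real.exp (w k z)) atTop (𝓝 0) := by
      rw [Metric.tendsto_nhds]
      intro ε hε
      filter_upwards [h.hθ ‖z‖ (ε / 2) (by positivity), h.hwneg ‖z‖] with k hk hk2
      rw [dist_zero_right, Real.norm_eq_abs]
      have := Real.exp_le_one_iff.2 (hk2 z le_rfl)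
      have := hk z le_rfl
      nlinarith
    simpa using h2.add h1
  have hint : Integrable (fun y => Real.exp (W y)) := by
    refine ⟨(Real.continuous_exp.comp hWc).aestronglyMeasurable, ?_⟩
    rw [hasFiniteIntegral_iff_ofReal (Eventually.of_forall fun y => (Real.exp_pos _).le)]
    have h1 : ∀ y, ENNReal.ofReal (Real.exp (W y)) =
        liminf (fun k => ENNReal.ofReal (g k y)) atTop := fun y =>
      ((ENNReal.continuous_ofReal.tendsto _).comp (hgW y)).liminf_eq.symm
    simp_rw [h1]
    refine (lintegral_liminf_le' fun k => (h.hg k).aestronglyMeasurable.aemeasurable.ennreal_ofReal).trans_lt ?_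
    have h2 : ∀ k, ∫⁻ y, ENNReal.ofReal (g k y) ≤ ENNReal.ofReal M := by
      intro k
      rw [← ofReal_integral_eq_lintegral_ofReal (h.hg k) (Eventually.of_forall (h.g0 k))]
      exact ENNReal.ofReal_le_ofReal (h.hM k)
    refine lt_of_le_of_lt ?_ (ENNReal.ofReal_lt_top (r := M))
    refine (liminf_le_liminf (Eventually.of_forall h2)).trans ?_
    simp
  have hintM : 0 ≤ ∫ y, Real.exp (W y) := integral_nonneg fun y => (Real.exp_pos _).le
  refine classification hint hWneg hW0 (fun z => ?_) z
  set K : ℂ → ℝ := fun y => Real.log ‖z - y‖ - Real.log ‖y‖ with hK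
  have hA1 : ∀ y, Real.exp (W y) ≤ 1 := fun y => Real.exp_le_one_iff.2 (hWneg y)
  have iW : Integrable (fun y => K y * Real.exp (W y)) := by
    have := (logdiff one_pos (z := z) (z' := 0) hint (fun y => (Real.exp_pos _).le)
      (fun y _ => hA1 y) (fun y _ => hA1 y)).1
    simpa [hK] using this
  have ig : ∀ᶠ k in atTop, Integrable (fun y => K y * g k y) := by
    filter_upwards [h.g_le (‖z‖ + 1), h.g_le 1] with k h1 h1'
    have := (logdiff one_pos (z := z) (z' := 0) (A := 2) (h.hg k) (h.g0 k) ?_ ?_).1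
    · simpa [hK] using this
    · intro y hy
      apply h1
      have := norm_add_le (y - z) z
      rw [mem_ball, dist_eq_norm] at hy
      simp at this
      linarith
    · intro y hy
      apply h1'
      rw [mem_ball, dist_zero_right] at hy
      exact hy.le
  have hKb : ∀ ρ, 2 * ‖z‖ + 1 ≤ ρ → IntegrableOn K (ball 0 ρ) := by
    intro ρ _
    have a1 := log_int_ball 0 ρ z
    have a2 := log_int_ball 0 ρ 0
    simp_rw [norm_sub_rev _ z] at a1
    simp only [sub_zero] at a2
    exact a1.sub a2
  have hKt : ∀ ρ, 2 * ‖z‖ + 1 ≤ ρ → ∀ y ∈ (ball (0:ℂ) ρ)ᶜ, |K y| ≤ 3 * ‖z‖ / ρ := by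
    intro ρ hρ y hy
    have hρ0 : 0 < ρ := by linarith [norm_nonneg z]
    have hy' : ρ ≤ ‖y‖ := by simpa using hy
    have hzy : ρ / 2 ≤ ‖z - y‖ := by
      have := norm_sub_norm_le y z
      rw [norm_sub_rev] at this
      linarith
    have hy0 : y ≠ 0 := by
      intro h; rw [h, norm_zero] at hy'; linarith
    have hzy0 : z ≠ y := by
      intro h; rw [h, sub_self, norm_zero] at hzy; linarith
    have := abs_log_norm_sub_le z 0 y hzy0 hy0.symm
    simp only [sub_zero, zero_sub, norm_neg] at this
    refine this.trans ?_
    have i1 : ‖z - y‖⁻¹ ≤ 2 / ρ := by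
      rw [inv_le_comm₀ (by linarith) (by positivity)]
      rw [inv_div]; exact hzy
    have i2 : ‖y‖⁻¹ ≤ 1 / ρ := by
      rw [inv_le_comm₀ (by linarith) (by positivity)]
      simpa using hy'
    have : ‖z‖ * (‖z - y‖⁻¹ + ‖y‖⁻¹) ≤ ‖z‖ * (2 / ρ + 1 / ρ) :=
      mul_le_mul_of_nonneg_left (add_le_add i1 i2) (norm_nonneg _)
    refine this.trans (le_of_eq ?_)
    ring
  -- tail estimate
  have tail : ∀ ρ, 2 * ‖z‖ + 1 ≤ ρ → ∀ G : ℂ → ℝ, Integrable G → (∀ y, 0 ≤ G y) →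
      Integrable (fun y => K y * G y) →
      |(∫ y, K y * G y) - ∫ y in ball 0 ρ, K y * G y| ≤ 3 * ‖z‖ / ρ * ∫ y, G y := by
    intro ρ hρ G hG hG0 hKG
    have hρ0 : 0 < ρ := by linarith [norm_nonneg z]
    rw [← integral_add_compl measurableSet_ball hKG, add_sub_cancel_left]
    refine abs_integral_le_integral_abs.trans ?_
    rw [← integral_const_mul]
    refine (setIntegral_mono_on hKG.abs.integrableOn (hG.const_mul _).integrableOn
      measurableSet_ball.compl (fun y hy => ?_)).trans
      (setIntegral_le_integral (hG.const_mul _) (Eventually.of_forall fun y => ?_))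
    · rw [abs_mul, abs_of_nonneg (hG0 y)]
      exact mul_le_mul_of_nonneg_right (hKt ρ hρ y hy) (hG0 y)
    · exact mul_nonneg (by positivity) (hG0 y)
  have hlim : Tendsto (fun k => ∫ y, K y * g k y) atTop (𝓝 (∫ y, K y * Real.exp (W y))) := by
    rw [Metric.tendsto_nhds]
    intro ε hε
    set Q := M + ∫ y, Real.exp (W y) with hQ
    have hQ0 : 0 ≤ Q := add_nonneg h.M0 hintM
    obtain ⟨ρ, hρ1, hρ2⟩ : ∃ ρ : ℝ, 2 * ‖z‖ + 1 ≤ ρ ∧ 3 * ‖z‖ / ρ * Q ≤ ε / 2 := by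
      refine ⟨2 * ‖z‖ + 1 + 6 * ‖z‖ * Q / ε, ?_, ?_⟩
      · have : 0 ≤ 6 * ‖z‖ * Q / ε := by positivity
        linarith
      · rw [div_mul_eq_mul_div, div_le_iff₀ (by positivity), mul_add (ε / 2)]
        have : ε / 2 * (6 * ‖z‖ * Q / ε) = 3 * ‖z‖ * Q := by field_simp; ring
        rw [this]
        have : 0 ≤ ε / 2 * (2 * ‖z‖ + 1) := by positivity
        linarith
    have hb : Tendsto (fun k => ∫ y in ball 0 ρ, K y * g k y) atTop
        (𝓝 (∫ y in ball 0 ρ, K y * Real.exp (W y))) := by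
      refine tendsto_integral_filter_of_dominated_convergence (fun y => |K y| * 2) ?_ ?_
        ((hKb ρ hρ1).abs.mul_const 2) ?_
      · filter_upwards [ig] with k hk
        exact hk.aestronglyMeasurable.restrict
      · filter_upwards [h.g_le ρ] with k hk
        filter_upwards [self_mem_ae_restrict measurableSet_ball] with y hy
        rw [norm_mul, Real.norm_eq_abs, Real.norm_of_nonneg (h.g0 k y)]
        refine mul_le_mul_of_nonneg_left (hk y ?_) (abs_nonneg _)
        rw [mem_ball, dist_zero_right] at hy
        exact hy.le
      · exact Eventually.of_forall fun y => (hgW y).const_mul _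
    filter_upwards [ig, (Metric.tendsto_nhds.1 hb) (ε / 2) (by positivity)] with k k1 k2
    have t1 := tail ρ hρ1 (g k) (h.hg k) (h.g0 k) k1
    have t2 := tail ρ hρ1 _ hint (fun y => (Real.exp_pos _).le) iW
    have hc0 : 0 ≤ 3 * ‖z‖ / ρ := by
      have : 0 < ρ := by linarith [norm_nonneg z]
      positivity
    have t3 := mul_le_mul_of_nonneg_left (h.hM k) hc0
    rw [hQ, mul_add] at hρ2
    rw [Real.dist_eq, abs_lt] at *
    rw [abs_le] at t1 t2
    constructor <;> linarith [t1.1, t1.2, t2.1, t2.2, k2.1, k2.2]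
  have h1 : Tendsto (fun k => w k z + 1 / (2 * π) * ∫ y, K y * g k y) atTop (𝓝 0) := by
    rw [Metric.tendsto_nhds]
    intro ε hε
    filter_upwards [h.hη ‖z‖ (ε / 2) (by positivity)] with k hk
    rw [dist_zero_right, Real.norm_eq_abs]
    have := hk z le_rfl
    linarith
  have h2 := (hW z).add (hlim.const_mul (1 / (2 * π)))
  have h3 := tendsto_nhds_unique h2 h1
  simp only [hK] at h3
  linarith

theorem BL.tendsto {w g : ℕ → ℂ → ℝ} {M : ℝ} (h : BL w g M) (z : ℂ) :
    Tendsto (fun k => w k z) atTop (𝓝 (U0 z)) := by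
  refine tendsto_of_subseq_tendsto fun ns hns => ?_
  obtain ⟨n, W, hn, hW⟩ := (h.comp hns).subseq
  have h1 := ((h.comp hns).comp hn.tendsto_atTop).limit hW z
  exact ⟨n, by rw [← h1]; exact hW z⟩

theorem BL.tendsto_g {w g : ℕ → ℂ → ℝ} {M : ℝ} (h : BL w g M) (z : ℂ) :
    Tendsto (fun k => g k z) atTop (𝓝 (Real.exp (U0 z))) := by
  have h1 : Tendsto (fun k => Real.exp (w k z)) atTop (𝓝 (Real.exp (U0 z))) :=
    (Real.continuous_exp.tendsto _).comp (h.tendsto z)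
  have h2 : Tendsto (fun k => g k z - Real.exp (w k z)) atTop (𝓝 0) := by
    rw [Metric.tendsto_nhds]
    intro ε hε
    filter_upwards [h.hθ ‖z‖ (ε / 2) (by positivity), h.hwneg ‖z‖] with k hk hk2
    rw [dist_zero_right, Real.norm_eq_abs]
    have := Real.exp_le_one_iff.2 (hk2 z le_rfl)
    have := hk z le_rfl
    nlinarith
  simpa using h2.add h1

lemma exp_U0 (z : ℂ) : Real.exp (U0 z) = 64 * ((‖z‖ ^ 2 + 8) ^ 2)⁻¹ := by
  have h : 0 < 1 + ‖z‖ ^ 2 / 8 := by positivity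
  rw [U0, show -2 * Real.log (1 + ‖z‖ ^ 2 / 8) = -(Real.log (1 + ‖z‖ ^ 2 / 8) + Real.log (1 + ‖z‖ ^ 2 / 8)) by ring,
    Real.exp_neg, Real.exp_add, Real.exp_log h]
  field_simp
  ring

lemma exp_U0_int : Integrable (fun z => Real.exp (U0 z)) ∧ ∫ z, Real.exp (U0 z) = 8 * π := by
  have := bubble_int 8 (by norm_num)
  simp_rw [exp_U0]
  refine ⟨this.1.const_mul _, ?_⟩
  rw [integral_const_mul, this.2]; ring

/-- convergence of integrals against locally integrable functions on balls -/
theorem BL.tendsto_int {w g : ℕ → ℂ → ℝ} {M : ℝ} (h : BL w g M) (ρ : ℝ) {ψ : ℂ → ℝ}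
    (hψ : IntegrableOn ψ (ball 0 ρ)) :
    Tendsto (fun k => ∫ y in ball 0 ρ, ψ y * g k y) atTop
      (𝓝 (∫ y in ball 0 ρ, ψ y * Real.exp (U0 y))) := by
  refine tendsto_integral_filter_of_dominated_convergence (fun y => |ψ y| * 2) ?_ ?_
    (hψ.abs.mul_const 2) ?_
  · exact Eventually.of_forall fun k =>
      hψ.aestronglyMeasurable.mul (h.hg k).aestronglyMeasurable.restrict
  · filter_upwards [h.g_le ρ] with k hk
    filter_upwards [self_mem_ae_restrict measurableSet_ball] with y hy
    rw [norm_mul, Real.norm_eq_abs, Real.norm_of_nonneg (h.g0 k y)]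
    refine mul_le_mul_of_nonneg_left (hk y ?_) (abs_nonneg _)
    rw [mem_ball, dist_zero_right] at hy
    exact hy.le
  · exact Eventually.of_forall fun y => (h.tendsto_g y).const_mul _

end BU

end

section
open MeasureTheory Real Filter Topology Metric Bornology
open scoped RealInnerProductSpace

namespace BU

lemma eps_reg {u : ℂ → ℝ} (hu : ContDiff ℝ 2 u) (hsu : HasCompactSupport u) {x : ℂ} {r lam B : ℝ}
    (hr : 0 < r) (hl : 0 < lam) (hB : 0 ≤ B)
    (h : ∀ y ∈ ball x r, -(B * (lam * Real.exp (u y))) ≤ lapC u y)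
    (hm : ∫ y in ball x r, lam * Real.exp (u y) < π * Real.exp (-(4 * B))) :
    lam * Real.exp (u x) * r ^ 2 ≤ 4 := by
  have hc : Continuous u := hu.continuous
  set F : ℂ → ℝ := fun y => (r - ‖y - x‖) ^ 2 * (lam * Real.exp (u y)) with hF
  have hFc : Continuous F := by simp only [hF]; fun_prop
  obtain ⟨y0, hy0, hmax⟩ := (isCompact_closedBall x r).exists_isMaxOn
    ⟨x, mem_closedBall_self hr.le⟩ hFc.continuousOn
  have hmax' : ∀ y ∈ closedBall x r, F y ≤ F y0 := fun y hy => hmax hy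
  have hFx : F x = r ^ 2 * (lam * Real.exp (u x)) := by simp [hF]
  have hy0' : ‖y0 - x‖ ≤ r := by rwa [mem_closedBall, dist_eq_norm] at hy0
  set s := (r - ‖y0 - x‖) / 2 with hs
  set μ := lam * Real.exp (u y0) with hμ
  have hμ0 : 0 < μ := by positivity
  have hF0 : F y0 = 4 * (s ^ 2 * μ) := by simp only [hF, hs, hμ]; ring
  have hs0 : 0 ≤ s := by rw [hs]; linarith
  by_contra hcon
  push Not at hcon
  have h1 : 1 < s ^ 2 * μ := by
    have := hmax' x (mem_closedBall_self hr.le)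
    rw [hFx, hF0] at this
    nlinarith
  have hspos : 0 < s := by
    rcases hs0.eq_or_lt with h0 | h0
    · rw [← h0] at h1; norm_num at h1
    · exact h0
  set t := (Real.sqrt μ)⁻¹ with ht
  have ht0 : 0 < t := by positivity
  have ht2 : t ^ 2 * μ = 1 := by
    rw [ht, inv_pow, Real.sq_sqrt hμ0.le, inv_mul_cancel₀ hμ0.ne']
  have hts : t < s := by
    have : t ^ 2 < s ^ 2 := by
      by_contra hh
      push Not at hh
      nlinarith
    exact lt_of_pow_lt_pow_left₀ 2 hs0 this
  have hsub : ∀ y ∈ ball y0 t, y ∈ ball x r ∧ lam * Real.exp (u y) ≤ 4 * μ := by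
    intro y hy
    rw [mem_ball, dist_eq_norm] at hy
    have h3 : ‖y - x‖ ≤ ‖y - y0‖ + ‖y0 - x‖ := by
      have := norm_add_le (y - y0) (y0 - x); simpa using this
    have h4 : s ≤ r - ‖y - x‖ := by
      have : 2 * s = r - ‖y0 - x‖ := by rw [hs]; ring
      linarith
    refine ⟨by rw [mem_ball, dist_eq_norm]; linarith, ?_⟩
    have h5 := hmax' y (by rw [mem_closedBall, dist_eq_norm]; linarith)
    rw [hF0] at h5
    have h6 : s ^ 2 ≤ (r - ‖y - x‖) ^ 2 := by gcongr
    have h7 : s ^ 2 * (lam * Real.exp (u y)) ≤ s ^ 2 * (4 * μ) := by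
      have : s ^ 2 * (lam * Real.exp (u y)) ≤ F y := by
        simp only [hF]; gcongr
      linarith
    exact le_of_mul_le_mul_left h7 (by positivity)
  have hsm := submean hu hsu (x := y0) (s := t) (A := B * (4 * μ)) ht0 (by positivity) (by
    intro y hy
    obtain ⟨h3, h4⟩ := hsub y hy
    have := h y h3
    have : B * (lam * Real.exp (u y)) ≤ B * (4 * μ) := by gcongr
    linarith)
  set a := u y0 - 4 * B with ha
  have hint1 : ∀ c (ρ : ℝ), IntegrableOn (fun y => lam * Real.exp (u y)) (ball c ρ) := fun c ρ =>
    ((by fun_prop : Continuous (fun y => lam * Real.exp (u y))).continuousOn.integrableOn_compact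
      (isCompact_closedBall c ρ)).mono_set ball_subset_closedBall
  have hintu : IntegrableOn u (ball y0 t) := 
    (hc.continuousOn.integrableOn_compact (isCompact_closedBall y0 t)).mono_set
      ball_subset_closedBall
  have hlow : π * Real.exp (-(4 * B)) ≤ ∫ y in ball y0 t, lam * Real.exp (u y) := by
    have hconst : IntegrableOn (fun _ : ℂ => (1 - a)) (ball y0 t) :=
      integrableOn_const measure_ball_lt_top.ne
    have h2 : ∫ y in ball y0 t, lam * Real.exp a * (u y + (1 - a)) ≤
        ∫ y in ball y0 t, lam * Real.exp (u y) := by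
      refine setIntegral_mono ((hintu.add hconst).const_mul _) (hint1 _ _) ?_
      intro y
      have : u y + (1 - a) ≤ Real.exp (u y - a) := by
        have := Real.add_one_le_exp (u y - a); linarith
      calc lam * Real.exp a * (u y + (1 - a)) ≤ lam * Real.exp a * Real.exp (u y - a) := by gcongr
        _ = lam * Real.exp (u y) := by rw [mul_assoc, ← Real.exp_add]; congr 2; ring
    rw [integral_const_mul, integral_add hintu hconst, setIntegral_const, vol_real ht0.le] at h2
    have h3 : π * t ^ 2 ≤ (∫ z in ball y0 t, u z) + (π * t ^ 2) • (1 - a) := by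
      rw [smul_eq_mul]
      have : B * (4 * μ) * t ^ 2 = 4 * B := by nlinarith
      rw [this] at hsm
      rw [ha]; nlinarith
    have h4 : lam * Real.exp a = μ * Real.exp (-(4 * B)) := by
      rw [ha, sub_eq_add_neg, Real.exp_add, hμ]; ring
    calc π * Real.exp (-(4 * B)) = (lam * Real.exp a) * (π * t ^ 2) := by
            rw [h4]; linear_combination (-(π * Real.exp (-(4 * B)))) * ht2
      _ ≤ _ := by gcongr
      _ ≤ _ := h2
  have : ∫ y in ball y0 t, lam * Real.exp (u y) ≤ ∫ y in ball x r, lam * Real.exp (u y) :=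
    setIntegral_mono_set (hint1 _ _) (Eventually.of_forall fun y => by positivity)
      (LE.le.eventuallyLE fun y hy => (hsub y hy).1)
  linarith

def qq (t : ℝ) : ℝ := (max t 0) ^ 2
def bb (t : ℝ) : ℝ := qq t / (1 + qq t)
def beta (t : ℝ) : ℝ := ∫ τ in (0:ℝ)..t, bb τ

lemma qq_nonneg (t : ℝ) : 0 ≤ qq t := by unfold qq; positivity

lemma qq_deriv (t : ℝ) : HasDerivAt qq (2 * max t 0) t := by
  rcases lt_trichotomy t 0 with h | h | h
  · have h1 : qq =ᶠ[𝓝 t] fun _ => 0 := by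
      filter_upwards [gt_mem_nhds h] with y hy
      simp [qq, max_eq_right (le_of_lt hy)]
    rw [max_eq_right h.le, mul_zero]
    exact (hasDerivAt_const t (0:ℝ)).congr_of_eventuallyEq h1
  · subst h
    have : HasFDerivAt qq (0 : ℝ →L[ℝ] ℝ) 0 := by
      apply Asymptotics.IsBigO.hasFDerivAt (n := 2) _ (by norm_num)
      apply Asymptotics.IsBigO.of_bound 1
      refine Eventually.of_forall fun y => ?_
      simp only [qq, sub_zero, norm_pow, one_mul]
      gcongr
      simp only [Real.norm_eq_abs, abs_abs]
      rw [abs_of_nonneg (le_max_right _ _)]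
      exact max_le (le_abs_self _) (abs_nonneg _)
    have h2 := this.hasDerivAt
    simpa using h2
  · have h1 : qq =ᶠ[𝓝 t] fun y => y ^ 2 := by
      filter_upwards [lt_mem_nhds h] with y hy
      simp [qq, max_eq_left (le_of_lt hy)]
    rw [max_eq_left h.le]
    have := (hasDerivAt_pow 2 t).congr_of_eventuallyEq h1
    simpa using this

lemma qq_cont : Continuous qq := by unfold qq; fun_prop

lemma bb_deriv (t : ℝ) : HasDerivAt bb (2 * max t 0 / (1 + qq t) ^ 2) t := by
  have h := qq_deriv t
  have h0 : 1 + qq t ≠ 0 := by have := qq_nonneg t; positivity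
  refine (h.div (h.const_add 1) h0).congr_deriv ?_
  congr 1; ring

lemma bb_cont : Continuous bb := continuous_iff_continuousAt.2 fun t => (bb_deriv t).continuousAt

lemma bb_nonneg (t : ℝ) : 0 ≤ bb t := by
  have := qq_nonneg t; unfold bb; positivity
lemma bb_le (t : ℝ) : bb t ≤ 1 := by
  have := qq_nonneg t
  unfold bb; rw [div_le_one (by positivity)]; linarith

lemma beta_deriv (t : ℝ) : HasDerivAt beta (bb t) t :=
  intervalIntegral.integral_hasDerivAt_right (bb_cont.intervalIntegrable _ _)
    (bb_cont.stronglyMeasurableAtFilter _ _) bb_cont.continuousAt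

lemma beta_contDiff : ContDiff ℝ 2 beta := by
  have hb : ContDiff ℝ 1 bb := by
    rw [contDiff_one_iff_deriv]
    refine ⟨fun t => (bb_deriv t).differentiableAt, ?_⟩
    have : deriv bb = fun t => 2 * max t 0 / (1 + qq t) ^ 2 := funext fun t => (bb_deriv t).deriv
    rw [this]
    have h1 := qq_cont
    exact Continuous.div (by fun_prop) (by fun_prop) (fun t => by
      have := qq_nonneg t; positivity)
  have h2 : (2 : WithTop ℕ∞) = 1 + 1 := by norm_num
  rw [h2, contDiff_succ_iff_deriv]
  refine ⟨fun t => (beta_deriv t).differentiableAt, by simp, ?_⟩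
  have : deriv beta = bb := funext fun t => (beta_deriv t).deriv
  rw [this]; exact hb

lemma beta_zero {t : ℝ} (ht : t ≤ 0) : beta t = 0 := by
  unfold beta
  rw [intervalIntegral.integral_congr (g := fun _ => (0:ℝ))]
  · simp
  · intro τ hτ
    rw [Set.uIcc_of_ge ht] at hτ
    simp [bb, qq, max_eq_right hτ.2]

lemma beta_nonneg (t : ℝ) : 0 ≤ beta t := by
  rcases le_total t 0 with h | h
  · rw [beta_zero h]
  · exact intervalIntegral.integral_nonneg h fun τ _ => bb_nonneg τ

lemma beta_le (t : ℝ) : beta t ≤ max t 0 := by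
  rcases le_total t 0 with h | h
  · rw [beta_zero h]; exact le_max_right _ _
  · rw [max_eq_left h]
    have := intervalIntegral.integral_mono_on h (bb_cont.intervalIntegrable 0 t)
      (continuous_const.intervalIntegrable (μ := volume) 0 t) fun τ _ => bb_le τ
    simpa [beta] using this

lemma beta_ge (t : ℝ) : t - π / 2 ≤ beta t := by
  rcases le_total t 0 with h | h
  · rw [beta_zero h]; have := Real.pi_pos; linarith
  · have h1 : beta t = ∫ τ in (0:ℝ)..t, (1 - (1 + τ ^ 2)⁻¹) := by
      unfold beta
      apply intervalIntegral.integral_congr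
      intro τ hτ
      rw [Set.uIcc_of_le h] at hτ
      simp only [bb, qq, max_eq_left hτ.1]
      field_simp; ring
    have hcc : Continuous (fun τ : ℝ => (1 + τ ^ 2)⁻¹) :=
      Continuous.inv₀ (by fun_prop) (fun τ => by positivity)
    rw [h1, intervalIntegral.integral_sub (continuous_const.intervalIntegrable _ _)
      (hcc.intervalIntegrable _ _), integral_inv_one_add_sq]
    simp only [intervalIntegral.integral_const, sub_zero, smul_eq_mul, mul_one, Real.arctan_zero]
    have := Real.arctan_lt_pi_div_two t
    linarith


structure Prob (Ω : Set ℂ) (V v : ℂ → ℝ) (lam : ℝ) : Prop where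
  hopen : IsOpen Ω
  hbd : IsBounded Ω
  hVc : ContinuousOn V (closure Ω)
  hVpos : ∀ x ∈ closure Ω, 0 < V x
  hl : 0 < lam
  hv2 : ContDiffOn ℝ 2 v Ω
  hvc : ContinuousOn v (closure Ω)
  hPDE : ∀ x ∈ Ω, -lapC v x = lam * V x * Real.exp (v x)
  hBC : ∀ x ∈ frontier Ω, v x = 0

open Classical in
def src (Ω : Set ℂ) (V v : ℂ → ℝ) (lam : ℝ) : ℂ → ℝ :=
  Ω.indicator fun x => lam * V x * Real.exp (v x)

section
variable {Ω : Set ℂ} {V v : ℂ → ℝ} {lam : ℝ}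

lemma src_in {x : ℂ} (hx : x ∈ Ω) : src Ω V v lam x = lam * V x * Real.exp (v x) := by
  simp [src, hx]
lemma src_out {x : ℂ} (hx : x ∉ Ω) : src Ω V v lam x = 0 := by simp [src, hx]

lemma Prob.nonneg (P : Prob Ω V v lam) (x : ℂ) : 0 ≤ src Ω V v lam x := by
  by_cases hx : x ∈ Ω
  · rw [src_in hx]
    have := P.hVpos x (subset_closure hx)
    have := P.hl
    positivity
  · rw [src_out hx]

lemma Prob.cont (P : Prob Ω V v lam) :
    ContinuousOn (fun x => lam * V x * Real.exp (v x)) (closure Ω) :=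
  (continuousOn_const.mul P.hVc).mul (Real.continuous_exp.comp_continuousOn P.hvc)

lemma Prob.bdd (P : Prob Ω V v lam) : ∃ A, ∀ y, |src Ω V v lam y| ≤ A := by
  obtain ⟨A, hA⟩ := (P.hbd.isCompact_closure).exists_bound_of_continuousOn P.cont
  refine ⟨max A 0, fun y => ?_⟩
  by_cases hy : y ∈ Ω
  · rw [src_in hy]; exact (hA y (subset_closure hy)).trans (le_max_left _ _)
  · rw [src_out hy]; simp

lemma Prob.integrable (P : Prob Ω V v lam) : Integrable (src Ω V v lam) := by
  unfold src
  rw [integrable_indicator_iff P.hopen.measurableSet]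
  exact (P.cont.integrableOn_compact P.hbd.isCompact_closure).mono_set subset_closure

lemma Prob.supp (P : Prob Ω V v lam) : ∃ D, ∀ y, src Ω V v lam y ≠ 0 → ‖y‖ ≤ D := by
  obtain ⟨D, hD⟩ := P.hbd.exists_norm_le
  refine ⟨D, fun y hy => ?_⟩
  by_contra h
  exact hy (src_out fun h' => h (hD y h'))

lemma Prob.mv (P : Prob Ω V v lam) : MV (fun x => v x - Pot (src Ω V v lam) x) Ω := by
  obtain ⟨A, hA⟩ := P.bdd
  obtain ⟨D, hD⟩ := P.supp
  exact mv_of_pde P.hopen P.hv2 P.integrable hA hD fun x hx => by rw [P.hPDE x hx, src_in hx]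

def trunc (Ω : Set ℂ) (v : ℂ → ℝ) : ℂ → ℝ := Ω.indicator fun x => beta (v x - 1)

lemma Prob.trunc_near (P : Prob Ω V v lam) {x : ℂ} (hx : x ∉ Ω) :
    trunc Ω v =ᶠ[𝓝 x] fun _ => 0 := by
  by_cases hc : x ∈ closure Ω
  · have hf : x ∈ frontier Ω := by rw [P.hopen.frontier_eq]; exact ⟨hc, hx⟩
    have h0 := P.hBC x hf
    have h1 : ∀ᶠ y in 𝓝[closure Ω] x, v y < 1 := by
      have := P.hvc x hc
      refine this.eventually (gt_mem_nhds ?_)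
      rw [h0]; norm_num
    rw [eventually_nhdsWithin_iff] at h1
    filter_upwards [h1] with y hy
    by_cases hyΩ : y ∈ Ω
    · simp only [trunc, Set.indicator_of_mem hyΩ]
      exact beta_zero (by linarith [hy (subset_closure hyΩ)])
    · simp [trunc, hyΩ]
  · filter_upwards [isClosed_closure.isOpen_compl.mem_nhds hc] with y hy
    have : y ∉ Ω := fun h => hy (subset_closure h)
    simp [trunc, this]

lemma Prob.trunc_near_in (P : Prob Ω V v lam) {x : ℂ} (hx : x ∈ Ω) :
    trunc Ω v =ᶠ[𝓝 x] fun y => beta (v y - 1) := by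
  filter_upwards [P.hopen.mem_nhds hx] with y hy
  simp [trunc, hy]

lemma Prob.trunc_c2 (P : Prob Ω V v lam) : ContDiff ℝ 2 (trunc Ω v) := by
  rw [contDiff_iff_contDiffAt]
  intro x
  by_cases hx : x ∈ Ω
  · have h1 : ContDiffAt ℝ 2 v x := P.hv2.contDiffAt (P.hopen.mem_nhds hx)
    have h2 : ContDiffAt ℝ 2 (fun y => beta (v y - 1)) x :=
      beta_contDiff.comp_contDiffAt x (h1.sub (contDiffAt_const (c := (1:ℝ))))
    exact h2.congr_of_eventuallyEq (P.trunc_near_in hx)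
  · exact contDiffAt_const.congr_of_eventuallyEq (P.trunc_near hx)

lemma Prob.trunc_supp (P : Prob Ω V v lam) : HasCompactSupport (trunc Ω v) := by
  refine HasCompactSupport.intro P.hbd.isCompact_closure fun x hx => ?_
  have : x ∉ Ω := fun h => hx (subset_closure h)
  simp [trunc, this]

lemma lapC_comp_beta {x : ℂ} (hv : ContDiffAt ℝ 2 v x) :
    bb (v x - 1) * lapC v x ≤ lapC (fun y => beta (v y - 1)) x := by
  have hev : ∀ᶠ y in 𝓝 x, DifferentiableAt ℝ v y := by
    filter_upwards [(hv.of_le (by norm_num : (1 : WithTop ℕ∞) ≤ 2)).eventually (by simp)] with y hy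
    exact hy.differentiableAt (by norm_num)
  have hd1 : ∀ e : ℂ, (fun y => fderiv ℝ (fun z => beta (v z - 1)) y e) =ᶠ[𝓝 x]
      fun y => bb (v y - 1) * fderiv ℝ v y e := by
    intro e
    filter_upwards [hev] with y hy
    have := (beta_deriv (v y - 1)).comp_hasFDerivAt y (hy.hasFDerivAt.sub_const 1)
    have h2 : fderiv ℝ (fun z => beta (v z - 1)) y = bb (v y - 1) • fderiv ℝ v y := this.fderiv
    rw [h2]; simp
  have hdx := hev.self_of_nhds
  have hd2 : ∀ e : ℂ, bb (v x - 1) * fderiv ℝ (fun y => fderiv ℝ v y e) x e ≤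
      fderiv ℝ (fun y => fderiv ℝ (fun z => beta (v z - 1)) y e) x e := by
    intro e
    rw [(hd1 e).fderiv_eq]
    have hD : DifferentiableAt ℝ (fun y => fderiv ℝ v y e) x := by
      have : ContDiffAt ℝ 1 (fderiv ℝ v) x := hv.fderiv_right (by norm_num)
      exact (this.differentiableAt (by norm_num)).clm_apply (differentiableAt_const e)
    have h1 := (bb_deriv (v x - 1)).comp_hasFDerivAt x (hdx.hasFDerivAt.sub_const 1)
    have h2 : HasFDerivAt (fun y => bb (v y - 1) * fderiv ℝ v y e) _ x := h1.mul hD.hasFDerivAt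
    rw [h2.fderiv]
    simp only [add_apply, smul_apply, smul_eq_mul, Function.comp]
    have : 0 ≤ 2 * max (v x - 1) 0 / (1 + qq (v x - 1)) ^ 2 := by
      have := le_max_right (v x - 1) 0; positivity
    nlinarith [mul_nonneg this (mul_self_nonneg (fderiv ℝ v x e))]
  unfold lapC
  have := hd2 1
  have := hd2 Complex.I
  linarith

end

lemma eps_reg_v {a b : ℝ} (ha : 0 < a) (hb : 0 < b) : ∃ ε C : ℝ, 0 < ε ∧ 0 < C ∧
    ∀ (Ω : Set ℂ) (V v : ℂ → ℝ) (lam : ℝ), Prob Ω V v lam → (∀ x ∈ Ω, a ≤ V x) →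
    (∀ x ∈ Ω, V x ≤ b) → lam ≤ ε → ∀ x ∈ Ω, ∀ r : ℝ, 0 < r → r ≤ 1 →
    ∫ y in ball x r, src Ω V v lam y ≤ ε → src Ω V v lam x * r ^ 2 ≤ C := by
  set B := b * Real.exp (1 + π / 2) with hB
  have hB0 : 0 < B := by positivity
  refine ⟨π * Real.exp (-(4 * B)) / (2 * (π + 1 / a)), 4 * B, by positivity, by positivity, ?_⟩
  intro Ω V v lam P haV hbV hlam x hx r hr hr1 hm
  set ε := π * Real.exp (-(4 * B)) / (2 * (π + 1 / a)) with hε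
  have hl := P.hl
  have hvu : ∀ y ∈ Ω, v y ≤ trunc Ω v y + (1 + π / 2) := by
    intro y hy
    simp only [trunc, Set.indicator_of_mem hy]
    have := beta_ge (v y - 1); linarith
  have hfu : ∀ y ∈ Ω, src Ω V v lam y ≤ B * (lam * Real.exp (trunc Ω v y)) := by
    intro y hy
    rw [src_in hy]
    calc lam * V y * Real.exp (v y) ≤ lam * b * Real.exp (trunc Ω v y + (1 + π / 2)) := by
          gcongr
          · exact hbV y hy
          · exact hvu y hy
      _ = _ := by rw [Real.exp_add, hB]; ring
  have hlap : ∀ y, -(B * (lam * Real.exp (trunc Ω v y))) ≤ lapC (trunc Ω v) y := by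
    intro y
    by_cases hy : y ∈ Ω
    · rw [lapC_congr (P.trunc_near_in hy)]
      have h1 := lapC_comp_beta (P.hv2.contDiffAt (P.hopen.mem_nhds hy))
      have h2 := P.hPDE y hy
      have h3 := hfu y hy
      have h4 := P.nonneg y
      rw [src_in hy] at h3 h4
      have h5 := bb_nonneg (v y - 1)
      have h6 := bb_le (v y - 1)
      nlinarith
    · rw [lapC_congr (P.trunc_near hy)]
      have : lapC (fun _ => (0:ℝ)) y = 0 := by simp [lapC]
      rw [this]
      have := Real.exp_pos (trunc Ω v y)
      have : 0 < B * (lam * Real.exp (trunc Ω v y)) := by positivity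
      linarith
  have hpt : ∀ y, lam * Real.exp (trunc Ω v y) ≤ lam + 1 / a * src Ω V v lam y := by
    intro y
    by_cases hy : y ∈ Ω
    · have h1 : Real.exp (trunc Ω v y) ≤ 1 + Real.exp (v y) := by
        have h2 : trunc Ω v y ≤ max (v y - 1) 0 := by
          simp only [trunc, Set.indicator_of_mem hy]; exact beta_le _
        rcases le_total (v y - 1) 0 with h | h
        · rw [max_eq_right h] at h2
          have := Real.exp_le_one_iff.2 h2
          have := Real.exp_pos (v y)
          linarith
        · rw [max_eq_left h] at h2
          have : Real.exp (trunc Ω v y) ≤ Real.exp (v y) := Real.exp_le_exp.2 (by linarith)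
          linarith
      rw [src_in hy]
      have h3 : Real.exp (v y) ≤ 1 / a * (V y * Real.exp (v y)) := by
        rw [one_div, inv_mul_eq_div, le_div_iff₀ ha]
        have := haV y hy
        have := Real.exp_pos (v y)
        nlinarith
      calc _ ≤ lam * (1 + 1 / a * (V y * Real.exp (v y))) := by gcongr; linarith
        _ = _ := by ring
    · rw [src_out hy]; simp [trunc, hy]
  have hmass : ∫ y in ball x r, lam * Real.exp (trunc Ω v y) < π * Real.exp (-(4 * B)) := by
    have hcst : IntegrableOn (fun _ : ℂ => lam) (ball x r) :=
      integrableOn_const measure_ball_lt_top.ne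
    have hi := (P.integrable.const_mul (1 / a)).integrableOn (s := ball x r)
    have hc : Continuous (fun y => lam * Real.exp (trunc Ω v y)) := by
      have := P.trunc_c2.continuous; fun_prop
    have h1 : ∫ y in ball x r, lam * Real.exp (trunc Ω v y) ≤
        ∫ y in ball x r, (lam + 1 / a * src Ω V v lam y) :=
      setIntegral_mono ((hc.continuousOn.integrableOn_compact (isCompact_closedBall x r)).mono_set
        ball_subset_closedBall) (hcst.add hi) hpt
    rw [integral_add hcst hi, integral_const_mul (1 / a), setIntegral_const, vol_real hr.le,
      smul_eq_mul] at h1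
    have h2 : π * r ^ 2 * lam ≤ π * ε := by
      have : r ^ 2 ≤ 1 := by nlinarith
      calc π * r ^ 2 * lam ≤ π * 1 * ε := by gcongr
        _ = _ := by ring
    have h3 : 1 / a * ∫ y in ball x r, src Ω V v lam y ≤ 1 / a * ε := by gcongr
    have h4 : (π + 1 / a) * ε = π * Real.exp (-(4 * B)) / 2 := by
      rw [hε]; field_simp
    have h5 : 0 < π * Real.exp (-(4 * B)) := by positivity
    nlinarith
  have h1 := eps_reg P.trunc_c2 P.trunc_supp hr hl hB0.le (fun y _ => hlap y) hmass
  calc src Ω V v lam x * r ^ 2 ≤ B * (lam * Real.exp (trunc Ω v x)) * r ^ 2 := by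
        gcongr; exact hfu x hx
    _ = B * (lam * Real.exp (trunc Ω v x) * r ^ 2) := by ring
    _ ≤ B * 4 := by gcongr
    _ = _ := by ring

end BU

end

section
open MeasureTheory Real Filter Topology Metric Bornology
open scoped RealInnerProductSpace

namespace BU

structure Sq (m : ℕ) where
  Ω : Set ℂ
  V : ℂ → ℝ
  lam : ℕ → ℝ
  v : ℕ → ℂ → ℝ
  xs : Fin m → ℂ
  xp : Fin m → ℕ → ℂ
  R : ℝ
  a : ℝ
  b : ℝ
  M : ℝ
  D : ℝ
  hP : ∀ k, Prob Ω V (v k) (lam k)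
  hVd : ContDiffOn ℝ 1 V Ω
  ha : 0 < a
  haV : ∀ x ∈ Ω, a ≤ V x
  hb : 0 < b
  hbV : ∀ x ∈ Ω, V x ≤ b
  hD1 : 1 ≤ D
  hD : ∀ x ∈ closure Ω, ‖x‖ ≤ D
  hlam0 : Tendsto lam atTop (𝓝 0)
  hmass : Tendsto (fun k => ∫ x, src Ω V (v k) (lam k) x) atTop (𝓝 (8 * π * m))
  hM0 : 0 ≤ M
  hM : ∀ k, ∫ x, src Ω V (v k) (lam k) x ≤ M
  hR : 0 < R
  hR1 : R ≤ 1
  hball : ∀ j, closedBall (xs j) (4 * R) ⊆ Ω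
  hsep : ∀ i j, i ≠ j → 8 * R ≤ ‖xs i - xs j‖
  hlim : ∀ j, Tendsto (xp j) atTop (𝓝 (xs j))
  hnear : ∀ j k, ‖xp j k - xs j‖ ≤ R / 8
  hmax : ∀ j k, ∀ y ∈ ball (xp j k) R, v k y ≤ v k (xp j k)
  hblow : ∀ j, Tendsto (fun k => v k (xp j k)) atTop atTop
  hv0 : ∀ j k, 0 ≤ v k (xp j k)

namespace Sq
variable {m : ℕ} (S : Sq m)

def f (k : ℕ) : ℂ → ℝ := src S.Ω S.V (S.v k) (S.lam k)
def h (k : ℕ) (x : ℂ) : ℝ := S.v k x - Pot (S.f k) x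
def del (j : Fin m) (k : ℕ) : ℝ :=
  (Real.sqrt (S.lam k * S.V (S.xp j k) * Real.exp (S.v k (S.xp j k))))⁻¹

lemma f_in {k : ℕ} {x : ℂ} (hx : x ∈ S.Ω) : S.f k x = S.lam k * S.V x * Real.exp (S.v k x) :=
  src_in hx
lemma f_out {k : ℕ} {x : ℂ} (hx : x ∉ S.Ω) : S.f k x = 0 := src_out hx
lemma f0 (k : ℕ) (x : ℂ) : 0 ≤ S.f k x := (S.hP k).nonneg x
lemma f_int (k : ℕ) : Integrable (S.f k) := (S.hP k).integrable
lemma f_bdd (k : ℕ) : ∃ A, ∀ y, |S.f k y| ≤ A := (S.hP k).bdd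
lemma f_supp (k : ℕ) (y : ℂ) (hy : S.f k y ≠ 0) : ‖y‖ ≤ S.D := by
  by_contra h
  exact hy (S.f_out fun h' => h (S.hD y (subset_closure h')))
lemma f_mass (k : ℕ) : ∫ x, S.f k x ≤ S.M := S.hM k
lemma h_mv (k : ℕ) : MV (S.h k) S.Ω := (S.hP k).mv
lemma pot_cont (k : ℕ) : Continuous (Pot (S.f k)) := by
  obtain ⟨A, hA⟩ := S.f_bdd k
  exact BU.pot_cont (S.f_int k) (S.f0 k) hA (S.f_supp k)
lemma h_cont (k : ℕ) : ContinuousOn (S.h k) (closure S.Ω) :=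
  (S.hP k).hvc.sub (S.pot_cont k).continuousOn
lemma logf_int (k : ℕ) (x : ℂ) : Integrable (fun y => Real.log ‖x - y‖ * S.f k y) := by
  obtain ⟨A, hA⟩ := S.f_bdd k
  exact log_integrable (S.f_int k) hA (S.f_supp k) x

lemma xp_ball (j : Fin m) (k : ℕ) : closedBall (S.xp j k) (3 * S.R) ⊆ S.Ω := by
  refine (closedBall_subset_closedBall' ?_).trans (S.hball j)
  rw [dist_eq_norm]
  have := S.hnear j k
  have := S.hR
  linarith
lemma xp_mem (j : Fin m) (k : ℕ) : S.xp j k ∈ S.Ω :=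
  S.xp_ball j k (mem_closedBall_self (by have := S.hR; positivity))

lemma fxp_pos (j : Fin m) (k : ℕ) : 0 < S.f k (S.xp j k) := by
  rw [S.f_in (S.xp_mem j k)]
  have := (S.hP k).hl
  have := (S.hP k).hVpos _ (subset_closure (S.xp_mem j k))
  positivity

lemma del_pos (j : Fin m) (k : ℕ) : 0 < S.del j k := by
  have := S.fxp_pos j k
  rw [S.f_in (S.xp_mem j k)] at this
  unfold del; positivity

lemma del_sq (j : Fin m) (k : ℕ) : S.del j k ^ 2 * S.f k (S.xp j k) = 1 := by
  have := S.fxp_pos j k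
  rw [S.f_in (S.xp_mem j k)] at this ⊢
  unfold del
  rw [inv_pow, Real.sq_sqrt this.le, inv_mul_cancel₀ this.ne']

lemma f_le_near (j : Fin m) (k : ℕ) (y : ℂ) (hy : y ∈ ball (S.xp j k) S.R) :
    S.f k y ≤ S.b / S.a * (S.del j k ^ 2)⁻¹ := by
  have h1 : (S.del j k ^ 2)⁻¹ = S.f k (S.xp j k) := by
    have := S.del_sq j k
    have h0 := S.del_pos j k
    field_simp; linarith
  have hR := S.hR
  have hyΩ : y ∈ S.Ω := S.xp_ball j k (ball_subset_closedBall
    (ball_subset_ball (by linarith) hy))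
  rw [h1, S.f_in hyΩ, S.f_in (S.xp_mem j k)]
  have hl := (S.hP k).hl
  have ha := S.ha
  have hb := S.hb
  calc S.lam k * S.V y * Real.exp (S.v k y)
      ≤ S.lam k * S.b * Real.exp (S.v k (S.xp j k)) := by
        gcongr
        · exact S.hbV y hyΩ
        · exact S.hmax j k y hy
    _ = S.b / S.a * (S.lam k * S.a * Real.exp (S.v k (S.xp j k))) := by field_simp
    _ ≤ _ := by
        gcongr
        exact S.haV _ (S.xp_mem j k)

lemma pot_le (k : ℕ) {x : ℂ} {s A : ℝ} (hs : 0 < s) (hs1 : s ≤ 1) (hA0 : 0 ≤ A)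
    (hA : ∀ y ∈ ball x s, S.f k y ≤ A) :
    Pot (S.f k) x ≤ 1 / (2 * π) * (Real.log s⁻¹ * S.M) + A * s ^ 2 := by
  have hpi := Real.pi_pos
  obtain ⟨hki, hkv⟩ := ker_integral_sub (a := 1) (by norm_num) hs x
  have hlog0 : 0 ≤ Real.log s⁻¹ := Real.log_nonneg (by rw [one_le_inv₀ hs]; exact hs1)
  have hpt : ∀ᵐ y, -(Real.log ‖x - y‖ * S.f k y) ≤
      Real.log s⁻¹ * S.f k y + s * A * ker 1 s (x - y) := by
    filter_upwards [ae_ne x] with y hy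
    have hf := S.f0 k y
    have hn : 0 < ‖x - y‖ := norm_pos_iff.2 (sub_ne_zero.2 hy)
    by_cases hb : ‖x - y‖ < s
    · have h1 : ker 1 s (x - y) = ‖x - y‖⁻¹ := by
        rw [ker_eq, Set.indicator_of_mem (by exact hb), Real.rpow_neg_one]
      have h2 : -Real.log ‖x - y‖ ≤ Real.log s⁻¹ + s * ‖x - y‖⁻¹ := by
        have h3 : Real.log (s * ‖x - y‖⁻¹) ≤ s * ‖x - y‖⁻¹ := Real.log_le_self (by positivity)
        rw [Real.log_mul hs.ne' (by positivity), Real.log_inv] at h3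
        rw [Real.log_inv]; linarith
      have h4 : S.f k y ≤ A := hA y (by rw [mem_ball, dist_comm, dist_eq_norm]; exact hb)
      rw [h1]
      calc -(Real.log ‖x - y‖ * S.f k y) = (-Real.log ‖x - y‖) * S.f k y := by ring
        _ ≤ (Real.log s⁻¹ + s * ‖x - y‖⁻¹) * S.f k y := by gcongr
        _ = Real.log s⁻¹ * S.f k y + s * S.f k y * ‖x - y‖⁻¹ := by ring
        _ ≤ _ := by gcongr
    · push Not at hb
      have h2 : -Real.log ‖x - y‖ ≤ Real.log s⁻¹ := by
        rw [Real.log_inv]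
        exact neg_le_neg (Real.log_le_log hs hb)
      have := ker_nonneg 1 s (x - y)
      have : 0 ≤ s * A * ker 1 s (x - y) := by positivity
      nlinarith
  have h1 := integral_mono_ae (S.logf_int k x).neg
    (((S.f_int k).const_mul (Real.log s⁻¹)).add (hki.const_mul (s * A))) hpt
  simp only [Pi.neg_apply, Pi.add_apply] at h1
  rw [integral_neg, integral_add ((S.f_int k).const_mul _) (hki.const_mul _), integral_const_mul,
    integral_const_mul, hkv] at h1
  norm_num at h1
  have h3 : Real.log s⁻¹ * ∫ y, S.f k y ≤ Real.log s⁻¹ * S.M :=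
    mul_le_mul_of_nonneg_left (S.f_mass k) hlog0
  unfold Pot
  rw [Real.log_inv] at h3
  calc -(1 / (2 * π)) * ∫ y, Real.log ‖x - y‖ * S.f k y
      = 1 / (2 * π) * -∫ y, Real.log ‖x - y‖ * S.f k y := by ring
    _ ≤ 1 / (2 * π) * (Real.log s⁻¹ * S.M + s * A * (2 * π * s)) := by
        gcongr
        rw [Real.log_inv]
        linarith
    _ = _ := by field_simp

/-- upper bound on h -/
def C1 : ℝ := 1 / (2 * π) * (2 * S.D * S.M)

lemma h_le (k : ℕ) : ∀ x ∈ closure S.Ω, S.h k x ≤ S.C1 := by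
  have hpi := Real.pi_pos
  refine max_principle (S.hP k).hopen (S.hP k).hbd (S.h_cont k) (S.h_mv k) ?_
  intro x hx
  have hxc : x ∈ closure S.Ω := frontier_subset_closure hx
  unfold h
  rw [(S.hP k).hBC x hx, zero_sub]
  unfold Pot C1
  have h1 : ∫ y, Real.log ‖x - y‖ * S.f k y ≤ ∫ y, 2 * S.D * S.f k y := by
    refine integral_mono (S.logf_int k x) ((S.f_int k).const_mul _) fun y => ?_
    by_cases hy : S.f k y = 0
    · simp [hy]
    · have h2 := S.f_supp k y hy
      have h3 := S.hD x hxc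
      have h4 : Real.log ‖x - y‖ ≤ 2 * S.D :=
        (Real.log_le_self (norm_nonneg _)).trans ((norm_sub_le _ _).trans (by linarith))
      have := S.f0 k y
      gcongr
  rw [integral_const_mul] at h1
  have h2 := S.f_mass k
  have hD := S.hD1
  calc -(-(1 / (2 * π)) * ∫ y, Real.log ‖x - y‖ * S.f k y)
      = 1 / (2 * π) * ∫ y, Real.log ‖x - y‖ * S.f k y := by ring
    _ ≤ 1 / (2 * π) * (2 * S.D * ∫ y, S.f k y) := by gcongr
    _ ≤ _ := by gcongr

lemma C1_nonneg : 0 ≤ S.C1 := by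
  unfold C1; have := S.hD1; have := S.hM0; positivity

lemma pot_xp (j : Fin m) (k : ℕ) : Pot (S.f k) (S.xp j k) ≤
    1 / (2 * π) * (Real.log (min (S.del j k) S.R)⁻¹ * S.M) + S.b / S.a := by
  have hd := S.del_pos j k
  have hR := S.hR
  have hs : 0 < min (S.del j k) S.R := lt_min hd hR
  have hab : 0 < S.b / S.a := div_pos S.hb S.ha
  refine (S.pot_le k hs ((min_le_right _ _).trans S.hR1)
    (A := S.b / S.a * (S.del j k ^ 2)⁻¹) (by positivity) ?_).trans ?_
  · intro y hy
    exact S.f_le_near j k y (ball_subset_ball (min_le_right _ _) hy)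
  · have : S.b / S.a * (S.del j k ^ 2)⁻¹ * min (S.del j k) S.R ^ 2 ≤
        S.b / S.a * (S.del j k ^ 2)⁻¹ * S.del j k ^ 2 := by
      gcongr
      exact min_le_left _ _
    have h2 : S.b / S.a * (S.del j k ^ 2)⁻¹ * S.del j k ^ 2 = S.b / S.a := by
      field_simp
    linarith

lemma del_tendsto (j : Fin m) : Tendsto (S.del j) atTop (𝓝 0) := by
  have hpi := Real.pi_pos
  have h1 : ∀ k, S.v k (S.xp j k) ≤ S.C1 + S.b / S.a +
      S.M / (2 * π) * Real.log (min (S.del j k) S.R)⁻¹ := by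
    intro k
    have h2 := S.h_le k _ (subset_closure (S.xp_mem j k))
    have h3 := S.pot_xp j k
    unfold h at h2
    have : 1 / (2 * π) * (Real.log (min (S.del j k) S.R)⁻¹ * S.M) =
      S.M / (2 * π) * Real.log (min (S.del j k) S.R)⁻¹ := by ring
    linarith
  rw [Metric.tendsto_atTop]
  intro ε hε
  have hR := S.hR
  set s := min ε S.R with hs
  have hs0 : 0 < s := lt_min hε hR
  have h2 := (S.hblow j).eventually_gt_atTop (S.C1 + S.b / S.a + S.M / (2 * π) * Real.log s⁻¹)
  obtain ⟨N, hN⟩ := eventually_atTop.1 h2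
  refine ⟨N, fun k hk => ?_⟩
  have hd := S.del_pos j k
  rw [Real.dist_eq, sub_zero, abs_of_pos hd]
  by_contra hcon
  push Not at hcon
  have h3 := hN k hk
  have h4 : s ≤ min (S.del j k) S.R := min_le_min_right _ hcon
  have h5 : Real.log (min (S.del j k) S.R)⁻¹ ≤ Real.log s⁻¹ :=
    Real.log_le_log (by positivity) (inv_anti₀ hs0 h4)
  have h6 : S.M / (2 * π) * Real.log (min (S.del j k) S.R)⁻¹ ≤ S.M / (2 * π) * Real.log s⁻¹ := by
    have := S.hM0; gcongr
  linarith [h1 k]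

/-- rescaled functions -/
def w (j : Fin m) (k : ℕ) (z : ℂ) : ℝ :=
  S.v k (S.xp j k + (S.del j k : ℂ) * z) - S.v k (S.xp j k)
def g (j : Fin m) (k : ℕ) (z : ℂ) : ℝ :=
  S.del j k ^ 2 * S.f k (S.xp j k + (S.del j k : ℂ) * z)

lemma scale_integral (F : ℂ → ℝ) (c : ℂ) {d : ℝ} (hd : 0 < d) :
    ∫ z, d ^ 2 * F (c + (d : ℂ) * z) = ∫ y, F y := by
  have h1 := Measure.integral_comp_smul (volume : Measure ℂ) (fun y => F (c + y)) d
  rw [Complex.finrank_real_complex] at h1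
  have h2 : ∫ y, F (c + y) = ∫ y, F y := integral_add_left_eq_self F c
  rw [integral_const_mul]
  have h3 : ∫ z, F (c + (d : ℂ) * z) = ∫ z, F (c + d • z) := by simp
  rw [h3, h1, h2, smul_eq_mul, abs_of_pos (by positivity), ← mul_assoc,
    mul_inv_cancel₀ (by positivity), one_mul]

lemma scale_integrable {F : ℂ → ℝ} (hF : Integrable F) (c : ℂ) {d : ℝ} (hd : 0 < d) :
    Integrable (fun z => d ^ 2 * F (c + (d : ℂ) * z)) := by
  apply Integrable.const_mul
  have h1 : Integrable (fun y => F (c + y)) := hF.comp_add_left c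
  have := (integrable_comp_smul_iff (volume : Measure ℂ) (fun y => F (c + y)) hd.ne').2 h1
  simpa using this

lemma g_int (j : Fin m) (k : ℕ) : Integrable (S.g j k) :=
  scale_integrable (S.f_int k) _ (S.del_pos j k)

lemma g_nonneg (j : Fin m) (k : ℕ) (z : ℂ) : 0 ≤ S.g j k z :=
  mul_nonneg (sq_nonneg _) (S.f0 _ _)

lemma ev_small (j : Fin m) (ρ c : ℝ) (hc : 0 < c) : ∀ᶠ k in atTop, ∀ z : ℂ, ‖z‖ ≤ ρ →
    ‖(S.del j k : ℂ) * z‖ < c := by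
  have h1 : Tendsto (fun k => S.del j k * |ρ|) atTop (𝓝 0) := by
    simpa using (S.del_tendsto j).mul_const |ρ|
  filter_upwards [h1.eventually (gt_mem_nhds hc)] with k hk z hz
  have hd := S.del_pos j k
  rw [norm_mul, Complex.norm_real, Real.norm_eq_abs, abs_of_pos hd]
  exact lt_of_le_of_lt (by gcongr; exact hz.trans (le_abs_self ρ)) hk

/-- Potential difference in rescaled variables. -/
lemma pot_scale (j : Fin m) (k : ℕ) (z : ℂ) :
    Pot (S.f k) (S.xp j k + (S.del j k : ℂ) * z) - Pot (S.f k) (S.xp j k) =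
      -(1 / (2 * π) * ∫ y, (Real.log ‖z - y‖ - Real.log ‖y‖) * S.g j k y) := by
  have hd := S.del_pos j k
  set c := S.xp j k
  set d := S.del j k with hdd
  have hne : (d : ℂ) ≠ 0 := by exact_mod_cast hd.ne'
  have h1 := scale_integral (fun y => (Real.log ‖c + (d:ℂ) * z - y‖ - Real.log ‖c - y‖) * S.f k y)
    c hd
  have h2 : ∫ y, (Real.log ‖z - y‖ - Real.log ‖y‖) * S.g j k y =
      ∫ y, (Real.log ‖c + (d:ℂ) * z - y‖ - Real.log ‖c - y‖) * S.f k y := by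
    rw [← h1]
    refine integral_congr_ae ?_
    filter_upwards [ae_ne z, ae_ne (0:ℂ)] with y hy hy0
    have e1 : c + (d:ℂ) * z - (c + d * y) = d * (z - y) := by ring
    have e2 : c - (c + (d:ℂ) * y) = -(d * y) := by ring
    rw [e1, e2, norm_neg, norm_mul, norm_mul, Real.log_mul, Real.log_mul]
    · simp only [g]; ring
    · simpa using hd.ne'
    · simpa using hy0.symm
    · simpa using hd.ne'
    · simpa [sub_eq_zero] using hy
  rw [h2]
  simp_rw [sub_mul]
  rw [integral_sub (S.logf_int k _) (S.logf_int k _)]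
  unfold Pot
  ring

lemma xlog_tendsto (c1 c2 : ℝ) (j : Fin m) :
    Tendsto (fun k => S.del j k * (c1 + c2 * Real.log (S.del j k)⁻¹)) atTop (𝓝 0) := by
  have h0 := S.del_tendsto j
  have h1 : Tendsto (fun k => Real.log (S.del j k) * S.del j k) atTop (𝓝 0) := by
    have := tendsto_log_mul_rpow_nhdsGT_zero zero_lt_one
    simp only [Real.rpow_one] at this
    refine this.comp ?_
    rw [tendsto_nhdsWithin_iff]
    exact ⟨h0, Eventually.of_forall fun k => S.del_pos j k⟩
  have := (h0.const_mul c1).sub (h1.const_mul c2)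
  simp only [mul_zero, sub_zero] at this
  refine this.congr fun k => ?_
  rw [Real.log_inv]; ring

theorem bl (j : Fin m) : BL (S.w j) (S.g j) S.M where
  hg := S.g_int j
  g0 := S.g_nonneg j
  hM k := by
    have := scale_integral (S.f k) (S.xp j k) (S.del_pos j k)
    exact this.le.trans (S.f_mass k)
  hw0 k := by simp [w]
  hwneg ρ := by
    filter_upwards [S.ev_small j ρ S.R S.hR] with k hk z hz
    have := S.hmax j k (S.xp j k + (S.del j k : ℂ) * z) (by
      rw [mem_ball, dist_eq_norm]; simpa using hk z hz)
    unfold w; linarith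
  hθ ρ ε hε := by
    have hxs : S.xs j ∈ S.Ω := S.hball j (mem_closedBall_self (by have := S.hR; positivity))
    have hVc : ContinuousAt S.V (S.xs j) := 
      ((S.hP 0).hVc.mono subset_closure).continuousAt ((S.hP 0).hopen.mem_nhds hxs)
    have hε' : 0 < ε * S.a / 2 := by have := S.ha; positivity
    obtain ⟨η, hη, hη2⟩ := Metric.continuousAt_iff.1 hVc _ hε'
    filter_upwards [S.ev_small j ρ (η / 2) (by positivity), S.ev_small j ρ S.R S.hR,
      (Metric.tendsto_nhds.1 (S.hlim j)) (η / 2) (by positivity)] with k h1 h2 h3 z hz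
    set y := S.xp j k + (S.del j k : ℂ) * z with hy
    have hyΩ : y ∈ S.Ω := S.xp_ball j k (by
      have h4 := h2 z hz
      have := S.hR
      rw [mem_closedBall, dist_eq_norm, hy, add_sub_cancel_left]; linarith)
    have e1 : S.g j k z = S.V y / S.V (S.xp j k) * Real.exp (S.w j k z) := by
      have hfx := S.del_sq j k
      have hVx := (S.hP k).hVpos _ (subset_closure (S.xp_mem j k))
      unfold g w
      rw [← hy, S.f_in hyΩ, Real.exp_sub]
      rw [S.f_in (S.xp_mem j k)] at hfx
      have := (S.hP k).hl
      have hE := Real.exp_pos (S.v k (S.xp j k))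
      field_simp
      linear_combination S.V y * hfx
    have hVx := S.haV _ (S.xp_mem j k)
    have ha := S.ha
    have d1 : |S.V y - S.V (S.xs j)| < ε * S.a / 2 := by
      have := hη2 (x := y) (by
        rw [hy, dist_eq_norm]
        rw [dist_eq_norm] at h3
        have h4 := h1 z hz
        have h5 : S.xp j k + (S.del j k : ℂ) * z - S.xs j = (S.xp j k - S.xs j) + S.del j k * z := by
          ring
        rw [h5]
        exact (norm_add_le _ _).trans_lt (by linarith))
      rwa [Real.dist_eq] at this
    have d2 : |S.V (S.xp j k) - S.V (S.xs j)| < ε * S.a / 2 := by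
      have := hη2 (x := S.xp j k) (by linarith)
      rwa [Real.dist_eq] at this
    have d3 : |S.V y - S.V (S.xp j k)| ≤ ε * S.V (S.xp j k) := by
      have : |S.V y - S.V (S.xp j k)| ≤ ε * S.a := by
        rw [abs_lt] at d1 d2; rw [abs_le]; constructor <;> linarith
      exact this.trans (by gcongr)
    rw [e1]
    have e2 : S.V y / S.V (S.xp j k) * Real.exp (S.w j k z) - Real.exp (S.w j k z) =
      (S.V y - S.V (S.xp j k)) / S.V (S.xp j k) * Real.exp (S.w j k z) := by
      have : S.V (S.xp j k) ≠ 0 := by linarith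
      field_simp
    rw [e2, abs_mul, abs_of_pos (Real.exp_pos _), abs_div, abs_of_pos (ha.trans_le hVx)]
    gcongr
    rwa [div_le_iff₀ (ha.trans_le hVx)]
  hη ρ ε hε := by
    have hR := S.hR
    have hpi := Real.pi_pos
    set c1 := 4 * |ρ| / S.R * (S.C1 + S.b / S.a) with hc1
    set c2 := 4 * |ρ| / S.R * (S.M / (2 * π)) with hc2
    have ht := S.xlog_tendsto c1 c2 j
    filter_upwards [ht.eventually (gt_mem_nhds hε), S.ev_small j ρ (S.R / 4) (by positivity),
      (S.del_tendsto j).eventually (gt_mem_nhds hR)] with k h1 h2 h3 z hz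
    have hd := S.del_pos j k
    have hp := S.pot_scale j k z
    have e1 : S.w j k z + 1 / (2 * π) * ∫ y, (Real.log ‖z - y‖ - Real.log ‖y‖) * S.g j k y =
        S.h k (S.xp j k + (S.del j k : ℂ) * z) - S.h k (S.xp j k) := by
      unfold w h; linarith
    rw [e1]
    have hsub : closedBall (S.xp j k) S.R ⊆ S.Ω :=
      (closedBall_subset_closedBall (by linarith)).trans (S.xp_ball j k)
    have hmv : MV (fun y => S.C1 - S.h k y) S.Ω := (MV.const S.C1 S.Ω).sub (S.h_mv k)
    have hz2 := (h2 z hz).le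
    have hh := harnack hmv hR hsub
      (fun y hy => by have := S.h_le k y (subset_closure (hsub hy)); linarith)
      (x := S.xp j k + (S.del j k : ℂ) * z) (by simpa using hz2)
    rw [add_sub_cancel_left] at hh
    have e2 : |S.h k (S.xp j k + (S.del j k : ℂ) * z) - S.h k (S.xp j k)| =
      |S.C1 - S.h k (S.xp j k + (S.del j k : ℂ) * z) - (S.C1 - S.h k (S.xp j k))| := by
      rw [← abs_neg]; congr 1; ring
    rw [e2]
    refine hh.trans (le_of_lt (lt_of_le_of_lt ?_ h1))
    have hn : ‖(S.del j k : ℂ) * z‖ ≤ S.del j k * |ρ| := by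
      rw [norm_mul, Complex.norm_real, Real.norm_eq_abs, abs_of_pos hd]
      gcongr; exact hz.trans (le_abs_self ρ)
    have hH : S.C1 - S.h k (S.xp j k) ≤
        S.C1 + S.b / S.a + S.M / (2 * π) * Real.log (S.del j k)⁻¹ := by
      have h5 := S.pot_xp j k
      rw [min_eq_left h3.le] at h5
      have h6 := S.hv0 j k
      have e3 : 1 / (2 * π) * (Real.log (S.del j k)⁻¹ * S.M) =
        S.M / (2 * π) * Real.log (S.del j k)⁻¹ := by ring
      unfold h; linarith
    have hH0 : 0 ≤ S.C1 - S.h k (S.xp j k) := by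
      have := S.h_le k _ (subset_closure (S.xp_mem j k)); linarith
    calc 4 * (‖(S.del j k : ℂ) * z‖ / S.R) * (S.C1 - S.h k (S.xp j k))
        ≤ 4 * (S.del j k * |ρ| / S.R) *
          (S.C1 + S.b / S.a + S.M / (2 * π) * Real.log (S.del j k)⁻¹) := by gcongr
      _ = _ := by rw [hc1, hc2]; ring

end Sq
end BU

end

section
open MeasureTheory Real Filter Topology Metric Bornology
open scoped RealInnerProductSpace

namespace BU
namespace Sq
variable {m : ℕ} (S : Sq m)

lemma scale_set (F : ℂ → ℝ) (c : ℂ) {d : ℝ} (hd : 0 < d) (ρ : ℝ) :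
    ∫ y in ball c (d * ρ), F y = ∫ z in ball 0 ρ, d ^ 2 * F (c + (d : ℂ) * z) := by
  rw [← integral_indicator measurableSet_ball, ← integral_indicator measurableSet_ball,
    ← scale_integral _ c hd]
  congr 1; ext z
  have : c + (d : ℂ) * z ∈ ball c (d * ρ) ↔ z ∈ ball (0:ℂ) ρ := by
    rw [mem_ball, mem_ball, dist_eq_norm, add_sub_cancel_left, dist_zero_right, norm_mul,
      Complex.norm_real, Real.norm_eq_abs, abs_of_pos hd]
    exact mul_lt_mul_iff_right₀ hd
  by_cases hz : z ∈ ball (0:ℂ) ρ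
  · rw [Set.indicator_of_mem hz, Set.indicator_of_mem (this.2 hz)]
  · rw [Set.indicator_of_notMem hz, Set.indicator_of_notMem (fun h => hz (this.1 h)), mul_zero]

lemma mass_ball (j : Fin m) (ρ : ℝ) :
    Tendsto (fun k => ∫ y in ball (S.xp j k) (S.del j k * ρ), S.f k y) atTop
      (𝓝 (∫ z in ball 0 ρ, Real.exp (U0 z))) := by
  have h := (S.bl j).tendsto_int ρ (ψ := fun _ => 1) (integrableOn_const measure_ball_lt_top.ne)
  simp only [one_mul] at h
  refine h.congr fun k => ?_
  rw [scale_set _ _ (S.del_pos j k)]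
  rfl

lemma expU_ball {ε : ℝ} (hε : 0 < ε) :
    ∃ L : ℝ, 0 < L ∧ |(∫ z in ball 0 L, Real.exp (U0 z)) - 8 * π| < ε := by
  have h1 := tendsto_setIntegral_of_monotone (μ := volume) (f := fun z : ℂ => Real.exp (U0 z))
    (s := fun n : ℕ => ball (0:ℂ) n) (fun n => measurableSet_ball)
    (fun a b hab => ball_subset_ball (by exact_mod_cast hab))
    exp_U0_int.1.integrableOn
  rw [iUnion_ball_nat, setIntegral_univ, exp_U0_int.2] at h1
  obtain ⟨n, hn, hn1⟩ := (((Metric.tendsto_nhds.1 h1) ε hε).and (eventually_ge_atTop 1)).exists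
  exact ⟨n, by exact_mod_cast hn1, by rwa [Real.dist_eq] at hn⟩

/-- union of the bubbles -/
def bub (L : ℝ) (k : ℕ) : Set ℂ := ⋃ j, ball (S.xp j k) (S.del j k * L)

lemma bub_meas (L : ℝ) (k : ℕ) : MeasurableSet (S.bub L k) :=
  (isOpen_iUnion fun _ => isOpen_ball).measurableSet

lemma delL_ev (L c : ℝ) (hc : 0 < c) : ∀ᶠ k in atTop, ∀ j, S.del j k * L < c := by
  rw [eventually_all]
  intro j
  have h1 : Tendsto (fun k => S.del j k * L) atTop (𝓝 0) := by
    simpa using (S.del_tendsto j).mul_const L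
  exact h1.eventually (gt_mem_nhds hc)

lemma xp_sep {i j : Fin m} (hij : i ≠ j) (k : ℕ) : 7 * S.R ≤ ‖S.xp i k - S.xp j k‖ := by
  have h1 := S.hsep i j hij
  have h2 := S.hnear i k
  have h3 := S.hnear j k
  have h4 : ‖S.xs i - S.xs j‖ ≤ ‖S.xp i k - S.xp j k‖ + ‖S.xp i k - S.xs i‖ + ‖S.xp j k - S.xs j‖ := by
    have e : S.xs i - S.xs j = (S.xp i k - S.xp j k) - (S.xp i k - S.xs i) + (S.xp j k - S.xs j) := by
      ring
    calc ‖S.xs i - S.xs j‖ = ‖(S.xp i k - S.xp j k) - (S.xp i k - S.xs i) + (S.xp j k - S.xs j)‖ := by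
          rw [← e]
      _ ≤ _ := (norm_add_le _ _).trans (by gcongr; exact norm_sub_le _ _)
  have := S.hR
  linarith

lemma decomp (L : ℝ) : ∀ᶠ k in atTop, ∀ F : ℂ → ℝ, Integrable F →
    ∫ y, F y = (∑ j, ∫ y in ball (S.xp j k) (S.del j k * L), F y) + ∫ y in (S.bub L k)ᶜ, F y := by
  filter_upwards [S.delL_ev L S.R S.hR] with k hk F hF
  rw [← integral_add_compl (S.bub_meas L k) hF]
  congr 1
  unfold bub
  rw [integral_iUnion_fintype (fun j => measurableSet_ball) ?_ (fun j => hF.integrableOn)]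
  intro i j hij
  refine ball_disjoint_ball ?_
  rw [dist_eq_norm]
  have := S.xp_sep hij k
  have := hk i
  have := hk j
  have := S.hR
  linarith

lemma conc {ε : ℝ} (hε : 0 < ε) : ∃ L : ℝ, 0 < L ∧ ∀ᶠ k in atTop,
    (∀ j, |(∫ y in ball (S.xp j k) (S.del j k * L), S.f k y) - 8 * π| ≤ ε) ∧
    ∫ y in (S.bub L k)ᶜ, S.f k y ≤ ε := by
  set η := ε / (2 * ((m:ℝ) + 1)) with hη
  have hη0 : 0 < η := by positivity
  have hηε : η ≤ ε := by
    rw [hη]; apply div_le_self hε.le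
    have : (0:ℝ) ≤ m := by positivity
    linarith
  obtain ⟨L, hL, hL2⟩ := expU_ball hη0
  refine ⟨L, hL, ?_⟩
  have h1 : ∀ᶠ k in atTop, ∀ j, |(∫ y in ball (S.xp j k) (S.del j k * L), S.f k y) - 8 * π| < η := by
    rw [eventually_all]
    intro j
    exact ((S.mass_ball j L).sub_const (8 * π)).abs.eventually (gt_mem_nhds hL2)
  have h2 := (Metric.tendsto_nhds.1 S.hmass) η hη0
  filter_upwards [h1, h2, S.decomp L] with k h1 h2 h3
  refine ⟨fun j => (h1 j).le.trans hηε, ?_⟩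
  have h4 := h3 _ (S.f_int k)
  have h5 : (m:ℝ) * (8 * π - η) ≤ ∑ j, ∫ y in ball (S.xp j k) (S.del j k * L), S.f k y := by
    have : ∑ _j : Fin m, (8 * π - η) ≤ ∑ j, ∫ y in ball (S.xp j k) (S.del j k * L), S.f k y :=
      Finset.sum_le_sum fun j _ => by have := abs_lt.1 (h1 j); linarith
    simp only [Finset.sum_const, Finset.card_univ, Fintype.card_fin, nsmul_eq_mul] at this
    exact this
  rw [Real.dist_eq, abs_lt] at h2
  have h6 : ∫ y, S.f k y < 8 * π * m + η := by
    have := h2.2; unfold f; linarith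
  have h7 : η * (m + 1) = ε / 2 := by rw [hη]; field_simp
  nlinarith

lemma dbound : ∃ C L : ℝ, 0 < C ∧ 0 < L ∧ ∀ᶠ k in atTop, ∀ (x : ℂ) (r : ℝ), 0 < r → r ≤ 1 →
    (∀ j, 2 * (S.del j k * L) ≤ ‖x - S.xp j k‖ ∧ 2 * r ≤ ‖x - S.xp j k‖) → S.f k x * r ^ 2 ≤ C := by
  obtain ⟨ε, C, hε, hC, H⟩ := eps_reg_v S.ha S.hb
  obtain ⟨L, hL, hc⟩ := S.conc hε
  refine ⟨C, L, hC, hL, ?_⟩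
  filter_upwards [hc, S.hlam0.eventually (gt_mem_nhds hε)] with k h1 h2 x r hr hr1 h3
  by_cases hx : x ∈ S.Ω
  · refine H _ _ _ _ (S.hP k) S.haV S.hbV h2.le x hx r hr hr1 ?_
    refine le_trans ?_ h1.2
    refine setIntegral_mono_set (S.f_int k).integrableOn (Eventually.of_forall fun y => S.f0 k y)
      (LE.le.eventuallyLE ?_)
    intro y hy hy2
    obtain ⟨j, hj⟩ := Set.mem_iUnion.1 hy2
    rw [mem_ball, dist_eq_norm] at hj hy
    obtain ⟨h4, h5⟩ := h3 j
    have h6 : ‖x - S.xp j k‖ ≤ ‖y - x‖ + ‖y - S.xp j k‖ := by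
      have := norm_sub_le (y - S.xp j k) (y - x)
      rw [sub_sub_sub_cancel_left] at this
      linarith
    linarith
  · rw [S.f_out hx, zero_mul]; exact hC.le

lemma f_far : ∃ C : ℝ, 0 < C ∧ ∀ᶠ k in atTop, ∀ x : ℂ, (∀ j, S.R / 4 ≤ ‖x - S.xs j‖) →
    S.f k x ≤ C := by
  obtain ⟨C, L, hC, hL, hk⟩ := S.dbound
  have hR := S.hR
  refine ⟨C / (S.R / 16) ^ 2, by positivity, ?_⟩
  filter_upwards [hk, S.delL_ev L (S.R / 16) (by positivity)] with k h1 h2 x hx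
  rw [le_div_iff₀ (by positivity)]
  refine h1 x _ (by positivity) (by linarith [S.hR1]) fun j => ?_
  have h3 := hx j
  have h4 := S.hnear j k
  have h5 : ‖x - S.xs j‖ ≤ ‖x - S.xp j k‖ + ‖S.xp j k - S.xs j‖ := by
    have := norm_add_le (x - S.xp j k) (S.xp j k - S.xs j)
    rwa [sub_add_sub_cancel] at this
  have := h2 j
  constructor <;> linarith

lemma f_near : ∃ C L : ℝ, 0 < C ∧ 0 < L ∧ ∀ᶠ k in atTop, ∀ j, ∀ x : ℂ,
    S.del j k * L ≤ ‖x - S.xp j k‖ → ‖x - S.xp j k‖ ≤ 2 * S.R →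
    S.f k x * ‖x - S.xp j k‖ ^ 2 ≤ C := by
  obtain ⟨C, L, hC, hL, hk⟩ := S.dbound
  have hR := S.hR
  refine ⟨4 * C, 2 * L, by positivity, by positivity, ?_⟩
  filter_upwards [hk, S.delL_ev L S.R (by positivity)] with k h1 h2 j x hx hx2
  have hpos : 0 < ‖x - S.xp j k‖ := lt_of_lt_of_le (by have := S.del_pos j k; positivity) hx
  have := h1 x (‖x - S.xp j k‖ / 2) (by positivity) (by linarith [S.hR1]) (fun i => by
    by_cases hij : i = j
    · subst hij; constructor <;> linarith
    · have h3 := S.xp_sep hij k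
      have h4 : ‖S.xp i k - S.xp j k‖ ≤ ‖x - S.xp j k‖ + ‖x - S.xp i k‖ := by
        have := norm_sub_le (x - S.xp j k) (x - S.xp i k)
        rwa [sub_sub_sub_cancel_left] at this
      have := h2 i
      constructor <;> linarith)
  nlinarith

lemma wc {ε Λ : ℝ} (hε : 0 < ε) (hΛ : 0 < Λ) : ∀ᶠ k in atTop, ∀ T : ℂ → ℝ,
    (∀ y, ‖y‖ ≤ S.D → |T y| ≤ Λ) → (∀ y y', |T y - T y'| ≤ Λ * ‖y - y'‖) →
    Integrable (fun y => T y * S.f k y) ∧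
    |(∫ y, T y * S.f k y) - 8 * π * ∑ j, T (S.xs j)| ≤ ε := by
  set η := ε / (2 * (Λ * (m + 1))) with hη
  have hη0 : 0 < η := by positivity
  obtain ⟨L, hL, hc⟩ := S.conc hη0
  have hM0 := S.hM0
  set η2 := ε / (4 * (Λ * (S.M + 1) * (m + 1))) with hη2
  have hη20 : 0 < η2 := by positivity
  have hl : ∀ᶠ k in atTop, ∀ j, ‖S.xp j k - S.xs j‖ < η2 := by
    rw [eventually_all]; intro j
    filter_upwards [(Metric.tendsto_nhds.1 (S.hlim j)) η2 hη20] with k hk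
    rwa [dist_eq_norm] at hk
  filter_upwards [hc, S.decomp L, S.delL_ev L η2 hη20, hl] with k h1 h2 h3 h4 T hT1 hT2
  have hTc : Continuous T := by
    have : LipschitzWith (Real.toNNReal Λ) T := LipschitzWith.of_dist_le_mul fun y y' => by
      rw [Real.dist_eq, dist_eq_norm, Real.coe_toNNReal _ hΛ.le]; exact hT2 y y'
    exact this.continuous
  have hpt : ∀ y, |T y * S.f k y| ≤ Λ * S.f k y := by
    intro y
    by_cases hy : S.f k y = 0
    · simp [hy]
    · rw [abs_mul, abs_of_nonneg (S.f0 k y)]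
      have := S.f0 k y
      gcongr
      exact hT1 y (S.f_supp k y hy)
  have hint : Integrable (fun y => T y * S.f k y) :=
    Integrable.mono' ((S.f_int k).const_mul Λ)
      (hTc.aestronglyMeasurable.mul (S.f_int k).aestronglyMeasurable) (Eventually.of_forall hpt)
  refine ⟨hint, ?_⟩
  have hcompl : |∫ y in (S.bub L k)ᶜ, T y * S.f k y| ≤ Λ * η := by
    have hp : ∀ᵐ y ∂(volume.restrict (S.bub L k)ᶜ), ‖T y * S.f k y‖ ≤ Λ * S.f k y :=
      Eventually.of_forall fun y => hpt y
    calc |∫ y in (S.bub L k)ᶜ, T y * S.f k y| ≤ ∫ y in (S.bub L k)ᶜ, Λ * S.f k y :=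
          norm_integral_le_of_norm_le ((S.f_int k).const_mul Λ).integrableOn hp
      _ = Λ * ∫ y in (S.bub L k)ᶜ, S.f k y := integral_const_mul _ _
      _ ≤ _ := by gcongr; exact h1.2
  have hj : ∀ j, |(∫ y in ball (S.xp j k) (S.del j k * L), T y * S.f k y) - 8 * π * T (S.xs j)| ≤
      Λ * (2 * η2) * S.M + Λ * η := by
    intro j
    set B := ball (S.xp j k) (S.del j k * L)
    have e1 : (∫ y in B, T y * S.f k y) - 8 * π * T (S.xs j) =
        (∫ y in B, (T y - T (S.xs j)) * S.f k y) + T (S.xs j) * ((∫ y in B, S.f k y) - 8 * π) := by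
      simp_rw [sub_mul]
      rw [integral_sub hint.integrableOn ((S.f_int k).const_mul _).integrableOn,
        integral_const_mul]
      ring
    rw [e1]
    have hxs : ‖S.xs j‖ ≤ S.D := S.hD _ (subset_closure (S.hball j (mem_closedBall_self
      (by have := S.hR; positivity))))
    refine (abs_add_le _ _).trans (add_le_add ?_ ?_)
    · have hp : ∀ᵐ y ∂(volume.restrict B), ‖(T y - T (S.xs j)) * S.f k y‖ ≤
          Λ * (2 * η2) * S.f k y := by
        filter_upwards [self_mem_ae_restrict measurableSet_ball] with y hy
        rw [Real.norm_eq_abs, abs_mul, abs_of_nonneg (S.f0 k y)]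
        have := S.f0 k y
        gcongr
        refine (hT2 _ _).trans ?_
        gcongr
        rw [mem_ball, dist_eq_norm] at hy
        have := norm_add_le (y - S.xp j k) (S.xp j k - S.xs j)
        rw [sub_add_sub_cancel] at this
        linarith [h3 j, h4 j]
      calc |∫ y in B, (T y - T (S.xs j)) * S.f k y| ≤ ∫ y in B, Λ * (2 * η2) * S.f k y :=
            norm_integral_le_of_norm_le ((S.f_int k).const_mul _).integrableOn hp
        _ = Λ * (2 * η2) * ∫ y in B, S.f k y := integral_const_mul _ _
        _ ≤ Λ * (2 * η2) * S.M := by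
            gcongr
            exact (setIntegral_le_integral (S.f_int k)
              (Eventually.of_forall (S.f0 k))).trans (S.f_mass k)
    · rw [abs_mul]
      gcongr
      · exact hT1 _ hxs
      · exact h1.1 j
  have e2 : (∫ y, T y * S.f k y) - 8 * π * ∑ j, T (S.xs j) =
      (∑ j, ((∫ y in ball (S.xp j k) (S.del j k * L), T y * S.f k y) - 8 * π * T (S.xs j))) +
      ∫ y in (S.bub L k)ᶜ, T y * S.f k y := by
    rw [h2 _ hint, Finset.sum_sub_distrib, ← Finset.mul_sum]; ring
  rw [e2]
  have hsum : |∑ j, ((∫ y in ball (S.xp j k) (S.del j k * L), T y * S.f k y) - 8 * π * T (S.xs j))|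
      ≤ m * (Λ * (2 * η2) * S.M + Λ * η) := by
    refine (Finset.abs_sum_le_sum_abs _ _).trans ((Finset.sum_le_sum fun j _ => hj j).trans ?_)
    simp only [Finset.sum_const, Finset.card_univ, Fintype.card_fin, nsmul_eq_mul]
    exact le_rfl
  have e3 : Λ * η * (m + 1) = ε / 2 := by rw [hη]; field_simp
  have e4 : Λ * (2 * η2) * (S.M + 1) * (m + 1) = ε / 2 := by rw [hη2]; field_simp; ring
  have hm0 : (0:ℝ) ≤ m := by positivity
  have e5 : m * (Λ * (2 * η2) * S.M) ≤ Λ * (2 * η2) * (S.M + 1) * (m + 1) := by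
    have : 0 ≤ Λ * (2 * η2) := by positivity
    nlinarith [mul_nonneg this hM0, mul_nonneg (mul_nonneg this hM0) hm0, mul_nonneg this hm0]
  refine (abs_add_le _ _).trans ?_
  nlinarith

end Sq
end BU

end

section
open MeasureTheory Real Filter Topology Metric Bornology
open scoped RealInnerProductSpace

namespace BU

/-- truncated logarithm -/
def tl (x : ℂ) (s : ℝ) (y : ℂ) : ℝ := Real.log (max ‖x - y‖ s)

lemma tl_lip (x : ℂ) {s : ℝ} (hs : 0 < s) (y y' : ℂ) : |tl x s y - tl x s y'| ≤ 2 / s * ‖y - y'‖ := by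
  unfold tl
  have h1 : s ≤ max ‖x - y‖ s := le_max_right _ _
  have h2 : s ≤ max ‖x - y'‖ s := le_max_right _ _
  have h3 := abs_log_sub_le (hs.trans_le h1) (hs.trans_le h2)
  have h4 : |max ‖x - y‖ s - max ‖x - y'‖ s| ≤ ‖y - y'‖ := by
    refine (abs_max_sub_max_le_abs _ _ _).trans ((abs_norm_sub_norm_le _ _).trans (le_of_eq ?_))
    rw [sub_sub_sub_cancel_left, norm_sub_rev]
  refine h3.trans ?_
  have h5 : (max ‖x - y‖ s)⁻¹ ≤ s⁻¹ := inv_anti₀ hs h1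
  have h6 : (max ‖x - y'‖ s)⁻¹ ≤ s⁻¹ := inv_anti₀ hs h2
  calc _ ≤ ‖y - y'‖ * (s⁻¹ + s⁻¹) := by gcongr
    _ = _ := by ring

lemma tl_bdd {x y : ℂ} {s D : ℝ} (hs : 0 < s) (hs1 : s ≤ 1) (hD : 1 ≤ D) (hx : ‖x‖ ≤ D)
    (hy : ‖y‖ ≤ D) : |tl x s y| ≤ 2 * D + 2 / s := by
  unfold tl
  have h1 : s ≤ max ‖x - y‖ s := le_max_right _ _
  have h2 : max ‖x - y‖ s ≤ 2 * D := max_le ((norm_sub_le _ _).trans (by linarith)) (by linarith)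
  refine (abs_log_le (hs.le.trans h1)).trans ?_
  have h5 : (max ‖x - y‖ s)⁻¹ ≤ s⁻¹ := inv_anti₀ hs h1
  have : 2 / s = s⁻¹ + s⁻¹ := by ring
  have : 0 < s⁻¹ := by positivity
  linarith

lemma lg_bound {s : ℝ} (hs : 0 < s) {z : ℂ} (hz : z ≠ 0) :
    |Real.log ‖z‖ - Real.log (max ‖z‖ s)| ≤ s * ker 1 s z := by
  have hn : 0 < ‖z‖ := norm_pos_iff.2 hz
  by_cases hb : ‖z‖ < s
  · have h1 : ker 1 s z = ‖z‖⁻¹ := by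
      rw [ker_eq, Set.indicator_of_mem (by exact hb), Real.rpow_neg_one]
    rw [h1, max_eq_right hb.le, abs_sub_comm, abs_of_nonneg (sub_nonneg.2 (Real.log_le_log hn hb.le))]
    have h3 : Real.log (s * ‖z‖⁻¹) ≤ s * ‖z‖⁻¹ := Real.log_le_self (by positivity)
    rw [Real.log_mul hs.ne' (by positivity), Real.log_inv] at h3
    linarith
  · push Not at hb
    rw [max_eq_left hb, sub_self, abs_zero]
    have := ker_nonneg 1 s z
    positivity

namespace Sq
variable {m : ℕ} (S : Sq m)

lemma pot_split (k : ℕ) {x : ℂ} {s A : ℝ} (hs : 0 < s) (_hA0 : 0 ≤ A)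
    (hA : ∀ y ∈ ball x s, S.f k y ≤ A) (hint : Integrable (fun y => tl x s y * S.f k y)) :
    |Pot (S.f k) x + 1 / (2 * π) * ∫ y, tl x s y * S.f k y| ≤ A * s ^ 2 := by
  have hpi := Real.pi_pos
  obtain ⟨hki, hkv⟩ := ker_integral_sub (a := 1) (by norm_num) hs x
  norm_num at hkv
  have e1 : Pot (S.f k) x + 1 / (2 * π) * ∫ y, tl x s y * S.f k y =
      -(1 / (2 * π)) * ∫ y, (Real.log ‖x - y‖ - tl x s y) * S.f k y := by
    simp_rw [sub_mul]
    rw [integral_sub (S.logf_int k x) hint]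
    unfold Pot; ring
  rw [e1, abs_mul, abs_neg, abs_of_pos (by positivity)]
  have hp : ∀ᵐ y, ‖(Real.log ‖x - y‖ - tl x s y) * S.f k y‖ ≤ s * A * ker 1 s (x - y) := by
    filter_upwards [ae_ne x] with y hy
    rw [Real.norm_eq_abs, abs_mul, abs_of_nonneg (S.f0 k y)]
    have h1 := lg_bound hs (sub_ne_zero.2 hy)
    have h0 := S.f0 k y
    by_cases hb : y ∈ ball x s
    · have := ker_nonneg 1 s (x - y)
      calc _ ≤ s * ker 1 s (x - y) * A := by gcongr; exacts [h1, hA y hb]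
        _ = _ := by ring
    · have hz : ker 1 s (x - y) = 0 := by
        rw [ker_eq, Set.indicator_of_notMem]
        rw [mem_ball, dist_comm, dist_eq_norm] at hb
        exact hb
      rw [hz, mul_zero] at h1 ⊢
      have : |Real.log ‖x - y‖ - tl x s y| = 0 := le_antisymm h1 (abs_nonneg _)
      rw [this, zero_mul]
  have h2 := norm_integral_le_of_norm_le (hki.const_mul (s * A)) hp
  rw [integral_const_mul, hkv, Real.norm_eq_abs] at h2
  calc 1 / (2 * π) * |∫ y, (Real.log ‖x - y‖ - tl x s y) * S.f k y|
      ≤ 1 / (2 * π) * (s * A * (2 * π * s)) := by gcongr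
    _ = _ := by field_simp

lemma hcau {η : ℝ} (hη : 0 < η) : ∃ K, ∀ k ≥ K, ∀ l ≥ K, ∀ x ∈ closure S.Ω,
    |S.h k x - S.h l x| ≤ η := by
  have hpi := Real.pi_pos
  have hR := S.hR
  have hR1 := S.hR1
  have hD1 := S.hD1
  obtain ⟨C, hC, hfar⟩ := S.f_far
  -- choose s
  obtain ⟨s, hs, hsR, hsC⟩ : ∃ s : ℝ, 0 < s ∧ s ≤ S.R ∧ C * s ^ 2 ≤ η / 4 := by
    set t := min S.R (η / (4 * C)) with ht
    have ht0 : 0 < t := lt_min hR (by positivity)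
    refine ⟨t, ht0, min_le_left _ _, ?_⟩
    have h1 : t ≤ 1 := (min_le_left _ _).trans hR1
    have h2 : t ≤ η / (4 * C) := min_le_right _ _
    rw [le_div_iff₀ (by positivity)] at h2
    nlinarith
  have hwc := S.wc (ε := η / 4) (Λ := 2 * S.D + 2 / s) (by positivity) (by positivity)
  obtain ⟨K, hK⟩ := eventually_atTop.1 (hfar.and hwc)
  refine ⟨K, ?_⟩
  have key : ∀ k ≥ K, ∀ x ∈ frontier S.Ω,
      |S.h k x - 1 / (2 * π) * (8 * π * ∑ j, tl x s (S.xs j))| ≤ η / 2 := by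
    intro k hk x hx
    have hxc : x ∈ closure S.Ω := frontier_subset_closure hx
    have hxn : x ∉ S.Ω := by
      rw [(S.hP 0).hopen.frontier_eq] at hx; exact hx.2
    obtain ⟨h1, h2⟩ := hK k hk
    have hxD := S.hD x hxc
    obtain ⟨h3, h4⟩ := h2 (tl x s) (fun y hy => tl_bdd hs (hsR.trans hR1) hD1 hxD hy)
      (fun y y' => (tl_lip x hs y y').trans (by gcongr; linarith))
    have h5 := S.pot_split k hs hC.le (fun y hy => h1 y (fun j => by
      have h6 : 4 * S.R < ‖x - S.xs j‖ := by
        by_contra hcon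
        push Not at hcon
        exact hxn (S.hball j (by rwa [mem_closedBall, dist_eq_norm]))
      rw [mem_ball, dist_eq_norm] at hy
      have h7 := norm_sub_le (y - S.xs j) (y - x)
      rw [sub_sub_sub_cancel_left] at h7
      linarith)) h3
    have e1 : S.h k x = - Pot (S.f k) x := by
      unfold h; rw [(S.hP k).hBC x hx]; ring
    rw [e1]
    have e2 : - Pot (S.f k) x - 1 / (2 * π) * (8 * π * ∑ j, tl x s (S.xs j)) =
      -(Pot (S.f k) x + 1 / (2 * π) * ∫ y, tl x s y * S.f k y) +
      1 / (2 * π) * ((∫ y, tl x s y * S.f k y) - 8 * π * ∑ j, tl x s (S.xs j)) := by ring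
    rw [e2]
    refine (abs_add_le _ _).trans ?_
    rw [abs_neg, abs_mul, abs_of_pos (by positivity : 0 < 1 / (2 * π))]
    have h8 : 1 / (2 * π) ≤ 1 := by
      rw [div_le_one (by positivity)]
      have := Real.pi_gt_three; linarith
    have h9 : 1 / (2 * π) * |(∫ y, tl x s y * S.f k y) - 8 * π * ∑ j, tl x s (S.xs j)| ≤
        1 * (η / 4) := by gcongr
    linarith
  have half : ∀ k ≥ K, ∀ l ≥ K, ∀ x ∈ closure S.Ω, S.h k x - S.h l x ≤ η := by
    intro k hk l hl
    refine max_principle (S.hP k).hopen (S.hP k).hbd ((S.h_cont k).sub (S.h_cont l))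
      ((S.h_mv k).sub (S.h_mv l)) ?_
    intro x hx
    have h1 := abs_le.1 (key k hk x hx)
    have h2 := abs_le.1 (key l hl x hx)
    change S.h k x - S.h l x ≤ η
    linarith
  intro k hk l hl x hx
  rw [abs_le]
  have := half k hk l hl x hx
  have := half l hl k hk x hx
  constructor <;> linarith

lemma hbdd : ∃ C : ℝ, 0 < C ∧ ∀ᶠ k in atTop, ∀ x ∈ closure S.Ω, |S.h k x| ≤ C := by
  obtain ⟨K, hK⟩ := S.hcau one_pos
  obtain ⟨A, hA⟩ := (S.hP K).hbd.isCompact_closure.exists_bound_of_continuousOn (S.h_cont K)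
  refine ⟨|A| + 1, by positivity, ?_⟩
  filter_upwards [eventually_ge_atTop K] with k hk x hx
  have h1 := abs_le.1 (hK k hk K le_rfl x hx)
  have h2 := hA x hx
  rw [Real.norm_eq_abs, abs_le] at h2
  have := le_abs_self A
  rw [abs_le]; constructor <;> linarith

lemma h_lim (j : Fin m) : ∃ c, Tendsto (fun k => S.h k (S.xp j k)) atTop (𝓝 c) := by
  have hR := S.hR
  obtain ⟨C, hC, hb⟩ := S.hbdd
  have hxs : S.xs j ∈ closure S.Ω := subset_closure (S.hball j (mem_closedBall_self (by positivity)))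
  have h1 : CauchySeq (fun k => S.h k (S.xs j)) := by
    rw [Metric.cauchySeq_iff]
    intro ε hε
    obtain ⟨K, hK⟩ := S.hcau (half_pos hε)
    refine ⟨K, fun k hk l hl => ?_⟩
    rw [Real.dist_eq]
    exact (hK k hk l hl _ hxs).trans_lt (by linarith)
  obtain ⟨c, hc⟩ := cauchySeq_tendsto_of_complete h1
  refine ⟨c, ?_⟩
  have h2 : Tendsto (fun k => S.h k (S.xp j k) - S.h k (S.xs j)) atTop (𝓝 0) := by
    have h3 : Tendsto (fun k => 8 * C / S.R * ‖S.xp j k - S.xs j‖) atTop (𝓝 0) := by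
      have := ((S.hlim j).sub_const (S.xs j)).norm.const_mul (8 * C / S.R)
      simpa using this
    refine squeeze_zero_norm' ?_ h3
    filter_upwards [hb] with k hk
    have hsub : closedBall (S.xs j) S.R ⊆ S.Ω :=
      (closedBall_subset_closedBall (by linarith)).trans (S.hball j)
    exact harnack_bdd (S.h_mv k) hR hsub (fun y hy => hk y (subset_closure (hsub hy)))
      ((S.hnear j k).trans (by linarith))
  simpa using h2.add hc

end Sq
end BU

end

section
open MeasureTheory Real Filter Topology Metric Bornology
open scoped RealInnerProductSpace

namespace BU
namespace Sq
variable {m : ℕ} (S : Sq m)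

lemma g_log_int (j : Fin m) (k : ℕ) (z : ℂ) :
    Integrable (fun y => Real.log ‖z - y‖ * S.g j k y) := by
  obtain ⟨A, hA⟩ := S.f_bdd k
  have hd := S.del_pos j k
  refine log_integrable (S.g_int j k) (A := S.del j k ^ 2 * A)
    (D := (S.D + ‖S.xp j k‖) / S.del j k) (fun y => ?_) (fun y hy => ?_) z
  · unfold g
    rw [abs_mul, abs_of_nonneg (sq_nonneg _)]
    gcongr
    exact hA _
  · have h1 : S.f k (S.xp j k + (S.del j k : ℂ) * y) ≠ 0 := fun h => hy (by simp [g, h])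
    have h2 := S.f_supp k _ h1
    rw [le_div_iff₀ hd]
    have h3 := norm_sub_le (S.xp j k + (S.del j k : ℂ) * y) (S.xp j k)
    rw [add_sub_cancel_left, norm_mul, Complex.norm_real, Real.norm_eq_abs, abs_of_pos hd] at h3
    linarith

/-- Explicit formula for w, with bounded error. -/
lemma w_le : ∃ C : ℝ, ∀ᶠ k in atTop, ∀ j, ∀ z : ℂ, S.del j k * ‖z‖ ≤ S.R →
    S.w j k z ≤ C + 1 / (2 * π) * ∫ y, (Real.log ‖y‖ - Real.log ‖z - y‖) * S.g j k y := by
  obtain ⟨C, hC, hb⟩ := S.hbdd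
  refine ⟨2 * C, ?_⟩
  filter_upwards [hb] with k hk j z hz
  have hR := S.hR
  have hd := S.del_pos j k
  have hx : S.xp j k + (S.del j k : ℂ) * z ∈ S.Ω := S.xp_ball j k (by
    rw [mem_closedBall, dist_eq_norm, add_sub_cancel_left, norm_mul, Complex.norm_real,
      Real.norm_eq_abs, abs_of_pos hd]
    linarith)
  have h1 := abs_le.1 (hk _ (subset_closure hx))
  have h2 := abs_le.1 (hk _ (subset_closure (S.xp_mem j k)))
  have hp := S.pot_scale j k z
  have e : ∫ y, (Real.log ‖y‖ - Real.log ‖z - y‖) * S.g j k y =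
      - ∫ y, (Real.log ‖z - y‖ - Real.log ‖y‖) * S.g j k y := by
    rw [← integral_neg]; congr 1; ext y; ring
  rw [e]
  unfold h at h1 h2
  unfold w
  nlinarith

lemma g_le_exp (j : Fin m) (k : ℕ) (z : ℂ) (hz : S.del j k * ‖z‖ ≤ S.R) :
    S.g j k z ≤ S.b / S.a * Real.exp (S.w j k z) := by
  have hR := S.hR
  have hd := S.del_pos j k
  have hx : S.xp j k + (S.del j k : ℂ) * z ∈ S.Ω := S.xp_ball j k (by
    rw [mem_closedBall, dist_eq_norm, add_sub_cancel_left, norm_mul, Complex.norm_real,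
      Real.norm_eq_abs, abs_of_pos hd]
    linarith)
  have ha := S.ha
  have hb := S.hb
  have hl := (S.hP k).hl
  have hsq := S.del_sq j k
  rw [S.f_in (S.xp_mem j k)] at hsq
  have hV := S.haV _ (S.xp_mem j k)
  have hVb := S.hbV _ hx
  have hE := Real.exp_pos (S.v k (S.xp j k))
  have h1 : S.del j k ^ 2 * S.lam k ≤ (S.a * Real.exp (S.v k (S.xp j k)))⁻¹ := by
    rw [← one_div, le_div_iff₀ (by positivity), ← hsq]
    calc S.del j k ^ 2 * S.lam k * (S.a * Real.exp (S.v k (S.xp j k))) ≤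
        S.del j k ^ 2 * S.lam k * (S.V (S.xp j k) * Real.exp (S.v k (S.xp j k))) := by gcongr
      _ = _ := by ring
  unfold g w
  rw [S.f_in hx, Real.exp_sub]
  calc S.del j k ^ 2 * (S.lam k * S.V (S.xp j k + (S.del j k : ℂ) * z) *
        Real.exp (S.v k (S.xp j k + (S.del j k : ℂ) * z)))
      = S.del j k ^ 2 * S.lam k * S.V (S.xp j k + (S.del j k : ℂ) * z) *
        Real.exp (S.v k (S.xp j k + (S.del j k : ℂ) * z)) := by ring
    _ ≤ (S.a * Real.exp (S.v k (S.xp j k)))⁻¹ * S.b *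
        Real.exp (S.v k (S.xp j k + (S.del j k : ℂ) * z)) := by
        have : 0 < S.V (S.xp j k + (S.del j k : ℂ) * z) := (S.hP k).hVpos _ (subset_closure hx)
        gcongr
    _ = _ := by field_simp

lemma g_near : ∃ C L : ℝ, 0 < C ∧ 0 < L ∧ ∀ᶠ k in atTop, ∀ j, ∀ y : ℂ,
    L ≤ ‖y‖ → S.del j k * ‖y‖ ≤ 2 * S.R → S.g j k y * ‖y‖ ^ 2 ≤ C := by
  obtain ⟨C, L, hC, hL, hk⟩ := S.f_near
  refine ⟨C, L, hC, hL, ?_⟩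
  filter_upwards [hk] with k h1 j y hy hy2
  have hd := S.del_pos j k
  have hn : ‖S.xp j k + (S.del j k : ℂ) * y - S.xp j k‖ = S.del j k * ‖y‖ := by
    rw [add_sub_cancel_left, norm_mul, Complex.norm_real, Real.norm_eq_abs, abs_of_pos hd]
  have := h1 j (S.xp j k + (S.del j k : ℂ) * y) (by rw [hn]; gcongr) (by rw [hn]; exact hy2)
  rw [hn] at this
  unfold g
  linarith

lemma decay_out : ∃ C L : ℝ, 0 < C ∧ 1 ≤ L ∧ ∀ᶠ k in atTop, ∀ j, ∀ z : ℂ,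
    L ≤ ‖z‖ → S.del j k * ‖z‖ ≤ S.R → S.g j k z ≤ C * ‖z‖ ^ (-(7 / 2) : ℝ) := by
  have hpi := Real.pi_pos
  obtain ⟨C0, hw⟩ := S.w_le
  obtain ⟨C, L0, hC, hL0, hg⟩ := S.g_near
  obtain ⟨L, hL, hc⟩ := S.conc Real.pi_pos
  set K := C0 + 1 / (2 * π) * (Real.log 3 * S.M + 2 * π * C) + 7 / 2 * Real.log (2 * L) with hK
  have hab : 0 < S.b / S.a := div_pos S.hb S.ha
  refine ⟨S.b / S.a * Real.exp K, max 1 (max (2 * L0) (2 * L)), by positivity, le_max_left _ _, ?_⟩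
  filter_upwards [hw, hg, hc] with k h1 h2 h3 j z hz hz2
  have hz1 : 1 ≤ ‖z‖ := (le_max_left _ _).trans hz
  have hzL0 : 2 * L0 ≤ ‖z‖ := (le_max_left _ _).trans ((le_max_right _ _).trans hz)
  have hzL : 2 * L ≤ ‖z‖ := (le_max_right _ _).trans ((le_max_right _ _).trans hz)
  have hz0 : 0 < ‖z‖ := by linarith
  have hd := S.del_pos j k
  have hs : 0 < ‖z‖ / 2 := by positivity
  obtain ⟨hki, hkv⟩ := ker_integral_sub (a := 1) (by norm_num) hs z
  norm_num at hkv
  set ℓ := Real.log (2 * L / ‖z‖) with hℓ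
  have hℓ0 : ℓ ≤ 0 := Real.log_nonpos (by positivity) (by rw [div_le_one hz0]; exact hzL)
  have hlog3 : 0 < Real.log 3 := Real.log_pos (by norm_num)
  have hpt : ∀ᵐ y, (Real.log ‖y‖ - Real.log ‖z - y‖) * S.g j k y ≤
      ((ball 0 L).indicator (fun y => ℓ * S.g j k y) y + Real.log 3 * S.g j k y) +
        2 * C / ‖z‖ * ker 1 (‖z‖ / 2) (z - y) := by
    filter_upwards [ae_ne z, ae_ne (0:ℂ)] with y hy hy0
    have hg0 := S.g_nonneg j k y
    have hny : 0 < ‖y‖ := norm_pos_iff.2 hy0.symm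
    have hnz : 0 < ‖z - y‖ := norm_pos_iff.2 (sub_ne_zero.2 hy)
    have hker := ker_nonneg 1 (‖z‖ / 2) (z - y)
    have hkt : 0 ≤ 2 * C / ‖z‖ * ker 1 (‖z‖ / 2) (z - y) := by positivity
    have tri1 : ‖z‖ ≤ ‖z - y‖ + ‖y‖ := by
      have := norm_add_le (z - y) y; simpa using this
    have tri2 : ‖y‖ ≤ ‖z - y‖ + ‖z‖ := by
      have := norm_sub_le z (z - y); rw [sub_sub_cancel] at this; linarith
    by_cases hyL : y ∈ ball (0:ℂ) L
    · rw [Set.indicator_of_mem hyL]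
      rw [mem_ball, dist_zero_right] at hyL
      have h4 : Real.log ‖y‖ - Real.log ‖z - y‖ ≤ ℓ := by
        rw [← Real.log_div hny.ne' hnz.ne', hℓ]
        apply Real.log_le_log (by positivity)
        rw [div_le_div_iff₀ hnz hz0]
        nlinarith
      nlinarith
    · rw [Set.indicator_of_notMem hyL, zero_add]
      by_cases hb : ‖z - y‖ < ‖z‖ / 2
      · have hk1 : ker 1 (‖z‖ / 2) (z - y) = ‖z - y‖⁻¹ := by
          rw [ker_eq, Set.indicator_of_mem (by exact hb), Real.rpow_neg_one]
        have h4 : Real.log ‖y‖ - Real.log ‖z - y‖ ≤ Real.log 3 + ‖z‖ / 2 * ‖z - y‖⁻¹ := by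
          have h5 : Real.log ‖y‖ ≤ Real.log (3 * (‖z‖ / 2)) := Real.log_le_log hny (by linarith)
          rw [Real.log_mul (by norm_num) hs.ne'] at h5
          have h6 : Real.log (‖z‖ / 2 * ‖z - y‖⁻¹) ≤ ‖z‖ / 2 * ‖z - y‖⁻¹ :=
            Real.log_le_self (by positivity)
          rw [Real.log_mul hs.ne' (by positivity), Real.log_inv] at h6
          linarith
        have h7 : S.g j k y ≤ 4 * C / ‖z‖ ^ 2 := by
          have h8 := h2 j y (by linarith) (by nlinarith)
          rw [le_div_iff₀ (by positivity)]
          have : (‖z‖ / 2) ^ 2 ≤ ‖y‖ ^ 2 := by gcongr; linarith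
          nlinarith
        rw [hk1]
        calc (Real.log ‖y‖ - Real.log ‖z - y‖) * S.g j k y
            ≤ (Real.log 3 + ‖z‖ / 2 * ‖z - y‖⁻¹) * S.g j k y := by gcongr
          _ = Real.log 3 * S.g j k y + ‖z‖ / 2 * ‖z - y‖⁻¹ * S.g j k y := by ring
          _ ≤ Real.log 3 * S.g j k y + ‖z‖ / 2 * ‖z - y‖⁻¹ * (4 * C / ‖z‖ ^ 2) := by gcongr
          _ = _ := by field_simp; ring
      · push Not at hb
        have h4 : Real.log ‖y‖ - Real.log ‖z - y‖ ≤ Real.log 3 := by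
          rw [← Real.log_div hny.ne' hnz.ne']
          apply Real.log_le_log (by positivity)
          rw [div_le_iff₀ hnz]
          linarith
        nlinarith
  have hint1 : Integrable (fun y => (Real.log ‖y‖ - Real.log ‖z - y‖) * S.g j k y) := by
    simp_rw [sub_mul]
    have := S.g_log_int j k 0
    simp only [zero_sub, norm_neg] at this
    exact this.sub (S.g_log_int j k z)
  have i1 : Integrable ((ball (0:ℂ) L).indicator (fun y => ℓ * S.g j k y)) :=
    ((S.g_int j k).const_mul ℓ).indicator measurableSet_ball
  have i2 := (S.g_int j k).const_mul (Real.log 3)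
  have i3 := hki.const_mul (2 * C / ‖z‖)
  have h4 := integral_mono_ae hint1 ((i1.add i2).add i3) hpt
  have e4 : ∫ y, (((ball (0:ℂ) L).indicator (fun y => ℓ * S.g j k y) + fun y => Real.log 3 * S.g j k y) +
        fun y => 2 * C / ‖z‖ * ker 1 (‖z‖ / 2) (z - y)) y =
      ℓ * (∫ y in ball 0 L, S.g j k y) + Real.log 3 * (∫ y, S.g j k y) + 2 * π * C := by
    rw [integral_add' (i1.add i2) i3, integral_add' i1 i2, integral_indicator measurableSet_ball,
      integral_const_mul, integral_const_mul, integral_const_mul, hkv]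
    field_simp
  rw [e4] at h4
  have hgL : 7 * π ≤ ∫ y in ball 0 L, S.g j k y := by
    have := abs_le.1 (h3.1 j)
    rw [scale_set _ _ hd] at this
    have h5 : ∫ y in ball 0 L, S.g j k y =
      ∫ z in ball 0 L, S.del j k ^ 2 * S.f k (S.xp j k + (S.del j k : ℂ) * z) := rfl
    rw [h5]; linarith
  have hgM : ∫ y, S.g j k y ≤ S.M := (S.bl j).hM k
  have h5 : ℓ * (∫ y in ball 0 L, S.g j k y) ≤ ℓ * (7 * π) := mul_le_mul_of_nonpos_left hgL hℓ0
  have h6 : Real.log 3 * (∫ y, S.g j k y) ≤ Real.log 3 * S.M := by gcongr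
  have h7 : S.w j k z ≤ K + Real.log ‖z‖ * (-(7 / 2)) := by
    have h8 := h1 j z hz2
    have h9 : 1 / (2 * π) * ∫ y, (Real.log ‖y‖ - Real.log ‖z - y‖) * S.g j k y ≤
        1 / (2 * π) * (ℓ * (7 * π) + Real.log 3 * S.M + 2 * π * C) := by
      gcongr; linarith
    have e5 : 1 / (2 * π) * (ℓ * (7 * π) + Real.log 3 * S.M + 2 * π * C) =
      7 / 2 * ℓ + 1 / (2 * π) * (Real.log 3 * S.M + 2 * π * C) := by field_simp; ring
    have e6 : ℓ = Real.log (2 * L) - Real.log ‖z‖ := Real.log_div (by positivity) hz0.ne'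
    rw [e5, e6] at h9
    rw [hK]; linarith
  calc S.g j k z ≤ S.b / S.a * Real.exp (S.w j k z) := S.g_le_exp j k z hz2
    _ ≤ S.b / S.a * Real.exp (K + Real.log ‖z‖ * (-(7 / 2))) := by gcongr
    _ = _ := by rw [Real.exp_add, ← Real.rpow_def_of_pos hz0]; ring

lemma decay : ∃ C : ℝ, 0 < C ∧ ∀ᶠ k in atTop, ∀ j, ∀ z : ℂ,
    S.del j k * ‖z‖ ≤ S.R → S.g j k z ≤ C * (1 + ‖z‖) ^ (-(7 / 2) : ℝ) := by
  obtain ⟨C, L, hC, hL, h⟩ := S.decay_out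
  have hab : 0 < S.b / S.a := div_pos S.hb S.ha
  have hR := S.hR
  refine ⟨C * 2 ^ (7 / 2 : ℝ) + S.b / S.a * (1 + L) ^ (7 / 2 : ℝ), by positivity, ?_⟩
  filter_upwards [h, S.delL_ev L S.R S.hR] with k h1 h2 j z hz
  have hd := S.del_pos j k
  have hn := norm_nonneg z
  have hp : 0 < (1 + ‖z‖) ^ (-(7 / 2) : ℝ) := by positivity
  rw [add_mul]
  by_cases hzL : L ≤ ‖z‖
  · have h3 := h1 j z hzL hz
    have h4 : ‖z‖ ^ (-(7 / 2) : ℝ) ≤ 2 ^ (7 / 2 : ℝ) * (1 + ‖z‖) ^ (-(7 / 2) : ℝ) := by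
      have h5 : ‖z‖ ^ (-(7 / 2) : ℝ) ≤ ((1 + ‖z‖) / 2) ^ (-(7 / 2) : ℝ) :=
        Real.rpow_le_rpow_of_nonpos (by positivity) (by linarith) (by norm_num)
      rw [Real.div_rpow (by positivity) (by norm_num), Real.rpow_neg (by norm_num : (0:ℝ) ≤ 2),
        div_inv_eq_mul] at h5
      linarith
    have h6 : 0 ≤ S.b / S.a * (1 + L) ^ (7 / 2 : ℝ) * (1 + ‖z‖) ^ (-(7 / 2) : ℝ) := by positivity
    calc S.g j k z ≤ C * ‖z‖ ^ (-(7 / 2) : ℝ) := h3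
      _ ≤ C * (2 ^ (7 / 2 : ℝ) * (1 + ‖z‖) ^ (-(7 / 2) : ℝ)) := by gcongr
      _ ≤ _ := by linarith
  · push Not at hzL
    have h3 : S.g j k z ≤ S.b / S.a := by
      have hlt : S.del j k * ‖z‖ < S.R := lt_of_le_of_lt (by gcongr) (h2 j)
      have := S.f_le_near j k (S.xp j k + (S.del j k : ℂ) * z) (by
        rw [mem_ball, dist_eq_norm, add_sub_cancel_left, norm_mul, Complex.norm_real,
          Real.norm_eq_abs, abs_of_pos hd]; exact hlt)
      unfold g
      calc _ ≤ S.del j k ^ 2 * (S.b / S.a * (S.del j k ^ 2)⁻¹) := by gcongr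
        _ = _ := by field_simp
    have h4 : 1 ≤ (1 + L) ^ (7 / 2 : ℝ) * (1 + ‖z‖) ^ (-(7 / 2) : ℝ) := by
      rw [Real.rpow_neg (by positivity), ← div_eq_mul_inv, one_le_div (by positivity)]
      gcongr
    have h6 : 0 ≤ C * 2 ^ (7 / 2 : ℝ) * (1 + ‖z‖) ^ (-(7 / 2) : ℝ) := by positivity
    nlinarith

lemma pw_int {r : ℝ} (hr : 2 < r) : Integrable (fun z : ℂ => (1 + ‖z‖) ^ (-r)) :=
  integrable_one_add_norm (by rw [Complex.finrank_real_complex]; exact_mod_cast hr)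

lemma pw_mul (z : ℂ) : ‖z‖ * (1 + ‖z‖) ^ (-(7 / 2) : ℝ) ≤ (1 + ‖z‖) ^ (-(5 / 2) : ℝ) := by
  have hn := norm_nonneg z
  have : (1 + ‖z‖) ^ (-(5 / 2) : ℝ) = (1 + ‖z‖) * (1 + ‖z‖) ^ (-(7 / 2) : ℝ) := by
    have h : (-(5 / 2) : ℝ) = 1 + (-(7 / 2)) := by norm_num
    rw [h, Real.rpow_add (by positivity), Real.rpow_one]
  rw [this]
  gcongr
  linarith

lemma kap : ∃ C : ℝ, 0 < C ∧ ∀ᶠ k in atTop, ∀ j,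
    ∫ x in ball (S.xp j k) S.R, ‖x - S.xp j k‖ * S.f k x ≤ C * S.del j k := by
  obtain ⟨C, hC, h⟩ := S.decay
  have hI := (pw_int (r := 5 / 2) (by norm_num))
  set I := ∫ z : ℂ, (1 + ‖z‖) ^ (-(5 / 2) : ℝ) with hIdef
  have hI0 : 0 ≤ I := integral_nonneg fun z => by positivity
  refine ⟨C * I + 1, by positivity, ?_⟩
  filter_upwards [h] with k h1 j
  have hd := S.del_pos j k
  have hRd : S.R = S.del j k * (S.R / S.del j k) := by field_simp
  rw [hRd, scale_set _ _ hd]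
  have hp : ∀ z ∈ ball (0:ℂ) (S.R / S.del j k), S.del j k ^ 2 *
      (‖S.xp j k + (S.del j k : ℂ) * z - S.xp j k‖ * S.f k (S.xp j k + (S.del j k : ℂ) * z)) ≤
      S.del j k * C * (1 + ‖z‖) ^ (-(5 / 2) : ℝ) := by
    intro z hz
    rw [mem_ball, dist_zero_right, lt_div_iff₀ hd] at hz
    rw [add_sub_cancel_left, norm_mul, Complex.norm_real, Real.norm_eq_abs, abs_of_pos hd]
    have h2 := h1 j z (by linarith)
    have h3 := pw_mul z
    calc S.del j k ^ 2 * (S.del j k * ‖z‖ * S.f k (S.xp j k + (S.del j k : ℂ) * z))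
        = S.del j k * ‖z‖ * S.g j k z := by unfold g; ring
      _ ≤ S.del j k * ‖z‖ * (C * (1 + ‖z‖) ^ (-(7 / 2) : ℝ)) := by gcongr
      _ = S.del j k * C * (‖z‖ * (1 + ‖z‖) ^ (-(7 / 2) : ℝ)) := by ring
      _ ≤ _ := by gcongr
  have h5 : ∫ z in ball (0:ℂ) (S.R / S.del j k), S.del j k ^ 2 *
      (‖S.xp j k + (S.del j k : ℂ) * z - S.xp j k‖ * S.f k (S.xp j k + (S.del j k : ℂ) * z)) ≤
      ∫ z in ball (0:ℂ) (S.R / S.del j k), S.del j k * C * (1 + ‖z‖) ^ (-(5 / 2) : ℝ) := by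
    refine integral_mono_of_nonneg (Eventually.of_forall fun z => ?_) (hI.const_mul _).integrableOn ?_
    · have := S.f0 k (S.xp j k + (S.del j k : ℂ) * z)
      positivity
    · filter_upwards [self_mem_ae_restrict measurableSet_ball] with z hz using hp z hz
  refine h5.trans ?_
  have h6 : ∫ z in ball (0:ℂ) (S.R / S.del j k), S.del j k * C * (1 + ‖z‖) ^ (-(5 / 2) : ℝ) ≤
      ∫ z : ℂ, S.del j k * C * (1 + ‖z‖) ^ (-(5 / 2) : ℝ) :=
    setIntegral_le_integral (hI.const_mul _) (Eventually.of_forall fun z => by positivity)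
  refine h6.trans ?_
  rw [integral_const_mul, ← hIdef]
  nlinarith

lemma dct (j : Fin m) : ∃ c, Tendsto (fun k => ∫ y in ball (S.xp j k) S.R,
    (Real.log ‖S.xp j k - y‖ - Real.log (S.del j k)) * S.f k y) atTop (𝓝 c) := by
  obtain ⟨C, hC, h⟩ := S.decay
  refine ⟨∫ z, Real.log ‖z‖ * Real.exp (U0 z), ?_⟩
  have e1 : ∀ k, ∫ y in ball (S.xp j k) S.R,
      (Real.log ‖S.xp j k - y‖ - Real.log (S.del j k)) * S.f k y =
      ∫ z, (ball (0:ℂ) (S.R / S.del j k)).indicator (fun z => Real.log ‖z‖ * S.g j k z) z := by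
    intro k
    have hd := S.del_pos j k
    have hRd : S.R = S.del j k * (S.R / S.del j k) := by field_simp
    conv_lhs => rw [hRd]
    rw [scale_set _ _ hd, integral_indicator measurableSet_ball]
    refine integral_congr_ae (ae_restrict_of_ae ?_)
    filter_upwards [ae_ne (0:ℂ)] with z hz
    have hz' : ‖z‖ ≠ 0 := by simpa using hz.symm
    rw [sub_add_cancel_left, norm_neg, norm_mul, Complex.norm_real, Real.norm_eq_abs,
      abs_of_pos hd, Real.log_mul hd.ne' hz']
    unfold g; ring
  simp_rw [e1]
  refine tendsto_integral_filter_of_dominated_convergence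
    (fun z => C * (2 * (1 + ‖z‖) ^ (-(5 / 2) : ℝ) + ker 1 1 z)) ?_ ?_ ?_ ?_
  · refine Eventually.of_forall fun k => ?_
    refine AEStronglyMeasurable.indicator ?_ measurableSet_ball
    have := (S.g_log_int j k 0).aestronglyMeasurable
    simpa only [zero_sub, norm_neg] using this
  · filter_upwards [h] with k hk
    filter_upwards [ae_ne (0:ℂ)] with z hz
    have hn : 0 < ‖z‖ := norm_pos_iff.2 hz.symm
    have hk0 := ker_nonneg 1 1 z
    by_cases hzb : z ∈ ball (0:ℂ) (S.R / S.del j k)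
    · rw [Set.indicator_of_mem hzb]
      rw [mem_ball, dist_zero_right, lt_div_iff₀ (S.del_pos j k)] at hzb
      have h2 := hk j z (by linarith)
      rw [Real.norm_eq_abs, abs_mul, abs_of_nonneg (S.g_nonneg j k z)]
      have h3 := abs_log_le hn.le
      have h4 := pw_mul z
      have h5 : ‖z‖⁻¹ * (1 + ‖z‖) ^ (-(7 / 2) : ℝ) ≤ (1 + ‖z‖) ^ (-(5 / 2) : ℝ) + ker 1 1 z := by
        have hp : 0 < (1 + ‖z‖) ^ (-(7 / 2) : ℝ) := by positivity
        by_cases h1 : ‖z‖ < 1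
        · have hk1 : ker 1 1 z = ‖z‖⁻¹ := by
            rw [ker_eq, Set.indicator_of_mem (by exact h1), Real.rpow_neg_one]
          rw [hk1]
          have h6 : (1 + ‖z‖) ^ (-(7 / 2) : ℝ) ≤ 1 :=
            Real.rpow_le_one_of_one_le_of_nonpos (by linarith) (by norm_num)
          have h7 : 0 < (1 + ‖z‖) ^ (-(5 / 2) : ℝ) := by positivity
          have : 0 < ‖z‖⁻¹ := by positivity
          nlinarith
        · push Not at h1
          have h6 : ‖z‖⁻¹ ≤ ‖z‖ := (inv_le_one_of_one_le₀ h1).trans h1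
          nlinarith
      calc |Real.log ‖z‖| * S.g j k z ≤ (‖z‖ + ‖z‖⁻¹) * (C * (1 + ‖z‖) ^ (-(7 / 2) : ℝ)) := by
            gcongr
            exact S.g_nonneg j k z
        _ = C * (‖z‖ * (1 + ‖z‖) ^ (-(7 / 2) : ℝ) + ‖z‖⁻¹ * (1 + ‖z‖) ^ (-(7 / 2) : ℝ)) := by ring
        _ ≤ _ := mul_le_mul_of_nonneg_left (by linarith) hC.le
    · rw [Set.indicator_of_notMem hzb, norm_zero]
      positivity
  · exact (((pw_int (r := 5 / 2) (by norm_num)).const_mul 2).add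
      (ker_integrable (by norm_num) one_pos)).const_mul C
  · refine Eventually.of_forall fun z => ?_
    have h1 := ((S.bl j).tendsto_g z).const_mul (Real.log ‖z‖)
    refine h1.congr' ?_
    filter_upwards [S.ev_small j ‖z‖ S.R S.hR] with k hk
    rw [Set.indicator_of_mem]
    have h2 := hk z le_rfl
    have hd := S.del_pos j k
    rw [norm_mul, Complex.norm_real, Real.norm_eq_abs, abs_of_pos hd] at h2
    rw [mem_ball, dist_zero_right, lt_div_iff₀ hd]
    linarith

end Sq
end BU

end

section
open MeasureTheory Real Filter Topology Metric Bornology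
open scoped RealInnerProductSpace

namespace BU

lemma int_div_zero {φ : ℂ → ℝ} (hφ : ContDiff ℝ 1 φ) (hs : HasCompactSupport φ) (e : ℂ) :
    Integrable (fun x => fderiv ℝ φ x e) ∧ ∫ x, fderiv ℝ φ x e = 0 := by
  have hc : Continuous (fun x => fderiv ℝ φ x e) :=
    (hφ.continuous_fderiv (by norm_num)).clm_apply continuous_const
  have hs' : HasCompactSupport (fun x => fderiv ℝ φ x e) := hs.fderiv_apply ℝ e
  refine ⟨hc.integrable_of_hasCompactSupport hs', ?_⟩
  have := ibp (f := fun _ => 1) (f' := fun _ => 0) (g := φ) (g' := fun x => fderiv ℝ φ x e) (e := e)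
    continuous_const continuous_const hφ.continuous hc hs hs'
    (fun x => by unfold HasLineDerivAt; exact hasDerivAt_const _ _)
    (fun x => ((hφ.differentiable (by norm_num)) x).hasFDerivAt.hasLineDerivAt e)
  simpa using this

lemma clm_split (L : ℂ →L[ℝ] ℝ) (z : ℂ) : L z = z.re * L 1 + z.im * L Complex.I := by
  have h : z = z.re • (1:ℂ) + z.im • Complex.I := by
    simp [Complex.re_add_im]
  conv_lhs => rw [h]
  rw [map_add, map_smul, map_smul, smul_eq_mul, smul_eq_mul]

lemma poh_comp {Ω : Set ℂ} (hΩ : IsOpen Ω) {f η : ℂ → ℝ} (hf : ContDiffOn ℝ 1 f Ω)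
    (hη : ContDiff ℝ 1 η) (hs : HasCompactSupport η) (hsub : tsupport η ⊆ Ω) (c e : ℂ)
    (ℓ : ℂ →L[ℝ] ℝ) :
    Integrable (fun x => fderiv ℝ f x e * (η x * ℓ (x - c)) +
      f x * (fderiv ℝ η x e * ℓ (x - c) + η x * ℓ e)) ∧
    ∫ x, (fderiv ℝ f x e * (η x * ℓ (x - c)) +
      f x * (fderiv ℝ η x e * ℓ (x - c) + η x * ℓ e)) = 0 := by
  set φ : ℂ → ℝ := fun x => f x * (η x * ℓ (x - c)) with hφdef
  have hℓ : ContDiff ℝ 1 (fun x => ℓ (x - c)) := by fun_prop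
  have hφ : ContDiff ℝ 1 φ := by
    rw [contDiff_iff_contDiffAt]
    intro x
    by_cases hx : x ∈ Ω
    · exact (hf.contDiffAt (hΩ.mem_nhds hx)).mul (hη.mul hℓ).contDiffAt
    · have h1 : x ∉ tsupport η := fun h => hx (hsub h)
      have h2 : φ =ᶠ[𝓝 x] fun _ => 0 := by
        filter_upwards [notMem_tsupport_iff_eventuallyEq.1 h1] with y hy
        simp only [hφdef, hy]; simp
      exact contDiffAt_const.congr_of_eventuallyEq h2
  have hsφ : HasCompactSupport φ := by
    have : HasCompactSupport (fun x => η x * ℓ (x - c)) := hs.mul_right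
    exact this.mul_left
  have hd : ∀ x, fderiv ℝ φ x e = fderiv ℝ f x e * (η x * ℓ (x - c)) +
      f x * (fderiv ℝ η x e * ℓ (x - c) + η x * ℓ e) := by
    intro x
    by_cases hx : x ∈ Ω
    · have h1 := ((hf.contDiffAt (hΩ.mem_nhds hx)).differentiableAt (by norm_num)).hasFDerivAt
      have h2 := ((hη.differentiable (by norm_num)) x).hasFDerivAt
      have h3 : HasFDerivAt (fun x => ℓ (x - c)) ℓ x := by
        have := ℓ.hasFDerivAt.comp x ((hasFDerivAt_id x).sub_const c)
        exact this.congr_fderiv (ContinuousLinearMap.comp_id _)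
      have h4 := (h1.mul (h2.mul h3)).fderiv
      have h5 : φ = f * (η * fun x => ℓ (x - c)) := rfl
      rw [h5, h4]
      simp only [add_apply, smul_apply, smul_eq_mul, Pi.mul_apply]
      ring
    · have h1 : x ∉ tsupport η := fun h => hx (hsub h)
      have h0 := notMem_tsupport_iff_eventuallyEq.1 h1
      have h2 : φ =ᶠ[𝓝 x] fun _ => 0 := by
        filter_upwards [h0] with y hy
        simp only [hφdef, hy]; simp
      rw [h2.fderiv_eq, h0.fderiv_eq, h0.self_of_nhds]
      simp
  have := int_div_zero hφ hsφ e
  simp_rw [hd] at this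
  exact this

lemma poh_core {Ω : Set ℂ} (hΩ : IsOpen Ω) {f η : ℂ → ℝ} (hf : ContDiffOn ℝ 1 f Ω)
    (hη : ContDiff ℝ 1 η) (hs : HasCompactSupport η) (hsub : tsupport η ⊆ Ω) (c : ℂ) :
    Integrable (fun x => fderiv ℝ f x ((η x : ℂ) * (x - c)) +
      f x * (2 * η x + fderiv ℝ η x (x - c))) ∧
    ∫ x, (fderiv ℝ f x ((η x : ℂ) * (x - c)) + f x * (2 * η x + fderiv ℝ η x (x - c))) = 0 := by
  obtain ⟨a1, a2⟩ := poh_comp hΩ hf hη hs hsub c 1 Complex.reCLM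
  obtain ⟨b1, b2⟩ := poh_comp hΩ hf hη hs hsub c Complex.I Complex.imCLM
  have e : ∀ x, fderiv ℝ f x ((η x : ℂ) * (x - c)) + f x * (2 * η x + fderiv ℝ η x (x - c)) =
      (fderiv ℝ f x 1 * (η x * Complex.reCLM (x - c)) +
      f x * (fderiv ℝ η x 1 * Complex.reCLM (x - c) + η x * Complex.reCLM 1)) +
      (fderiv ℝ f x Complex.I * (η x * Complex.imCLM (x - c)) +
      f x * (fderiv ℝ η x Complex.I * Complex.imCLM (x - c) + η x * Complex.imCLM Complex.I)) := by
    intro x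
    rw [clm_split (fderiv ℝ f x), clm_split (fderiv ℝ η x)]
    simp only [Complex.reCLM_apply, Complex.imCLM_apply, Complex.re_ofReal_mul,
      Complex.im_ofReal_mul, Complex.one_re, Complex.I_im]
    ring
  simp_rw [e]
  refine ⟨a1.add b1, ?_⟩
  rw [integral_add a1 b1, a2, b2, add_zero]

lemma sym {g : ℂ → ℝ} (hg : Integrable g) (hg0 : ∀ y, 0 ≤ g y) {A : ℝ} (hA : ∀ y, g y ≤ A)
    {ξ : ℂ → ℂ} (hξ : Continuous ξ) {B : ℝ} (hB : ∀ x, ‖ξ x‖ ≤ B) {χ κ : ℂ → ℝ}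
    (hχ : Integrable (fun x => χ x * g x)) (hκ : Integrable (fun x => κ x * g x)) {C : ℝ}
    (hC : ∀ x y, x ≠ y → |((ξ x - ξ y) * (x - y)⁻¹).re - χ x * χ y| ≤ C * (κ x + κ y)) :
    Integrable (fun x => g x * (cau g x * ξ x).re) ∧
    |(∫ x, g x * (cau g x * ξ x).re) - (∫ x, χ x * g x) ^ 2 / 2| ≤
      C * (∫ x, g x) * ∫ x, κ x * g x := by
  have hB0 : 0 ≤ B := (norm_nonneg _).trans (hB 0)
  set K : ℂ × ℂ → ℝ := fun p => g p.1 * (g p.2 * (ξ p.1 * (p.1 - p.2)⁻¹).re) with hK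
  have hKm : AEStronglyMeasurable K (volume.prod volume) := by
    refine hg.1.comp_fst.mul (hg.1.comp_snd.mul ?_)
    have := hξ.measurable
    exact (by fun_prop : Measurable fun p : ℂ × ℂ => (ξ p.1 * (p.1 - p.2)⁻¹).re).aestronglyMeasurable
  have hre : ∀ x t, g t * (ξ x * (x - t)⁻¹).re = ((g t : ℂ) * (x - t)⁻¹ * ξ x).re := by
    intro x t
    rw [mul_assoc, Complex.re_ofReal_mul, mul_comm (ξ x)]
  have hin : ∀ x, Integrable (fun t => g t * (ξ x * (x - t)⁻¹).re) := by
    intro x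
    simp_rw [hre]
    exact ((cau_integrable hg hg0 hA x).mul_const _).re
  have e1 : ∀ x, ∫ t, K (x, t) = g x * (cau g x * ξ x).re := by
    intro x
    simp only [hK]
    rw [integral_const_mul]
    congr 1
    simp_rw [hre]
    rw [cau, ← integral_mul_const]
    exact integral_re ((cau_integrable hg hg0 hA x).mul_const _)
  have hKi : Integrable K (volume.prod volume) := by
    rw [integrable_prod_iff hKm]
    refine ⟨Eventually.of_forall fun x => (hin x).const_mul (g x), ?_⟩
    refine (hg.const_mul (B * (2 * π * A + ∫ y, g y))).mono' hKm.norm.integral_prod_right' ?_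
    refine Eventually.of_forall fun x => ?_
    rw [Real.norm_of_nonneg (integral_nonneg fun _ => norm_nonneg _)]
    have h := (riesz1 (z := x) one_pos hg hg0 (A := A) (fun y _ => hA y))
    have h2 : ∫ t, ‖K (x, t)‖ ≤ ∫ t, (g x * B) * (g t * ‖x - t‖⁻¹) := by
      refine integral_mono ((hin x).const_mul (g x)).norm (h.1.const_mul _) fun t => ?_
      simp only [hK]
      rw [norm_mul, norm_mul, Real.norm_of_nonneg (hg0 x), Real.norm_of_nonneg (hg0 t)]
      have h3 : ‖(ξ x * (x - t)⁻¹).re‖ ≤ B * ‖x - t‖⁻¹ := by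
        refine (Complex.abs_re_le_norm _).trans ?_
        rw [norm_mul, norm_inv]
        gcongr
        exact hB x
      calc _ ≤ g x * (g t * (B * ‖x - t‖⁻¹)) :=
            mul_le_mul_of_nonneg_left (mul_le_mul_of_nonneg_left h3 (hg0 t)) (hg0 x)
        _ = _ := by ring
    rw [integral_const_mul] at h2
    refine h2.trans ?_
    have h4 := h.2
    simp only [mul_one, inv_one, one_mul] at h4
    calc _ ≤ (g x * B) * (2 * π * A + ∫ y, g y) :=
          mul_le_mul_of_nonneg_left h4 (mul_nonneg (hg0 x) hB0)
      _ = _ := by ring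
  have i1 := hKi.integral_prod_left
  simp_rw [e1] at i1
  refine ⟨i1, ?_⟩
  have e2 : ∫ p, K p ∂(volume.prod volume) = ∫ x, g x * (cau g x * ξ x).re := by
    rw [integral_prod _ hKi]; simp_rw [e1]
  have e3 : ∫ p, K p ∂(volume.prod volume) = ∫ p : ℂ × ℂ, K p.swap ∂(volume.prod volume) :=
    (integral_prod_swap K).symm
  have hKs : Integrable (fun p : ℂ × ℂ => K p.swap) (volume.prod volume) := hKi.swap
  have hχχ := hχ.mul_prod hχ
  have hb1 := hκ.mul_prod hg
  have hb2 := hg.mul_prod hκ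
  have a3 : ∀ᵐ p : ℂ × ℂ ∂(volume.prod volume), p.1 ≠ p.2 := by
    rw [Measure.ae_prod_iff_ae_ae]
    · exact Eventually.of_forall fun y => ae_ne y
    · exact (measurableSet_eq_fun measurable_fst measurable_snd).compl
  have hp : ∀ᵐ p : ℂ × ℂ ∂(volume.prod volume),
      ‖(K p + K p.swap) - (χ p.1 * g p.1) * (χ p.2 * g p.2)‖ ≤
      C * ((κ p.1 * g p.1) * g p.2 + g p.1 * (κ p.2 * g p.2)) := by
    filter_upwards [a3] with p h3
    simp only [hK, Prod.fst_swap, Prod.snd_swap]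
    have h4 : (p.2 - p.1)⁻¹ = - (p.1 - p.2)⁻¹ := by rw [← neg_sub, inv_neg]
    have h5 : g p.1 * (g p.2 * (ξ p.1 * (p.1 - p.2)⁻¹).re) +
        g p.2 * (g p.1 * (ξ p.2 * (p.2 - p.1)⁻¹).re) - χ p.1 * g p.1 * (χ p.2 * g p.2) =
        g p.1 * g p.2 * (((ξ p.1 - ξ p.2) * (p.1 - p.2)⁻¹).re - χ p.1 * χ p.2) := by
      rw [h4, sub_mul, Complex.sub_re, mul_neg, Complex.neg_re]; ring
    rw [h5, norm_mul, Real.norm_of_nonneg (mul_nonneg (hg0 _) (hg0 _)), Real.norm_eq_abs]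
    calc _ ≤ g p.1 * g p.2 * (C * (κ p.1 + κ p.2)) :=
          mul_le_mul_of_nonneg_left (hC _ _ h3) (mul_nonneg (hg0 _) (hg0 _))
      _ = _ := by ring
  have h6 := norm_integral_le_of_norm_le ((hb1.add hb2).const_mul C) hp
  have e7 : ∫ p : ℂ × ℂ, ((K p + K p.swap) - (χ p.1 * g p.1) * (χ p.2 * g p.2)) ∂(volume.prod volume)
      = 2 * (∫ x, g x * (cau g x * ξ x).re) - (∫ x, χ x * g x) ^ 2 := by
    rw [integral_sub (f := fun p => K p + K p.swap) (hKi.add hKs) hχχ, integral_add hKi hKs, ← e3, e2,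
      integral_prod_mul (fun x => χ x * g x) (fun x => χ x * g x)]
    ring
  have e8 : ∫ p : ℂ × ℂ, C * ((κ p.1 * g p.1) * g p.2 + g p.1 * (κ p.2 * g p.2)) ∂(volume.prod volume)
      = 2 * (C * (∫ x, g x) * ∫ x, κ x * g x) := by
    rw [integral_const_mul, integral_add hb1 hb2, integral_prod_mul (fun x => κ x * g x) g,
      integral_prod_mul g (fun x => κ x * g x)]
    ring
  change _ ≤ ∫ p : ℂ × ℂ, C * ((κ p.1 * g p.1) * g p.2 + g p.1 * (κ p.2 * g p.2)) ∂(volume.prod volume) at h6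
  rw [e7, e8, Real.norm_eq_abs] at h6
  have h9 : 2 * (∫ x, g x * (cau g x * ξ x).re) - (∫ x, χ x * g x) ^ 2 =
      2 * ((∫ x, g x * (cau g x * ξ x).re) - (∫ x, χ x * g x) ^ 2 / 2) := by ring
  rw [h9, abs_mul, abs_two] at h6
  linarith

def kp (R : ℝ) : ℂ → ℝ := (ball (0:ℂ) R).indicator fun z => ‖z‖

lemma kp_nonneg (R : ℝ) (z : ℂ) : 0 ≤ kp R z := Set.indicator_nonneg (fun z _ => norm_nonneg z) z
lemma kp_in {R : ℝ} {z : ℂ} (h : ‖z‖ < R) : kp R z = ‖z‖ :=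
  Set.indicator_of_mem (by simpa using h) _

lemma cutoff {R : ℝ} (hR : 0 < R) : ∃ (χ : ℂ → ℝ) (C : ℝ), ContDiff ℝ 1 χ ∧ 0 < C ∧
    (∀ z, 0 ≤ χ z) ∧ (∀ z, χ z ≤ 1) ∧ (∀ z, ‖z‖ ≤ R / 4 → χ z = 1) ∧
    tsupport χ ⊆ closedBall 0 (R / 2) ∧ HasCompactSupport χ ∧
    (∀ z, ‖(χ z : ℂ) * z‖ ≤ kp R z) ∧ (∀ z, |fderiv ℝ χ z z| ≤ C * kp R z) ∧
    (∀ z w, z ≠ w → |(((χ z : ℂ) * z - (χ w : ℂ) * w) * (z - w)⁻¹).re - χ z * χ w| ≤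
      C * (kp R z + kp R w)) := by
  let b : ContDiffBump (0:ℂ) := ⟨R / 4, R / 2, by positivity, by linarith⟩
  have hb : ContDiff ℝ 1 (b : ℂ → ℝ) := b.contDiff
  have hsupp : tsupport (b : ℂ → ℝ) = closedBall 0 (R / 2) := b.tsupport_eq
  have hcs : HasCompactSupport (b : ℂ → ℝ) := b.hasCompactSupport
  have hout : ∀ z, R / 2 < ‖z‖ → b z = 0 := fun z hz => by
    apply b.zero_of_le_dist
    rw [dist_zero_right]; exact hz.le
  have hin : ∀ z, ‖z‖ ≤ R / 4 → b z = 1 := fun z hz => by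
    apply b.one_of_mem_closedBall
    rw [mem_closedBall, dist_zero_right]; exact hz
  have hξ : ContDiff ℝ 1 (fun z : ℂ => (b z : ℂ) * z) :=
    (Complex.ofRealCLM.contDiff.comp hb).mul contDiff_id
  have hξs : HasCompactSupport (fun z : ℂ => (b z : ℂ) * z) := by
    have : HasCompactSupport (fun z : ℂ => (b z : ℂ)) := hcs.comp_left (g := fun t : ℝ => (t : ℂ)) (by simp)
    exact this.mul_right
  obtain ⟨Λ1, h1⟩ := hb.lipschitzWith_of_hasCompactSupport hcs (by norm_num)
  obtain ⟨Λ2, h2⟩ := hξ.lipschitzWith_of_hasCompactSupport hξs (by norm_num)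
  set C : ℝ := Λ1 + (Λ2 + 1) * (4 / R) + 2 / R with hC
  have hΛ1 : (0:ℝ) ≤ Λ1 := Λ1.2
  have hΛ2 : (0:ℝ) ≤ Λ2 := Λ2.2
  have hC0 : 0 < C := by positivity
  have hξk : ∀ z, ‖(b z : ℂ) * z‖ ≤ kp R z := by
    intro z
    rw [norm_mul, Complex.norm_real, Real.norm_of_nonneg b.nonneg]
    by_cases hz : ‖z‖ < R
    · rw [kp_in hz]
      exact mul_le_of_le_one_left (norm_nonneg _) b.le_one
    · rw [hout z (by linarith), zero_mul]; exact kp_nonneg R z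
  refine ⟨b, C, hb, hC0, fun z => b.nonneg, fun z => b.le_one, hin, hsupp.le, hcs, hξk, ?_, ?_⟩
  · intro z
    by_cases hz : ‖z‖ < R
    · rw [kp_in hz]
      have h3 : ‖fderiv ℝ b z‖ ≤ Λ1 := norm_fderiv_le_of_lipschitz ℝ h1
      have h4 := (fderiv ℝ b z).le_opNorm z
      rw [Real.norm_eq_abs] at h4
      refine h4.trans ?_
      gcongr
      refine h3.trans ?_
      have : 0 ≤ (Λ2 + 1 : ℝ) * (4 / R) + 2 / R := by positivity
      rw [hC]; linarith
    · have : z ∉ tsupport (b : ℂ → ℝ) := by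
        rw [hsupp, mem_closedBall, dist_zero_right]; linarith
      rw [(notMem_tsupport_iff_eventuallyEq.1 this).fderiv_eq]
      have := kp_nonneg R z
      have : 0 ≤ C * kp R z := by positivity
      simpa using this
  · have key : ∀ z w, z ≠ w → R / 4 < ‖z‖ →
        |(((b z : ℂ) * z - (b w : ℂ) * w) * (z - w)⁻¹).re - b z * b w| ≤
        C * (kp R z + kp R w) := by
      intro z w hzw hz
      have hn : 0 < ‖z - w‖ := norm_pos_iff.2 (sub_ne_zero.2 hzw)
      have kz := kp_nonneg R z
      have kw := kp_nonneg R w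
      have hre : |(((b z : ℂ) * z - (b w : ℂ) * w) * (z - w)⁻¹).re| ≤
          ‖(b z : ℂ) * z - (b w : ℂ) * w‖ * ‖z - w‖⁻¹ := by
        refine (Complex.abs_re_le_norm _).trans ?_
        rw [norm_mul, norm_inv]
      by_cases hzR : ‖z‖ < R
      · have h3 := h2.dist_le_mul z w
        rw [dist_eq_norm, dist_eq_norm] at h3
        have h4 : ‖(b z : ℂ) * z - (b w : ℂ) * w‖ * ‖z - w‖⁻¹ ≤ Λ2 := by
          rw [← div_eq_mul_inv, div_le_iff₀ hn]; exact h3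
        have h5 : |b z * b w| ≤ 1 := by
          rw [abs_mul, abs_of_nonneg b.nonneg, abs_of_nonneg b.nonneg]
          exact mul_le_one₀ b.le_one b.nonneg b.le_one
        have h6 : (Λ2 + 1 : ℝ) ≤ (Λ2 + 1) * (4 / R) * kp R z := by
          rw [kp_in hzR]
          have : 1 ≤ 4 / R * ‖z‖ := by
            rw [div_mul_eq_mul_div, le_div_iff₀ hR]; linarith
          rw [mul_assoc]
          exact le_mul_of_one_le_right (by positivity) this
        have h7 : (Λ2 + 1) * (4 / R) * kp R z ≤ C * kp R z := by
          gcongr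
          have : 0 ≤ (Λ1 : ℝ) + 2 / R := by positivity
          rw [hC]; linarith
        have h8 : 0 ≤ C * kp R w := by positivity
        refine (abs_sub _ _).trans ?_
        linarith
      · rw [hout z (by linarith)] at hre ⊢
        simp only [Complex.ofReal_zero, zero_mul, zero_sub, sub_zero, norm_neg] at hre ⊢
        refine hre.trans ?_
        by_cases hw : R / 2 < ‖w‖
        · rw [hout w hw]
          simp only [Complex.ofReal_zero, zero_mul, norm_zero]
          positivity
        · push Not at hw hzR
          have h3 : R / 2 ≤ ‖z - w‖ := by
            have := norm_sub_norm_le z w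
            linarith
          have h4 : ‖z - w‖⁻¹ ≤ 2 / R := by
            refine (inv_anti₀ (by positivity) h3).trans (le_of_eq ?_)
            rw [inv_div]
          calc _ ≤ kp R w * (2 / R) := mul_le_mul (hξk w) h4 (by positivity) kw
            _ ≤ C * kp R w := by
              rw [mul_comm]
              gcongr
              have : 0 ≤ (Λ1 : ℝ) + (Λ2 + 1) * (4 / R) := by positivity
              rw [hC]; linarith
            _ ≤ _ := by
              have : 0 ≤ C * kp R z := by positivity
              linarith
    intro z w hzw
    by_cases hz : R / 4 < ‖z‖
    · exact key z w hzw hz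
    · by_cases hw : R / 4 < ‖w‖
      · have := key w z hzw.symm hw
        have e : ((b w : ℂ) * w - (b z : ℂ) * z) * (w - z)⁻¹ =
            ((b z : ℂ) * z - (b w : ℂ) * w) * (z - w)⁻¹ := by
          rw [← neg_sub z w, inv_neg]; ring
        rw [e, mul_comm (b w), add_comm (kp R w)] at this
        exact this
      · push Not at hz hw
        rw [hin z hz, hin w hw]
        have := kp_nonneg R z
        have := kp_nonneg R w
        have h3 : 0 ≤ C * (kp R z + kp R w) := by positivity
        have h4 : z - w ≠ 0 := sub_ne_zero.2 hzw
        simpa [h4] using h3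

end BU

end

section
open MeasureTheory Real Filter Topology Metric Bornology
open scoped RealInnerProductSpace

namespace BU
namespace Sq
variable {m : ℕ} (S : Sq m)

lemma pot_fderiv (k : ℕ) (x : ℂ) :
    HasFDerivAt (Pot (S.f k)) (-(1 / (2 * π)) • reMul (cau (S.f k) x)) x := by
  obtain ⟨A, hA⟩ := S.f_bdd k
  refine hasFDerivAt_of_pot (S.f_int k) (S.f0 k) (fun y => (le_abs_self _).trans (hA y)) ?_ x
  intro z z'
  unfold Pot
  rw [← mul_sub, ← integral_sub (S.logf_int k z') (S.logf_int k z)]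
  congr 2; funext y; ring

lemma V_diff {x : ℂ} (hx : x ∈ S.Ω) : DifferentiableAt ℝ S.V x :=
  (S.hVd.contDiffAt ((S.hP 0).hopen.mem_nhds hx)).differentiableAt (by norm_num)

lemma h_diff (k : ℕ) {x : ℂ} (hx : x ∈ S.Ω) : DifferentiableAt ℝ (S.h k) x :=
  (((S.hP k).hv2.contDiffAt ((S.hP 0).hopen.mem_nhds hx)).differentiableAt (by norm_num)).sub
    (S.pot_fderiv k x).differentiableAt

lemma f_contDiff (k : ℕ) : ContDiffOn ℝ 1 (S.f k) S.Ω := by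
  have h1 : ContDiffOn ℝ 1 (fun x => S.lam k * S.V x * Real.exp (S.v k x)) S.Ω :=
    (contDiffOn_const.mul S.hVd).mul (((S.hP k).hv2.of_le (by norm_num)).exp)
  exact h1.congr fun x hx => S.f_in hx

lemma f_fderiv (k : ℕ) {x : ℂ} (hx : x ∈ S.Ω) (ζ : ℂ) :
    fderiv ℝ (S.f k) x ζ = S.f k x * ((fderiv ℝ S.V x ζ / S.V x + fderiv ℝ (S.h k) x ζ) -
      1 / (2 * π) * (cau (S.f k) x * ζ).re) := by
  have hΩ := (S.hP 0).hopen.mem_nhds hx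
  have hV := (S.hP k).hVpos x (subset_closure hx)
  have h1 := (S.V_diff hx).hasFDerivAt
  have h2 : HasFDerivAt (S.v k) (fderiv ℝ (S.h k) x + (-(1 / (2 * π)) • reMul (cau (S.f k) x))) x := by
    have := (S.h_diff k hx).hasFDerivAt.add (S.pot_fderiv k x)
    refine this.congr_of_eventuallyEq (Eventually.of_forall fun y => ?_)
    change S.v k y = S.v k y - Pot (S.f k) y + Pot (S.f k) y
    ring
  have h3 := (h1.const_mul (S.lam k)).mul h2.exp
  have h4 : S.f k =ᶠ[𝓝 x] (fun x => S.lam k * S.V x) * fun x => Real.exp (S.v k x) := by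
    filter_upwards [hΩ] with y hy
    exact S.f_in hy
  rw [h4.fderiv_eq, h3.fderiv, S.f_in hx]
  simp only [add_apply, smul_apply, smul_eq_mul, reMul_apply]
  field_simp
  ring

lemma grad_bd : ∃ C : ℝ, 0 < C ∧ ∀ᶠ k in atTop, ∀ j, ∀ x ∈ ball (S.xp j k) S.R, ∀ ζ,
    |fderiv ℝ S.V x ζ / S.V x + fderiv ℝ (S.h k) x ζ| ≤ C * ‖ζ‖ := by
  have hR := S.hR
  obtain ⟨C, hC, hb⟩ := S.hbdd
  set Q : Set ℂ := ⋃ j, closedBall (S.xs j) (2 * S.R) with hQ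
  have hQc : IsCompact Q := isCompact_iUnion fun j => isCompact_closedBall _ _
  have hQΩ : Q ⊆ S.Ω := Set.iUnion_subset fun j =>
    (closedBall_subset_closedBall (by linarith)).trans (S.hball j)
  obtain ⟨A, hA⟩ := hQc.exists_bound_of_continuousOn
    ((S.hVd.continuousOn_fderiv_of_isOpen (S.hP 0).hopen (by norm_num)).mono hQΩ)
  refine ⟨|A| / S.a + 8 * C / S.R, by have := S.ha; positivity, ?_⟩
  filter_upwards [hb] with k hk j x hx ζ
  rw [mem_ball, dist_eq_norm] at hx
  have hn := S.hnear j k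
  have hxQ : x ∈ Q := by
    refine Set.mem_iUnion.2 ⟨j, ?_⟩
    rw [mem_closedBall, dist_eq_norm]
    have := norm_sub_le_norm_sub_add_norm_sub x (S.xp j k) (S.xs j)
    linarith
  have hxΩ := hQΩ hxQ
  have hcb : closedBall x S.R ⊆ S.Ω := by
    refine (closedBall_subset_closedBall' ?_).trans (S.xp_ball j k)
    rw [dist_eq_norm]; linarith
  have h1 : ‖fderiv ℝ (S.h k) x‖ ≤ 8 * C / S.R := by
    refine (S.h_diff k hxΩ).hasFDerivAt.le_of_lip' (by positivity) ?_
    filter_upwards [closedBall_mem_nhds x (by positivity : 0 < S.R / 4)] with y hy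
    rw [mem_closedBall, dist_eq_norm] at hy
    exact harnack_bdd (S.h_mv k) hR hcb (fun z hz => hk z (subset_closure (hcb hz))) hy
  have h2 : |fderiv ℝ (S.h k) x ζ| ≤ 8 * C / S.R * ‖ζ‖ :=
    ((fderiv ℝ (S.h k) x).le_opNorm ζ).trans (by gcongr)
  have h3 : |fderiv ℝ S.V x ζ| ≤ |A| * ‖ζ‖ :=
    ((fderiv ℝ S.V x).le_opNorm ζ).trans (by gcongr; exact (hA x hxQ).trans (le_abs_self A))
  have ha := S.ha
  have hV := S.haV x hxΩ
  have h4 : |fderiv ℝ S.V x ζ / S.V x| ≤ |A| / S.a * ‖ζ‖ := by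
    rw [abs_div, abs_of_pos (ha.trans_le hV), div_mul_eq_mul_div]
    gcongr
  calc _ ≤ _ := abs_add_le _ _
    _ ≤ |A| / S.a * ‖ζ‖ + 8 * C / S.R * ‖ζ‖ := add_le_add h4 h2
    _ = _ := by ring

lemma kp_eq (j : Fin m) (k : ℕ) : Integrable (fun x => kp S.R (x - S.xp j k) * S.f k x) ∧
    ∫ x, kp S.R (x - S.xp j k) * S.f k x =
    ∫ x in ball (S.xp j k) S.R, ‖x - S.xp j k‖ * S.f k x := by
  have hR := S.hR
  constructor
  · refine ((S.f_int k).const_mul S.R).mono' ?_ (Eventually.of_forall fun x => ?_)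
    · refine AEStronglyMeasurable.mul ?_ (S.f_int k).1
      have h1 : Measurable (kp S.R) := measurable_norm.indicator measurableSet_ball
      exact (h1.comp (measurable_id.sub_const _)).aestronglyMeasurable
    · have h0 := S.f0 k x
      have h1 := kp_nonneg S.R (x - S.xp j k)
      rw [Real.norm_of_nonneg (by positivity)]
      gcongr
      by_cases h : ‖x - S.xp j k‖ < S.R
      · rw [kp_in h]; exact h.le
      · unfold kp
        rw [Set.indicator_of_notMem (by simpa using h)]; exact hR.le
  · rw [← integral_indicator measurableSet_ball]
    congr 1; funext x
    by_cases h : ‖x - S.xp j k‖ < S.R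
    · rw [kp_in h, Set.indicator_of_mem (by rw [mem_ball, dist_eq_norm]; exact h)]
    · unfold kp
      rw [Set.indicator_of_notMem (by simpa using h),
        Set.indicator_of_notMem (by rw [mem_ball, dist_eq_norm]; exact h), zero_mul]

lemma poh : ∃ C : ℝ, 0 < C ∧ ∀ᶠ k in atTop, ∀ j,
    |(∫ y in ball (S.xp j k) S.R, S.f k y) - 8 * π| ≤ C * S.del j k := by
  have hR := S.hR
  have hpi := Real.pi_pos
  have hM0 := S.hM0
  obtain ⟨χ, C, hχ, hC, hχ0, hχ1, hχin, hχs, hχc, hξk, hχd, hsym⟩ := cutoff hR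
  obtain ⟨Cg, hCg, hg⟩ := S.grad_bd
  obtain ⟨Ck, hCk, hk⟩ := S.kap
  obtain ⟨L, hL, hc⟩ := S.conc Real.pi_pos
  set C1 := Cg + C + 1 / (2 * π) * (C * S.M) with hC1
  refine ⟨(4 * C1 * Ck) + 4 / S.R * Ck, by positivity, ?_⟩
  filter_upwards [hg, hk, hc, S.delL_ev L (S.R / 4) (by positivity)] with k hg hk hc hL4 j
  set c := S.xp j k with hcdef
  have hd := S.del_pos j k
  obtain ⟨hκi, hκe⟩ := S.kp_eq j k
  have hκ := hk j
  rw [← hκe, ← hcdef] at hκ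
  rw [← hcdef] at hκi
  set I := ∫ x, kp S.R (x - c) * S.f k x with hI
  have hI0 : 0 ≤ I := integral_nonneg fun x => mul_nonneg (kp_nonneg _ _) (S.f0 k x)
  obtain ⟨A, hA⟩ := S.f_bdd k
  have hA' : ∀ y, S.f k y ≤ A := fun y => (le_abs_self _).trans (hA y)
  have hsubc : ContDiff ℝ 1 (fun x : ℂ => x - c) := contDiff_id.sub contDiff_const
  have hη : ContDiff ℝ 1 (fun x => χ (x - c)) := hχ.comp hsubc
  have hts : tsupport (fun x => χ (x - c)) ⊆ closedBall c (S.R / 2) := by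
    refine closure_minimal (fun x hx => ?_) isClosed_closedBall
    have := hχs (subset_tsupport _ (show x - c ∈ Function.support χ from hx))
    rw [mem_closedBall, dist_zero_right] at this
    rw [mem_closedBall, dist_eq_norm]; exact this
  have hηs : HasCompactSupport (fun x => χ (x - c)) :=
    HasCompactSupport.of_support_subset_isCompact (isCompact_closedBall c (S.R / 2))
      ((subset_tsupport _).trans hts)
  have htΩ : tsupport (fun x => χ (x - c)) ⊆ S.Ω :=
    hts.trans ((closedBall_subset_closedBall (by linarith)).trans (S.xp_ball j k))
  obtain ⟨hPi, hP0⟩ := poh_core (S.hP 0).hopen (S.f_contDiff k) hη hηs htΩ c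
  have hχf : Integrable (fun x => χ (x - c) * S.f k x) := by
    refine (S.f_int k).mono' (hη.continuous.aestronglyMeasurable.mul (S.f_int k).1)
      (Eventually.of_forall fun x => ?_)
    have h0 := S.f0 k x
    have h1 := hχ0 (x - c)
    rw [Real.norm_of_nonneg (by positivity)]
    exact mul_le_of_le_one_left h0 (hχ1 _)
  have hkR : ∀ z, kp S.R z ≤ S.R := by
    intro z
    by_cases h : ‖z‖ < S.R
    · rw [kp_in h]; exact h.le
    · unfold kp
      rw [Set.indicator_of_notMem (by simpa using h)]; exact hR.le
  obtain ⟨hsi, hse⟩ := sym (S.f_int k) (S.f0 k) hA' (ξ := fun x => (χ (x - c) : ℂ) * (x - c))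
    ((Complex.continuous_ofReal.comp hη.continuous).mul hsubc.continuous)
    (B := S.R) (fun x => (hξk (x - c)).trans (hkR _))
    (χ := fun x => χ (x - c)) (κ := fun x => kp S.R (x - c)) hχf hκi (C := C)
    (fun x y hxy => by
      have := hsym (x - c) (y - c) (fun h => hxy (by simpa using h))
      rwa [sub_sub_sub_cancel_right] at this)
  set σ := ∫ x, χ (x - c) * S.f k x with hσ
  set J := ∫ x, S.f k x * (cau (S.f k) x * ((χ (x - c) : ℂ) * (x - c))).re with hJ
  rw [← hI] at hse
  -- pointwise estimate
  have hfd : ∀ x, fderiv ℝ (fun x => χ (x - c)) x = fderiv ℝ χ (x - c) := fun x =>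
    fderiv_comp_sub c
  have hpt : ∀ x, ‖(fderiv ℝ (S.f k) x ((χ (x - c) : ℂ) * (x - c)) +
      S.f k x * (2 * χ (x - c) + fderiv ℝ (fun x => χ (x - c)) x (x - c))) -
      (2 * (χ (x - c) * S.f k x) - 1 / (2 * π) * (S.f k x *
        (cau (S.f k) x * ((χ (x - c) : ℂ) * (x - c))).re))‖ ≤
      (Cg + C) * (kp S.R (x - c) * S.f k x) := by
    intro x
    rw [hfd, Real.norm_eq_abs]
    have hf0 := S.f0 k x
    have hk0 := kp_nonneg S.R (x - c)
    have h1 := hχd (x - c)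
    have h2 := hξk (x - c)
    by_cases hx : x ∈ ball c S.R
    · have hxΩ : x ∈ S.Ω := S.xp_ball j k (ball_subset_closedBall
        (ball_subset_ball (by linarith) hx))
      rw [S.f_fderiv k hxΩ]
      have h3 := hg j x hx ((χ (x - c) : ℂ) * (x - c))
      set ζ := (χ (x - c) : ℂ) * (x - c)
      set P := fderiv ℝ S.V x ζ / S.V x + fderiv ℝ (S.h k) x ζ
      set Q := fderiv ℝ χ (x - c) (x - c)
      have e : S.f k x * (P - 1 / (2 * π) * (cau (S.f k) x * ζ).re) +
          S.f k x * (2 * χ (x - c) + Q) - (2 * (χ (x - c) * S.f k x) -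
          1 / (2 * π) * (S.f k x * (cau (S.f k) x * ζ).re)) = S.f k x * (P + Q) := by ring
      rw [e, abs_mul, abs_of_nonneg hf0]
      have h4 : |P + Q| ≤ (Cg + C) * kp S.R (x - c) := by
        refine (abs_add_le _ _).trans ?_
        have : Cg * ‖ζ‖ ≤ Cg * kp S.R (x - c) := by gcongr
        linarith
      calc _ ≤ S.f k x * ((Cg + C) * kp S.R (x - c)) := by gcongr
        _ = _ := by ring
    · have hk1 : kp S.R (x - c) = 0 := by
        unfold kp
        rw [mem_ball, dist_eq_norm] at hx
        exact Set.indicator_of_notMem (by simpa using hx) _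
      rw [hk1] at h1 h2 ⊢
      have h3 : (χ (x - c) : ℂ) * (x - c) = 0 := norm_le_zero_iff.1 h2
      have h4 : fderiv ℝ χ (x - c) (x - c) = 0 := by
        rw [mul_zero] at h1; exact abs_nonpos_iff.1 h1
      rw [h3, h4]
      simp only [map_zero, mul_zero, Complex.zero_re, sub_zero, add_zero, zero_add, zero_mul]
      rw [show S.f k x * (2 * χ (x - c)) - 2 * (χ (x - c) * S.f k x) = 0 by ring, abs_zero]
  have h5 := norm_integral_le_of_norm_le (hκi.const_mul (Cg + C)) (Eventually.of_forall hpt)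
  have i2 : Integrable (fun x => 2 * (χ (x - c) * S.f k x) - 1 / (2 * π) * (S.f k x *
        (cau (S.f k) x * ((χ (x - c) : ℂ) * (x - c))).re)) :=
    (hχf.const_mul 2).sub (hsi.const_mul _)
  rw [integral_sub hPi i2, hP0, integral_sub (hχf.const_mul 2) (hsi.const_mul _),
    integral_const_mul, integral_const_mul, integral_const_mul, ← hσ, ← hJ, ← hI,
    Real.norm_eq_abs, abs_le] at h5
  rw [abs_le] at hse
  have hMf := S.f_mass k
  have hCM : C * (∫ x, S.f k x) * I ≤ C * S.M * I := by gcongr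
  have h6 : |2 * σ - σ ^ 2 / (4 * π)| ≤ C1 * I := by
    have e : 2 * σ - σ ^ 2 / (4 * π) = (2 * σ - 1 / (2 * π) * J) + 1 / (2 * π) * (J - σ ^ 2 / 2) := by
      field_simp; ring
    have h7 : |1 / (2 * π) * (J - σ ^ 2 / 2)| ≤ 1 / (2 * π) * (C * S.M * I) := by
      rw [abs_mul, abs_of_pos (by positivity : 0 < 1 / (2 * π))]
      gcongr
      exact abs_le.2 ⟨by linarith, by linarith⟩
    rw [e]
    refine (abs_add_le _ _).trans ?_
    have h8 : |2 * σ - 1 / (2 * π) * J| ≤ (Cg + C) * I := abs_le.2 ⟨by linarith, by linarith⟩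
    rw [hC1]
    calc _ ≤ (Cg + C) * I + 1 / (2 * π) * (C * S.M * I) := add_le_add h8 h7
      _ = _ := by ring
  -- lower bound on sigma
  have hσ7 : 7 * π ≤ σ := by
    have h7 := (abs_le.1 (hc.1 j)).1
    have h8 : ∫ y in ball c (S.del j k * L), S.f k y ≤ σ := by
      rw [← integral_indicator measurableSet_ball, hσ]
      refine integral_mono ((S.f_int k).indicator measurableSet_ball) hχf fun x => ?_
      have hf0 := S.f0 k x
      by_cases hx : x ∈ ball c (S.del j k * L)
      · rw [Set.indicator_of_mem hx]
        rw [mem_ball, dist_eq_norm] at hx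
        have := hL4 j
        simp only []
        rw [hχin _ (by linarith), one_mul]
      · rw [Set.indicator_of_notMem hx]
        exact mul_nonneg (hχ0 _) hf0
    linarith
  have h9 : |σ - 8 * π| ≤ 4 * C1 * I := by
    have e : 2 * σ - σ ^ 2 / (4 * π) = -(σ / (4 * π)) * (σ - 8 * π) := by field_simp; ring
    have hσ0 : 0 ≤ σ := by linarith
    rw [e, abs_mul, abs_neg, abs_of_nonneg (by positivity : 0 ≤ σ / (4 * π))] at h6
    have : 1 / 4 ≤ σ / (4 * π) := by
      rw [div_le_div_iff₀ (by norm_num) (by positivity)]; linarith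
    have h10 : 1 / 4 * |σ - 8 * π| ≤ σ / (4 * π) * |σ - 8 * π| := by gcongr
    linarith
  have h11 : |(∫ y in ball c S.R, S.f k y) - σ| ≤ 4 / S.R * I := by
    rw [← integral_indicator measurableSet_ball, hσ,
      ← integral_sub ((S.f_int k).indicator measurableSet_ball) hχf, hI, ← integral_const_mul]
    have hp : ∀ x, ‖(ball c S.R).indicator (S.f k) x - χ (x - c) * S.f k x‖ ≤
        4 / S.R * (kp S.R (x - c) * S.f k x) := ?_
    · exact norm_integral_le_of_norm_le (hκi.const_mul _) (Eventually.of_forall hp)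
    intro x
    have hf0 := S.f0 k x
    have hk0 := kp_nonneg S.R (x - c)
    have h1 := hχ0 (x - c)
    have h2 := hχ1 (x - c)
    by_cases hx4 : ‖x - c‖ ≤ S.R / 4
    · rw [Set.indicator_of_mem (by rw [mem_ball, dist_eq_norm]; linarith), hχin _ hx4, one_mul,
        sub_self, norm_zero]
      positivity
    · push Not at hx4
      by_cases hx : ‖x - c‖ < S.R
      · rw [Set.indicator_of_mem (by rw [mem_ball, dist_eq_norm]; exact hx), kp_in hx,
          Real.norm_of_nonneg (by nlinarith)]
        have h3 : 1 ≤ 4 / S.R * ‖x - c‖ := by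
          rw [div_mul_eq_mul_div, le_div_iff₀ hR]; linarith
        nlinarith
      · have h3 : χ (x - c) = 0 := by
          by_contra h
          have := hχs (subset_tsupport _ (show x - c ∈ Function.support χ from h))
          rw [mem_closedBall, dist_zero_right] at this
          linarith
        rw [Set.indicator_of_notMem (by rw [mem_ball, dist_eq_norm]; exact hx), h3, zero_mul,
          sub_zero, norm_zero]
        positivity
  have h12 : (∫ y in ball c S.R, S.f k y) - 8 * π =
      ((∫ y in ball c S.R, S.f k y) - σ) + (σ - 8 * π) := by ring
  rw [h12]
  have hC10 : 0 ≤ C1 := by positivity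
  calc _ ≤ _ := abs_add_le _ _
    _ ≤ 4 / S.R * I + 4 * C1 * I := add_le_add h11 h9
    _ = (4 / S.R + 4 * C1) * I := by ring
    _ ≤ (4 / S.R + 4 * C1) * (Ck * S.del j k) := by gcongr
    _ = _ := by ring

end Sq
end BU

end

section
open MeasureTheory Real Filter Topology Metric Bornology
open scoped RealInnerProductSpace

namespace BU
namespace Sq
variable {m : ℕ} (S : Sq m)

lemma tl_cont {s : ℝ} (hs : 0 < s) (y : ℂ) : Continuous (fun x => tl x s y) := by
  unfold tl
  refine Continuous.log (by fun_prop) fun x => ?_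
  exact (hs.trans_le (le_max_right _ _)).ne'

lemma tl_lim (j : Fin m) : Tendsto (fun k => ∫ y, tl (S.xp j k) S.R y * S.f k y) atTop
    (𝓝 (8 * π * ∑ i, tl (S.xs j) S.R (S.xs i))) := by
  have hR := S.hR
  have hD := S.hD1
  have h1 : Tendsto (fun k => 8 * π * ∑ i, tl (S.xp j k) S.R (S.xs i)) atTop
      (𝓝 (8 * π * ∑ i, tl (S.xs j) S.R (S.xs i))) := by
    refine Tendsto.const_mul _ (tendsto_finsetSum _ fun i _ => ?_)
    exact ((tl_cont hR (S.xs i)).tendsto _).comp (S.hlim j)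
  have h2 : Tendsto (fun k => (∫ y, tl (S.xp j k) S.R y * S.f k y) -
      8 * π * ∑ i, tl (S.xp j k) S.R (S.xs i)) atTop (𝓝 0) := by
    rw [Metric.tendsto_atTop']
    intro ε hε
    have := S.wc (half_pos hε) (Λ := 2 * S.D + 2 / S.R) (by positivity)
    obtain ⟨N, hN⟩ := eventually_atTop.1 this
    refine ⟨N, fun k hk => ?_⟩
    have h3 := (hN k hk.le (tl (S.xp j k) S.R)
      (fun y hy => tl_bdd hR S.hR1 hD (S.hD _ (subset_closure (S.xp_mem j k))) hy)
      (fun y y' => (tl_lip _ hR y y').trans (by gcongr; linarith))).2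
    rw [Real.dist_eq, sub_zero]
    linarith
  simpa using h2.add h1

lemma tl_int (j : Fin m) (k : ℕ) : Integrable (fun y => tl (S.xp j k) S.R y * S.f k y) := by
  have hR := S.hR
  refine ((S.f_int k).const_mul (2 * S.D + 2 / S.R)).mono' ?_ (Eventually.of_forall fun y => ?_)
  · refine AEStronglyMeasurable.mul ?_ (S.f_int k).1
    have : Measurable (tl (S.xp j k) S.R) := by unfold tl; fun_prop
    exact this.aestronglyMeasurable
  · rw [norm_mul, Real.norm_of_nonneg (S.f0 k y)]
    by_cases h : S.f k y = 0
    · simp [h]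
    · exact mul_le_mul_of_nonneg_right (tl_bdd hR S.hR1 S.hD1
        (S.hD _ (subset_closure (S.xp_mem j k))) (S.f_supp k y h)) (S.f0 k y)

lemma pot_xp_eq (j : Fin m) (k : ℕ) : Pot (S.f k) (S.xp j k) + 4 * Real.log (S.del j k) =
    -(1 / (2 * π)) * ((∫ y, tl (S.xp j k) S.R y * S.f k y) +
      (∫ y in ball (S.xp j k) S.R, (Real.log ‖S.xp j k - y‖ - Real.log (S.del j k)) * S.f k y) -
      Real.log S.R * (∫ y in ball (S.xp j k) S.R, S.f k y)) -
    1 / (2 * π) * (((∫ y in ball (S.xp j k) S.R, S.f k y) - 8 * π) * Real.log (S.del j k)) := by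
  have hpi := Real.pi_pos
  have hR := S.hR
  have i1 := (S.logf_int k (S.xp j k)).integrableOn (s := ball (S.xp j k) S.R)
  have i2 := (S.f_int k).integrableOn (s := ball (S.xp j k) S.R)
  have e1 : ∫ y in ball (S.xp j k) S.R, (Real.log ‖S.xp j k - y‖ - Real.log (S.del j k)) * S.f k y =
      (∫ y in ball (S.xp j k) S.R, Real.log ‖S.xp j k - y‖ * S.f k y) -
      Real.log (S.del j k) * ∫ y in ball (S.xp j k) S.R, S.f k y := by
    rw [← integral_const_mul, ← integral_sub i1 (i2.const_mul _)]
    congr 1; funext y; ring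
  have i3 : IntegrableOn (fun y => Real.log ‖S.xp j k - y‖ * S.f k y - Real.log S.R * S.f k y)
      (ball (S.xp j k) S.R) := i1.sub (i2.const_mul _)
  have e2 : ∫ y, Real.log ‖S.xp j k - y‖ * S.f k y = (∫ y, tl (S.xp j k) S.R y * S.f k y) +
      ((∫ y in ball (S.xp j k) S.R, Real.log ‖S.xp j k - y‖ * S.f k y) -
      Real.log S.R * ∫ y in ball (S.xp j k) S.R, S.f k y) := by
    rw [← integral_const_mul, ← integral_sub i1 (i2.const_mul _),
      ← integral_indicator measurableSet_ball, ← integral_add (S.tl_int j k)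
      (i3.integrable_indicator measurableSet_ball)]
    congr 1; funext y
    by_cases hy : y ∈ ball (S.xp j k) S.R
    · rw [Set.indicator_of_mem hy]
      rw [mem_ball, dist_comm, dist_eq_norm] at hy
      unfold tl
      rw [max_eq_right hy.le]; simp
    · rw [Set.indicator_of_notMem hy]
      rw [mem_ball, dist_comm, dist_eq_norm, not_lt] at hy
      unfold tl
      rw [max_eq_left hy, add_zero]
  unfold Pot
  rw [e2, e1]
  field_simp
  ring

lemma log_del (j : Fin m) (k : ℕ) : 2 * Real.log (S.del j k) =
    -(Real.log (S.lam k) + Real.log (S.V (S.xp j k)) + S.v k (S.xp j k)) := by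
  have hl := (S.hP k).hl
  have hV := (S.hP k).hVpos _ (subset_closure (S.xp_mem j k))
  unfold del
  rw [Real.log_inv, Real.log_sqrt (by positivity), Real.log_mul (by positivity) (by positivity),
    Real.log_mul hl.ne' hV.ne', Real.log_exp]
  ring

theorem main (j : Fin m) : ∃ c, Tendsto (fun k => S.v k (S.xp j k) + 2 * Real.log (S.lam k))
    atTop (𝓝 c) := by
  obtain ⟨c1, h1⟩ := S.h_lim j
  obtain ⟨c2, h2⟩ := S.dct j
  have h3 := S.tl_lim j
  obtain ⟨C, hC, hp⟩ := S.poh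
  have hd0 := S.del_tendsto j
  have h4 : Tendsto (fun k => (∫ y in ball (S.xp j k) S.R, S.f k y) - 8 * π) atTop (𝓝 0) := by
    refine squeeze_zero_norm' (hp.mono fun k hk => hk j) ?_
    simpa using hd0.const_mul C
  have h5 : Tendsto (fun k => ((∫ y in ball (S.xp j k) S.R, S.f k y) - 8 * π) *
      Real.log (S.del j k)) atTop (𝓝 0) := by
    have hx := (S.xlog_tendsto 0 C j).norm
    rw [norm_zero] at hx
    refine squeeze_zero_norm' (hp.mono fun k hk => ?_) hx
    have hd := S.del_pos j k
    have := hk j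
    rw [norm_mul, norm_mul, Real.log_inv, zero_add, norm_mul, norm_neg, Real.norm_of_nonneg hd.le,
      Real.norm_of_nonneg hC.le, Real.norm_eq_abs]
    calc _ ≤ C * S.del j k * ‖Real.log (S.del j k)‖ := by gcongr
      _ = _ := by ring
  have h6 : Tendsto (fun k => ∫ y in ball (S.xp j k) S.R, S.f k y) atTop (𝓝 (8 * π)) := by
    simpa using h4.add_const (8 * π)
  have hxs : S.xs j ∈ S.Ω := S.hball j (mem_closedBall_self (by have := S.hR; positivity))
  have h7 : Tendsto (fun k => Real.log (S.V (S.xp j k))) atTop (𝓝 (Real.log (S.V (S.xs j)))) := by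
    refine Tendsto.log ?_ ((S.hP 0).hVpos _ (subset_closure hxs)).ne'
    exact ((S.V_diff hxs).continuousAt.tendsto).comp (S.hlim j)
  have h8 := (((h3.add h2).sub (h6.const_mul (Real.log S.R))).const_mul (-(1 / (2 * π)))).sub
    (h5.const_mul (1 / (2 * π)))
  have h9 := (h1.add h8).neg.sub (h7.const_mul 2)
  refine ⟨_, h9.congr fun k => ?_⟩
  have e1 := S.pot_xp_eq j k
  have e2 := S.log_del j k
  have e3 : S.h k (S.xp j k) = S.v k (S.xp j k) - Pot (S.f k) (S.xp j k) := rfl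
  rw [← e1, e3]
  linarith

end Sq
end BU

end

section
open MeasureTheory Real Filter Topology Metric Bornology
open scoped RealInnerProductSpace

namespace BU

def TT : ℂ ≃ₗᵢ[ℝ] E2 := Complex.orthonormalBasisOneI.repr

lemma TT_one : TT 1 = EuclideanSpace.single (0 : Fin 2) (1:ℝ) := by
  unfold TT; ext i; fin_cases i <;> simp
lemma TT_I : TT Complex.I = EuclideanSpace.single (1 : Fin 2) (1:ℝ) := by
  unfold TT; ext i; fin_cases i <;> simp

lemma TT_fderiv (f : E2 → ℝ) (x e : ℂ) :
    fderiv ℝ (fun z => f (TT z)) x e = fderiv ℝ f (TT x) (TT e) := by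
  have := TT.toContinuousLinearEquiv.comp_right_fderiv (f := f) (x := x)
  change fderiv ℝ (fun z => f (TT z)) x = _ at this
  rw [this]; rfl

lemma TT_lap (f : E2 → ℝ) (x : ℂ) : lapC (fun z => f (TT z)) x = lap f (TT x) := by
  unfold lapC lap
  simp_rw [TT_fderiv]
  rw [TT_fderiv (fun y => fderiv ℝ f y (TT 1)), TT_fderiv (fun y => fderiv ℝ f y (TT Complex.I)),
    TT_one, TT_I, Fin.sum_univ_two]

lemma TT_closure (A : Set E2) : closure (TT ⁻¹' A) = TT ⁻¹' closure A :=
  (TT.toHomeomorph.preimage_closure A).symm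
lemma TT_frontier (A : Set E2) : frontier (TT ⁻¹' A) = TT ⁻¹' frontier A :=
  (TT.toHomeomorph.preimage_frontier A).symm

lemma TT_contDiffOn {n : WithTop ℕ∞} {f : E2 → ℝ} {A : Set E2} (h : ContDiffOn ℝ n f A) :
    ContDiffOn ℝ n (fun z => f (TT z)) (TT ⁻¹' A) :=
  h.comp TT.contDiff.contDiffOn (fun _ hx => hx)

lemma TT_src {Ω : Set E2} (hΩ : IsOpen Ω) (V v : E2 → ℝ) (l : ℝ) :
    ∫ x, src (TT ⁻¹' Ω) (fun z => V (TT z)) (fun z => v (TT z)) l x =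
    ∫ x in Ω, l * V x * Real.exp (v x) := by
  unfold src
  rw [integral_indicator (hΩ.preimage TT.continuous).measurableSet]
  exact TT.measurePreserving.setIntegral_preimage_emb TT.toHomeomorph.measurableEmbedding
    (fun x => l * V x * Real.exp (v x)) Ω

lemma prob {m : ℕ} (S : Setting m) (k : ℕ) :
    Prob (TT ⁻¹' S.Ω) (fun z => S.V (TT z)) (fun z => S.v k (TT z)) (S.lam k) where
  hopen := S.hopen.preimage TT.continuous
  hbd := by
    obtain ⟨D, hD⟩ := S.hbd.exists_norm_le
    refine (isBounded_iff_forall_norm_le).2 ⟨D, fun x hx => ?_⟩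
    have := hD _ hx
    rwa [TT.norm_map] at this
  hVc := by
    rw [TT_closure]
    exact S.hVreg.continuousOn.comp TT.continuous.continuousOn fun _ hx => hx
  hVpos := by
    rw [TT_closure]
    exact fun x hx => S.hVpos _ hx
  hl := S.hlam_pos k
  hv2 := TT_contDiffOn (S.hv_reg k)
  hvc := by
    rw [TT_closure]
    exact (S.hv_cont k).comp TT.continuous.continuousOn fun _ hx => hx
  hPDE := fun x hx => by rw [TT_lap]; exact S.hPDE k _ hx
  hBC := by
    rw [TT_frontier]
    exact fun x hx => S.hBC k _ hx

theorem transfer {m : ℕ} (S : Setting m) (j : Fin m) :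
    ∃ c, Tendsto (fun k => S.v k (S.xpt j k) + 2 * Real.log (S.lam k)) atTop (𝓝 c) := by
  have hR := S.hR
  set R := min (S.R / 8) 1 with hRdef
  have hR0 : 0 < R := lt_min (by positivity) one_pos
  have hR1 : R ≤ 1 := min_le_right _ _
  have hR8 : R ≤ S.R / 8 := min_le_left _ _
  obtain ⟨D, hD⟩ := S.hbd.closure.exists_norm_le
  have hcomp : IsCompact (closure S.Ω) := S.hbd.isCompact_closure
  have hne : (closure S.Ω).Nonempty := ⟨_, subset_closure (S.hx_mem j)⟩
  obtain ⟨xa, hxa, hmin⟩ := hcomp.exists_isMinOn hne S.hVreg.continuousOn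
  obtain ⟨xb, hxb, hmax⟩ := hcomp.exists_isMaxOn hne S.hVreg.continuousOn
  have ev : ∀ᶠ k in atTop, (∀ j, ‖S.xpt j k - S.xstar j‖ ≤ R / 8) ∧ (∀ j, 0 ≤ S.v k (S.xpt j k)) ∧
      ∫ x in S.Ω, S.lam k * S.V x * Real.exp (S.v k x) ≤ 8 * π * m + 1 := by
    refine Eventually.and ?_ (Eventually.and ?_ ?_)
    · rw [eventually_all]
      intro j
      filter_upwards [(S.hxpt_lim j).eventually (closedBall_mem_nhds _ (by positivity : 0 < R / 8))]
        with k hk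
      rwa [dist_eq_norm] at hk
    · rw [eventually_all]
      intro j
      exact (S.hxpt_blow j).eventually_ge_atTop 0
    · exact S.hmass.eventually (ge_mem_nhds (by linarith)) 
  obtain ⟨K0, hK0⟩ := eventually_atTop.1 ev
  have hT := fun k => hK0 (k + K0) (Nat.le_add_left _ _)
  have hsh := tendsto_add_atTop_nat K0
  let Q : Sq m :=
    { Ω := TT ⁻¹' S.Ω
      V := fun z => S.V (TT z)
      lam := fun k => S.lam (k + K0)
      v := fun k z => S.v (k + K0) (TT z)
      xs := fun j => TT.symm (S.xstar j)
      xp := fun j k => TT.symm (S.xpt j (k + K0))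
      R := R
      a := S.V xa
      b := S.V xb
      M := 8 * π * m + 1
      D := max D 1
      hP := fun k => prob S (k + K0)
      hVd := TT_contDiffOn (S.hVreg.mono subset_closure)
      ha := S.hVpos _ hxa
      haV := fun x hx => hmin (subset_closure hx)
      hb := S.hVpos _ hxb
      hbV := fun x hx => hmax (subset_closure hx)
      hD1 := le_max_right _ _
      hD := fun x hx => by
        rw [TT_closure] at hx
        have := hD _ hx
        rw [TT.norm_map] at this
        exact this.trans (le_max_left _ _)
      hlam0 := S.hlam0.comp hsh
      hmass := by
        simp_rw [TT_src S.hopen]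
        exact S.hmass.comp hsh
      hM0 := by have := Real.pi_pos; positivity
      hM := fun k => by
        rw [TT_src S.hopen]
        exact (hT k).2.2
      hR := hR0
      hR1 := hR1
      hball := fun i => by
        rw [← TT.preimage_closedBall]
        exact Set.preimage_mono ((closedBall_subset_closedBall (by linarith)).trans (S.hR2 i))
      hsep := fun i l hil => by
        rw [← map_sub, TT.symm.norm_map]
        by_contra h
        push Not at h
        have hb : S.xstar l ∈ ball (S.xstar i) S.R := ?_
        · exact Set.disjoint_left.1 (S.hRdisj i l hil) hb (mem_ball_self hR)
        rw [mem_ball, dist_comm, dist_eq_norm]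
        linarith
      hlim := fun i => (TT.symm.continuous.tendsto _).comp ((S.hxpt_lim i).comp hsh)
      hnear := fun i k => by
        rw [← map_sub, TT.symm.norm_map]
        exact (hT k).1 i
      hmax := fun i k y hy => by
        rw [TT.apply_symm_apply]
        refine S.hxpt_max i _ _ ?_
        rw [mem_ball] at hy ⊢
        rw [← TT.symm.dist_map, TT.symm_apply_apply]
        linarith
      hblow := fun i => by
        simp only [TT.apply_symm_apply]
        exact (S.hxpt_blow i).comp hsh
      hv0 := fun i k => by
        rw [TT.apply_symm_apply]
        exact (hT k).2.1 i }
  obtain ⟨c, hc⟩ := Q.main j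
  refine ⟨c, (tendsto_add_atTop_iff_nat K0).1 (hc.congr fun k => ?_)⟩
  change S.v (k + K0) (TT (TT.symm (S.xpt j (k + K0)))) + _ = _
  rw [TT.apply_symm_apply]

theorem final {m : ℕ} (S : Setting m) :
    ∃ d : Fin m → ℝ, (∀ j, 0 < d j) ∧ ∀ j : Fin m,
      (∃ err : ℕ → ℝ, Tendsto err atTop (𝓝 0) ∧
        ∀ k, S.delta j k = d j * Real.sqrt (S.lam k) + err k * Real.sqrt (S.lam k)) ∧
      (∃ err : ℕ → ℝ, Tendsto err atTop (𝓝 0) ∧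
        ∀ᶠ k in atTop, S.v k (S.xpt j k) =
          -2 * Real.log (S.lam k) - 2 * Real.log (d j)
            - Real.log (S.V (S.xpt j k)) + err k) := by
  choose c hc using transfer S
  have hR := S.hR
  have hV : ∀ j k, 0 < S.V (S.xpt j k) := fun j k => S.hVpos _ (subset_closure
    (S.hR2 j (ball_subset_closedBall (ball_subset_ball (by linarith) (S.hxpt_mem j k)))))
  have hVl : ∀ j, Tendsto (fun k => Real.log (S.V (S.xpt j k))) atTop
      (𝓝 (Real.log (S.V (S.xstar j)))) := by
    intro j
    refine Tendsto.log ?_ (S.hVpos _ (subset_closure (S.hx_mem j))).ne'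
    have h1 : ContinuousAt S.V (S.xstar j) :=
      (S.hVreg.continuousOn.mono subset_closure).continuousAt (S.hopen.mem_nhds (S.hx_mem j))
    exact h1.tendsto.comp (S.hxpt_lim j)
  refine ⟨fun j => Real.exp (-(c j + Real.log (S.V (S.xstar j))) / 2), fun j => Real.exp_pos _,
    fun j => ⟨?_, ?_⟩⟩
  · have h1 : Tendsto (fun k => Real.exp (-((S.v k (S.xpt j k) + 2 * Real.log (S.lam k)) +
        Real.log (S.V (S.xpt j k))) / 2)) atTop
        (𝓝 (Real.exp (-(c j + Real.log (S.V (S.xstar j))) / 2))) :=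
      (Real.continuous_exp.tendsto _).comp ((((hc j).add (hVl j)).neg).div_const 2)
    have h2 := h1.sub_const (Real.exp (-(c j + Real.log (S.V (S.xstar j))) / 2))
    rw [sub_self] at h2
    refine ⟨_, h2, fun k => ?_⟩
    have hl := S.hlam_pos k
    have hv := hV j k
    rw [← add_mul, add_sub_cancel]
    have hp : 0 < S.lam k * S.V (S.xpt j k) * Real.exp (S.v k (S.xpt j k)) := by positivity
    unfold Setting.delta
    refine Real.log_injOn_pos (Set.mem_Ioi.2 (by positivity)) (Set.mem_Ioi.2 (by positivity)) ?_
    rw [Real.log_inv, Real.log_sqrt hp.le, Real.log_mul (by positivity) (by positivity),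
      Real.log_mul hl.ne' hv.ne', Real.log_exp, Real.log_mul (by positivity) (by positivity),
      Real.log_exp, Real.log_sqrt hl.le]
    ring
  · refine ⟨fun k => (S.v k (S.xpt j k) + 2 * Real.log (S.lam k)) + Real.log (S.V (S.xpt j k)) -
      (c j + Real.log (S.V (S.xstar j))), ?_, Eventually.of_forall fun k => ?_⟩
    · simpa using ((hc j).add (hVl j)).sub_const (c j + Real.log (S.V (S.xstar j)))
    · simp only [Real.log_exp]
      ring

end BU

end

/-- there exist constants `d_j > 0` with
`δ_{j,k} = d_j λ_k^{1/2} + o(λ_k^{1/2})`, and consequently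
`v_k(x_{j,k}) = −2 log λ_k − 2 log d_j − log V(x_{j,k}) + o(1)`. -/
theorem statement16 {m : ℕ} (S : Setting m) :
    ∃ d : Fin m → ℝ, (∀ j, 0 < d j) ∧ ∀ j : Fin m,
      (∃ err : ℕ → ℝ, Tendsto err atTop (𝓝 0) ∧
        ∀ k, S.delta j k = d j * Real.sqrt (S.lam k) + err k * Real.sqrt (S.lam k)) ∧
      (∃ err : ℕ → ℝ, Tendsto err atTop (𝓝 0) ∧
        ∀ᶠ k in atTop, S.v k (S.xpt j k) =
          -2 * Real.log (S.lam k) - 2 * Real.log (d j)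
            - Real.log (S.V (S.xpt j k)) + err k) := by
  exact BU.final S
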